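/- arXiv:1505.04652 — 3 statements merged into one kernel-verified Lean document; each statement's English description precedes it below -/
import Mathlib

section
/- Let f : ℕ → ℝ be a multiplicative arithmetic function (f(1) = 1 and f(mn) = f(m)f(n) whenever gcd(m,n) = 1) satisfying 0 ≤ f(n) ≤ 1 for all positive integers n. Suppose there are positive real constants τ and β such that ∑_{p ≤ x, p prime} f(p) = τ·x/log x + O(x/(log x)^{1+β}) as x → ∞. Then there exists a positive constant C_f such that ∑_{n ≤ x} f(n) ∼ C_f · x·(log x)^{τ−1} as x → ∞. -/
open Filter Real

theorem abs_sub_le_of_right_deriv_le {H H' : ℝ → ℝ} {β K a b : ℝ} (hβ : 0 < β) (ha : 0 < a)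
    (hab : a ≤ b) (hH : ContinuousOn H (Set.Icc a b))
    (hH' : ∀ u ∈ Set.Ico a b, HasDerivWithinAt H (H' u) (Set.Ici u) u)
    (bound : ∀ u ∈ Set.Ico a b, |H' u| ≤ K * u ^ (-β - 1)) (hK : 0 ≤ K) :
    |H b - H a| ≤ K / β * a ^ (-β) := by
  have hB (x : ℝ) (hx : 0 < x) :
      HasDerivAt (fun x : ℝ => K / β * (a ^ (-β) - x ^ (-β))) (K * x ^ (-β - 1)) x := by
    have := ((hasDerivAt_rpow_const (x := x) (p := -β) (Or.inl hx.ne')).const_sub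
      (a ^ (-β))).const_mul (K / β)
    exact this.congr_deriv (by field_simp)
  have key := image_norm_le_of_norm_deriv_right_le_deriv_boundary' (f := fun x => H x - H a)
    (f' := H') (a := a) (b := b) (B := fun x : ℝ => K / β * (a ^ (-β) - x ^ (-β)))
    (B' := fun x => K * x ^ (-β - 1))
    (hH.sub continuousOn_const) (fun x hx => (hH' x hx).sub_const _) (by simp)
    (fun x hx => (hB x (ha.trans_le hx.1)).continuousAt.continuousWithinAt)
    (fun x hx => (hB x (ha.trans_le hx.1)).hasDerivWithinAt) bound (Set.right_mem_Icc.2 hab)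
  have hb : 0 ≤ b ^ (-β) := rpow_nonneg (ha.le.trans hab) _
  have : 0 ≤ K / β := by positivity
  calc |H b - H a| ≤ K / β * (a ^ (-β) - b ^ (-β)) := key
    _ ≤ _ := by gcongr; linarith

theorem exists_tendsto_of_right_deriv_le {H H' : ℝ → ℝ} {β K U : ℝ} (hβ : 0 < β) (hU : 0 < U)
    (hK : 0 ≤ K) (hH : ContinuousOn H (Set.Ici U))
    (hH' : ∀ u ≥ U, HasDerivWithinAt H (H' u) (Set.Ici u) u)
    (bound : ∀ u ≥ U, |H' u| ≤ K * u ^ (-β - 1)) :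
    ∃ c, Tendsto H atTop (nhds c) := by
  have hcs : CauchySeq (fun u => H (max u U)) := by
    refine cauchySeq_of_le_tendsto_0 (fun N => 2 * (K / β * (max N U) ^ (-β))) ?_ ?_
    · have aux (n N : ℝ) (h : N ≤ n) :
          |H (max n U) - H (max N U)| ≤ K / β * (max N U) ^ (-β) :=
        abs_sub_le_of_right_deriv_le hβ (lt_max_of_lt_right hU) (max_le_max_right _ h)
          (hH.mono fun x hx => (le_max_right _ _).trans hx.1)
          (fun u hu => hH' u ((le_max_right _ _).trans hu.1))
          (fun u hu => bound u ((le_max_right _ _).trans hu.1)) hK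
      intro n m N hn hm
      rw [Real.dist_eq]
      have h1 := abs_sub_le (H (max n U)) (H (max N U)) (H (max m U))
      have h2 := aux n N hn
      have h3 := aux m N hm
      rw [abs_sub_comm] at h3
      linarith
    · have h1 : Tendsto (fun N : ℝ => max N U) atTop atTop :=
        tendsto_atTop_mono (fun _ => le_max_left _ _) tendsto_id
      simpa using (((tendsto_rpow_neg_atTop hβ).comp h1).const_mul (K / β)).const_mul 2
  obtain ⟨c, hc⟩ := cauchySeq_tendsto_of_complete hcs
  refine ⟨c, hc.congr' ?_⟩
  filter_upwards [eventually_ge_atTop U] with u hu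
  rw [max_eq_left hu]

/-- If `u G' ≈ (τ + 1) G` up to a relative error `O(u ^ (-β))`, then `G' ∼ C u ^ τ`. -/
theorem exists_tendsto_right_deriv_div_rpow {G G' : ℝ → ℝ} {τ β K : ℝ} (hτ : 0 < τ) (hβ : 0 < β)
    (hK : 0 ≤ K) (hG : ContinuousOn G (Set.Ici 1))
    (hG' : ∀ u ≥ 1, HasDerivWithinAt G (G' u) (Set.Ici u) u)
    (hpos : ∀ u ≥ 1, 0 < G u) (hpos' : ∀ u ≥ 1, 0 ≤ G' u)
    (h : ∀ u ≥ 1, |u * G' u - (τ + 1) * G u| ≤ K * u ^ (1 - β) * G' u) :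
    ∃ C, 0 < C ∧ Tendsto (fun u => G' u / u ^ τ) atTop (nhds C) := by
  have hlim : Tendsto (fun u : ℝ => K * u ^ (-β)) atTop (nhds 0) := by
    simpa using (tendsto_rpow_neg_atTop hβ).const_mul K
  obtain ⟨U, hU⟩ := eventually_atTop.1
    ((hlim.eventually_le_const (by norm_num : (0 : ℝ) < 1 / 2)).and (eventually_ge_atTop 1))
  have hU1 : 1 ≤ U := (hU U le_rfl).2
  have hbd (u : ℝ) (hu : U ≤ u) :
      |G' u / G u - (τ + 1) / u| ≤ 2 * (τ + 1) * K * u ^ (-β - 1) := by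
    have hu1 : 1 ≤ u := hU1.trans hu
    have hu0 : 0 < u := by linarith
    have h1 := h u hu1
    have e1 : u ^ (1 - β) = u * u ^ (-β) := by
      rw [sub_eq_add_neg, rpow_add hu0, rpow_one]
    have e2 : u ^ (-β - 1) = u ^ (-β) / u := rpow_sub_one hu0.ne' _
    have hG0 := hpos u hu1
    have hG1 := hpos' u hu1
    have hs := (hU u hu).1
    set s := u ^ (-β) with hs_def
    have hs0 : 0 ≤ s := rpow_nonneg hu0.le _
    rw [e1] at h1
    rw [e2]
    have h2 : u * G' u ≤ 2 * (τ + 1) * G u := by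
      have := (abs_le.1 h1).2
      have h3 : K * s * (u * G' u) ≤ 1 / 2 * (u * G' u) := by gcongr
      nlinarith
    have : G' u / G u - (τ + 1) / u = (u * G' u - (τ + 1) * G u) / (u * G u) := by
      field_simp
    rw [this, abs_div, abs_of_pos (mul_pos hu0 hG0), div_le_iff₀ (mul_pos hu0 hG0)]
    calc _ ≤ _ := h1
      _ = K * s * (u * G' u) := by ring
      _ ≤ K * s * (2 * (τ + 1) * G u) := by gcongr
      _ = _ := by field_simp
  obtain ⟨c, hc⟩ := exists_tendsto_of_right_deriv_le (H := fun u => log (G u) - (τ + 1) * log u)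
    (H' := fun u => G' u / G u - (τ + 1) / u) hβ (by linarith : 0 < U)
    (by positivity : 0 ≤ 2 * (τ + 1) * K)
    (((hG.mono (Set.Ici_subset_Ici.2 hU1)).log fun u hu => (hpos u (hU1.trans hu)).ne').sub
      (continuousOn_const.mul (continuousOn_log.mono fun u hu => by
        have : 1 ≤ u := hU1.trans hu
        simp only [Set.mem_compl_iff, Set.mem_singleton_iff]; linarith)))
    (fun u hu => by
      have hu1 : 1 ≤ u := hU1.trans hu
      refine ((hG' u hu1).log (hpos u hu1).ne').sub ?_
      rw [div_eq_mul_inv]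
      exact ((hasDerivAt_log (by linarith)).const_mul _).hasDerivWithinAt) hbd
  have hGlim : Tendsto (fun u => G u / u ^ (τ + 1)) atTop (nhds (exp c)) := by
    refine ((continuous_exp.tendsto c).comp hc).congr' ?_
    filter_upwards [eventually_ge_atTop 1] with u hu
    have hu0 : 0 < u := by linarith
    simp only [Function.comp]
    rw [exp_sub, exp_log (hpos u hu), rpow_def_of_pos hu0, mul_comm (log u)]
  have hratio : Tendsto (fun u => u * (G' u / G u)) atTop (nhds (τ + 1)) := by
    rw [tendsto_iff_norm_sub_tendsto_zero]
    refine squeeze_zero' (.of_forall fun _ => norm_nonneg _) ?_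
      (g := fun u => 2 * (τ + 1) * (K * u ^ (-β))) (by simpa using hlim.const_mul (2 * (τ + 1)))
    filter_upwards [eventually_ge_atTop U] with u hu
    have hu0 : 0 < u := by linarith
    have : u * (G' u / G u) - (τ + 1) = u * (G' u / G u - (τ + 1) / u) := by field_simp
    rw [this, norm_mul, norm_of_nonneg hu0.le]
    calc _ ≤ u * (2 * (τ + 1) * K * u ^ (-β - 1)) := by gcongr; exact hbd u hu
      _ = _ := by rw [rpow_sub_one hu0.ne']; field_simp
  refine ⟨exp c * (τ + 1), by positivity, (hGlim.mul hratio).congr' ?_⟩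
  filter_upwards [eventually_ge_atTop 1] with u hu
  have hu0 : 0 < u := by linarith
  have := hpos u hu
  rw [rpow_add_one hu0.ne']
  field_simp

theorem sum_Ioc_sum_divisorsAntidiagonal (u v : ℕ → ℝ) (N : ℕ) :
    ∑ n ∈ Finset.Ioc 0 N, ∑ x ∈ n.divisorsAntidiagonal, u x.1 * v x.2 =
      ∑ m ∈ Finset.Ioc 0 N, u m * ∑ d ∈ Finset.Ioc 0 (N / m), v d := by
  let toAF (w : ℕ → ℝ) : ArithmeticFunction ℝ := ⟨fun n => if n = 0 then 0 else w n, if_pos rfl⟩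
  have h (w : ℕ → ℝ) (n : ℕ) (hn : n ≠ 0) : toAF w n = w n := if_neg hn
  have key := ArithmeticFunction.sum_Ioc_mul_eq_sum_sum (toAF u) (toAF v) N
  convert key using 1
  · refine Finset.sum_congr rfl fun n _ => ?_
    rw [ArithmeticFunction.mul_apply]
    refine Finset.sum_congr rfl fun x hx => ?_
    rw [h u _ (Nat.ne_zero_of_mem_divisorsAntidiagonal hx).1,
      h v _ (Nat.ne_zero_of_mem_divisorsAntidiagonal hx).2]
  · refine Finset.sum_congr rfl fun m hm => ?_
    rw [h u _ (Finset.mem_Ioc.1 hm).1.ne']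
    congr 1
    exact Finset.sum_congr rfl fun d hd => (h v _ (Finset.mem_Ioc.1 hd).1.ne').symm

/-- `log d` on the prime powers `d` that are not primes, and `0` elsewhere. -/
noncomputable def properPrimePowLog (d : ℕ) : ℝ :=
  open Classical in if IsPrimePow d ∧ ¬ d.Prime then log d else 0

theorem properPrimePowLog_nonneg (d : ℕ) : 0 ≤ properPrimePowLog d := by
  unfold properPrimePowLog
  split_ifs
  · exact log_natCast_nonneg d
  · exact le_rfl

theorem properPrimePowLog_le (d : ℕ) :
    properPrimePowLog d ≤
      (if d.Prime then 0 else ArithmeticFunction.vonMangoldt d) * log d / log 2 := by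
  unfold properPrimePowLog
  have h2 : 0 < log 2 := log_pos one_lt_two
  split_ifs with h h' h'
  · exact absurd h' h.2
  · rw [ArithmeticFunction.vonMangoldt_apply, if_pos h.1, le_div_iff₀ h2, mul_comm]
    have hd : 1 < d := h.1.one_lt
    have : log 2 ≤ log d.minFac := by
      gcongr
      exact_mod_cast (Nat.minFac_prime hd.ne').two_le
    gcongr
  · simp
  · have := log_natCast_nonneg d
    have := ArithmeticFunction.vonMangoldt_nonneg (n := d)
    positivity

theorem summable_properPrimePowLog_div : Summable fun d : ℕ => properPrimePowLog d / d := by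
  obtain ⟨C, hC⟩ := Chebyshev.psi_sub_theta_le_mul_sqrt
  have hO : (fun n : ℕ => ∑ k ∈ Finset.Icc 1 n, properPrimePowLog k) =O[atTop]
      fun n : ℕ => (n : ℝ) ^ (3 / 4 : ℝ) := by
    have h1 : (fun x : ℝ => log x) =o[atTop] fun x => x ^ (1 / 4 : ℝ) :=
      isLittleO_log_rpow_atTop (by norm_num)
    have h2 : (fun x : ℝ => √x * log x) =O[atTop] fun x => x ^ (3 / 4 : ℝ) := by
      refine ((Asymptotics.isBigO_refl (fun x : ℝ => √x) atTop).mul h1.isBigO).congr' .rfl ?_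
      filter_upwards [eventually_gt_atTop 0] with x hx
      rw [sqrt_eq_rpow, ← rpow_add hx]; norm_num
    refine .trans (.of_bound (|C| / log 2) ?_) (h2.comp_tendsto tendsto_natCast_atTop_atTop)
    refine .of_forall fun n => ?_
    have h2 : 0 < log 2 := log_pos one_lt_two
    have hn : 0 ≤ log n := log_natCast_nonneg n
    rw [norm_of_nonneg (Finset.sum_nonneg fun k _ => properPrimePowLog_nonneg k)]
    simp only [Function.comp]
    rw [norm_of_nonneg (by positivity)]
    calc ∑ k ∈ Finset.Icc 1 n, properPrimePowLog k
        ≤ ∑ k ∈ Finset.Icc 1 n,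
            (if k.Prime then 0 else ArithmeticFunction.vonMangoldt k) * (log n / log 2) := by
          refine Finset.sum_le_sum fun k hk => (properPrimePowLog_le k).trans ?_
          rw [mul_div_assoc]
          have hk := Finset.mem_Icc.1 hk
          have hk0 : (0 : ℝ) < k := by exact_mod_cast hk.1
          have : (k : ℝ) ≤ n := by exact_mod_cast hk.2
          gcongr
      _ = (Chebyshev.psi n - Chebyshev.theta n) * (log n / log 2) := by
          rw [← Finset.sum_mul, Chebyshev.psi_sub_theta_eq_sum_not_prime, Finset.sum_filter,
            Nat.floor_natCast]
          congr 1
          refine Finset.sum_congr rfl fun k _ => ?_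
          split_ifs <;> rfl
      _ ≤ (|C| * √n) * (log n / log 2) := by
          gcongr
          exact (hC n).trans (by gcongr; exact le_abs_self C)
      _ = _ := by ring
  have := LSeriesSummable_of_sum_norm_bigO_and_nonneg (s := 1) hO properPrimePowLog_nonneg
    (by norm_num) (by norm_num)
  have := this.norm
  refine this.congr fun d => ?_
  rcases eq_or_ne d 0 with rfl | hd
  · simp
  · rw [LSeries.term_of_ne_zero hd]
    simp [abs_of_nonneg (properPrimePowLog_nonneg d)]

theorem abs_mul_log_sub_sum_le {f : ℕ → ℝ}
    (hf_mul : ∀ m n : ℕ, Nat.Coprime m n → f (m * n) = f m * f n)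
    (hf_nonneg : ∀ n : ℕ, 0 < n → 0 ≤ f n) (hf_le_one : ∀ n : ℕ, 0 < n → f n ≤ 1)
    {n : ℕ} (hn : n ≠ 0) :
    |f n * log n - ∑ x ∈ n.divisorsAntidiagonal, f x.1 * (if x.2.Prime then f x.2 * log x.2 else 0)|
      ≤ ∑ x ∈ n.divisorsAntidiagonal, f x.1 * properPrimePowLog x.2 := by
  have hlog : log n = ∑ p ∈ n.primeFactors, n.factorization p * log p := by
    have := Real.log_nat_eq_sum_factorization n
    rw [this]; rfl
  have hS : ∑ x ∈ n.divisorsAntidiagonal, f x.1 * (if x.2.Prime then f x.2 * log x.2 else 0)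
      = ∑ p ∈ n.primeFactors, f (n / p) * (f p * log p) := by
    rw [Nat.sum_divisorsAntidiagonal' (fun a b => f a * (if b.Prime then f b * log b else 0)),
      show n.primeFactors = n.divisors.filter Nat.Prime by ext p; simp; tauto, Finset.sum_filter]
    refine Finset.sum_congr rfl fun p _ => ?_
    split_ifs <;> simp
  have hg : ∑ p ∈ n.primeFactors, f (n / p ^ n.factorization p) *
      properPrimePowLog (p ^ n.factorization p) ≤
      ∑ x ∈ n.divisorsAntidiagonal, f x.1 * properPrimePowLog x.2 := by
    rw [Nat.sum_divisorsAntidiagonal' (fun a b => f a * properPrimePowLog b)]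
    rw [← Finset.sum_image (s := n.primeFactors) (g := fun p => p ^ n.factorization p)
      (f := fun d => f (n / d) * properPrimePowLog d)]
    · refine Finset.sum_le_sum_of_subset_of_nonneg ?_ fun d hd _ => ?_
      · intro d hd
        obtain ⟨p, _, rfl⟩ := Finset.mem_image.1 hd
        exact Nat.mem_divisors.2 ⟨Nat.ordProj_dvd n p, hn⟩
      · have := Nat.div_pos (Nat.divisor_le hd) (Nat.pos_of_mem_divisors hd)
        exact mul_nonneg (hf_nonneg _ this) (properPrimePowLog_nonneg d)
    · intro p hp q hq hpq
      have hp' := Nat.prime_of_mem_primeFactors hp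
      have hq' := Nat.prime_of_mem_primeFactors hq
      have hv : n.factorization p ≠ 0 :=
        (hp'.factorization_pos_of_dvd hn (Nat.dvd_of_mem_primeFactors hp)).ne'
      have : p ∣ q ^ n.factorization q := by
        rw [← show p ^ n.factorization p = q ^ n.factorization q from hpq]
        exact dvd_pow_self p hv
      exact (Nat.prime_dvd_prime_iff_eq hp' hq').1 (hp'.dvd_of_dvd_pow this)
  refine le_trans ?_ hg
  rw [hlog, hS, Finset.mul_sum, ← Finset.sum_sub_distrib]
  refine (Finset.abs_sum_le_sum_abs _ _).trans (Finset.sum_le_sum fun p hp => ?_)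
  have hp' := Nat.prime_of_mem_primeFactors hp
  have hpn := Nat.dvd_of_mem_primeFactors hp
  have hk1 : 1 ≤ n.factorization p := hp'.factorization_pos_of_dvd hn hpn
  set k := n.factorization p with hk
  set m := n / p ^ k with hm
  have hnm : n = p ^ k * m := (Nat.ordProj_mul_ordCompl_eq_self n p).symm
  have hcop : Nat.Coprime p m := Nat.coprime_ordCompl hp' hn
  have hm0 : 0 < m := Nat.ordCompl_pos p hn
  have hfn : f n = f (p ^ k) * f m := by
    conv_lhs => rw [hnm]
    exact hf_mul _ _ (hcop.pow_left k)
  have hnp : f (n / p) = f (p ^ (k - 1)) * f m := by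
    have : n / p = p ^ (k - 1) * m := by
      conv_lhs => rw [hnm]
      obtain ⟨j, hj⟩ : ∃ j, k = j + 1 := ⟨k - 1, by omega⟩
      rw [hj, pow_succ, mul_right_comm, Nat.mul_div_cancel _ hp'.pos, Nat.add_sub_cancel]
    rw [this]
    exact hf_mul _ _ (hcop.pow_left _)
  have hlp : 0 ≤ log p := log_natCast_nonneg p
  have hfm := hf_nonneg m hm0
  have hpp := fun j : ℕ => pow_pos hp'.pos j
  rcases hk1.eq_or_lt with h1 | h2
  · have h0 : f (n / p) * f p = f n := by
      rw [hnp, hfn, ← h1]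
      have hf1 : f 1 * f m = f m := by rw [← hf_mul 1 m (Nat.coprime_one_left m), one_mul]
      simp only [Nat.sub_self, pow_zero, pow_one, hf1]
      ring
    rw [← mul_assoc (f (n / p)), h0, ← h1]
    simp only [Nat.cast_one, one_mul, sub_self, abs_zero]
    exact mul_nonneg hfm (properPrimePowLog_nonneg _)
  · have hval : properPrimePowLog (p ^ k) = k * log p := by
      have : IsPrimePow (p ^ k) ∧ ¬ (p ^ k).Prime :=
        ⟨hp'.isPrimePow.pow (by omega), Nat.Prime.not_prime_pow h2⟩
      rw [properPrimePowLog, if_pos this]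
      push_cast
      rw [log_pow]
    rw [hval, hfn, hnp]
    have a0 := hf_nonneg _ (hpp k)
    have a1 := hf_le_one _ (hpp k)
    have b0 := hf_nonneg _ (hpp (k - 1))
    have b1 := hf_le_one _ (hpp (k - 1))
    have c0 := hf_nonneg p hp'.pos
    have c1 := hf_le_one p hp'.pos
    have hkl : (1 : ℝ) * log p ≤ k * log p := by gcongr; exact_mod_cast hk1
    have hkl0 : 0 ≤ k * log p := by positivity
    have e1 : 0 ≤ f (p ^ k) * f m * (k * log p) := by positivity
    have e2 : f (p ^ k) * f m * (k * log p) ≤ 1 * f m * (k * log p) := by gcongr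
    have e3 : 0 ≤ f (p ^ (k - 1)) * f m * (f p * log p) := by positivity
    have e4 : f (p ^ (k - 1)) * f m * (f p * log p) ≤ 1 * f m * (1 * log p) := by gcongr
    have e5 : 1 * f m * (1 * log p) ≤ 1 * f m * (k * log p) := by gcongr
    rw [abs_le]
    constructor <;> linarith

theorem one_sub_mul_rpow_mul_sub_le {a b β : ℝ} (ha : 0 < a) (hb : 0 ≤ b) (h0 : 0 ≤ β)
    (h1 : β ≤ 1) : (1 - β) * a ^ (-β) * (a - b) ≤ a ^ (1 - β) - b ^ (1 - β) := by
  have h := rpow_one_add_le_one_add_mul_self (s := b / a - 1) (by have := div_nonneg hb ha.le; linarith)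
    (p := 1 - β) (by linarith) (by linarith)
  rw [add_sub_cancel, div_rpow hb ha.le, div_le_iff₀ (rpow_pos_of_pos ha _)] at h
  have e : a ^ (1 - β) = a * a ^ (-β) := by rw [sub_eq_add_neg, rpow_add ha, rpow_one]
  rw [e] at h ⊢
  have : (1 + (1 - β) * (b / a - 1)) * (a * a ^ (-β)) =
      a * a ^ (-β) - (1 - β) * a ^ (-β) * (a - b) := by field_simp; ring
  linarith

theorem inv_add_one_le_log_sub_log {n : ℕ} (hn : 1 ≤ n) :
    1 / ((n : ℝ) + 1) ≤ log (n + 1) - log n ∧ log (n + 1) - log n ≤ 1 / n := by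
  have hn0 : (0 : ℝ) < n := by exact_mod_cast hn
  have hn1 : (0 : ℝ) < n + 1 := by linarith
  constructor
  · have := log_le_sub_one_of_pos (div_pos hn0 hn1)
    rw [log_div hn0.ne' hn1.ne'] at this
    have e : (n : ℝ) / (n + 1) - 1 = -(1 / (n + 1)) := by field_simp; ring
    linarith
  · have := log_le_sub_one_of_pos (div_pos hn1 hn0)
    rw [log_div hn1.ne' hn0.ne'] at this
    have e : ((n : ℝ) + 1) / n - 1 = 1 / n := by field_simp; ring
    linarith

/-- Partial summation: `∑_{d ≤ x} h d = τ x + O(x / (log x) ^ β)` yields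
`∑_{d ≤ n} h d / d = τ log n + O((log n) ^ (1 - β))`. -/
theorem exists_abs_sum_div_sub_log_le {h : ℕ → ℝ} {τ β K : ℝ} (hτ : 0 ≤ τ) (hβ : 0 < β)
    (hβ1 : β < 1) (hK : 0 ≤ K)
    (hS : ∀ x : ℝ, 1 ≤ x → |∑ d ∈ Finset.Ioc 0 ⌊x⌋₊, h d - τ * x| ≤ K * (x * (1 + log x) ^ (-β))) :
    ∃ K', 0 ≤ K' ∧ ∀ x : ℝ, 1 ≤ x →
      |∑ d ∈ Finset.Ioc 0 ⌊x⌋₊, h d / d - τ * log x| ≤ K' * (1 + log x) ^ (1 - β) := by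
  have hSn (n : ℕ) (hn : 1 ≤ n) : |(∑ d ∈ Finset.Ioc 0 n, h d) / n - τ| ≤ K * (1 + log n) ^ (-β) := by
    have h1 := hS n (by exact_mod_cast hn)
    have hn0 : (0 : ℝ) < n := by exact_mod_cast hn
    rw [Nat.floor_natCast] at h1
    have e : (∑ d ∈ Finset.Ioc 0 n, h d) / n - τ = (∑ d ∈ Finset.Ioc 0 n, h d - τ * n) / n := by
      field_simp
    rw [e, abs_div, abs_of_pos hn0, div_le_iff₀ hn0]
    linarith
  have hβ1' : 0 < 1 - β := by linarith
  set K1 := 2 * K / (1 - β) with hK1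
  have hK1' : 0 ≤ K1 := by positivity
  have hD (n : ℕ) (hn : 1 ≤ n) :
      |∑ d ∈ Finset.Ioc 0 n, h d / d - (∑ d ∈ Finset.Ioc 0 n, h d) / n - τ * log n| ≤
        K1 * (1 + log n) ^ (1 - β) + τ * (1 - 1 / n) := by
    induction n, hn using Nat.le_induction with
    | base => simp [hK1']
    | succ n hn ih =>
      have hn0 : (0 : ℝ) < n := by exact_mod_cast hn
      have hlog0 : 0 ≤ log n := log_natCast_nonneg n
      obtain ⟨hl1, hl2⟩ := inv_add_one_le_log_sub_log hn
      have hs := hSn n hn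
      rw [Finset.sum_Ioc_succ_top (Nat.zero_le n), Finset.sum_Ioc_succ_top (Nat.zero_le n)]
      push_cast
      set S := ∑ d ∈ Finset.Ioc 0 n, h d
      set P := ∑ d ∈ Finset.Ioc 0 n, h d / d
      have e : P + h (n + 1) / (n + 1) - (S + h (n + 1)) / (n + 1) - τ * log (n + 1) =
          (P - S / n - τ * log n) + (S / n - τ) / (n + 1) +
            τ * (1 / (n + 1) - (log (n + 1) - log n)) := by
        field_simp; ring
      rw [e]
      have h2 : |τ * (1 / (n + 1) - (log (n + 1) - log n))| ≤ τ * (1 / n - 1 / (n + 1)) := by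
        rw [abs_mul, abs_of_nonneg hτ]
        gcongr
        rw [abs_le]
        constructor <;> linarith
      have h3 : |(S / n - τ) / ((n : ℝ) + 1)| ≤
          K1 * ((1 + log (n + 1)) ^ (1 - β) - (1 + log n) ^ (1 - β)) := by
        have hn1 : (0 : ℝ) < n + 1 := by linarith
        rw [abs_div, abs_of_pos hn1]
        have ha : (0 : ℝ) < 1 + log (n + 1) := by linarith [div_pos one_pos hn1]
        have hb : (0 : ℝ) < 1 + log n := by linarith
        have hab : 1 + log (n + 1) ≤ 2 * (1 + log n) := by
          have : 1 / (n : ℝ) ≤ 1 := by rw [div_le_one hn0]; exact_mod_cast hn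
          linarith
        have hber := one_sub_mul_rpow_mul_sub_le ha hb.le hβ.le hβ1.le
        have hle : (1 + log n) ^ (-β) ≤ 2 * (1 + log (n + 1)) ^ (-β) := by
          have h5 : (2 * (1 + log n)) ^ (-β) ≤ (1 + log (n + 1)) ^ (-β) :=
            rpow_le_rpow_of_nonpos ha hab (by linarith)
          rw [mul_rpow (by norm_num) hb.le] at h5
          have h6 : (2 : ℝ) ^ (-1 : ℝ) ≤ 2 ^ (-β) :=
            rpow_le_rpow_of_exponent_le (by norm_num) (by linarith)
          have h7 : (2 : ℝ) ^ (-1 : ℝ) = 1 / 2 := by norm_num [rpow_neg_one]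
          rw [h7] at h6
          have h8 : 0 < (1 + log (n : ℝ)) ^ (-β) := rpow_pos_of_pos hb _
          nlinarith
        calc |S / n - τ| / (n + 1) ≤ K * (1 + log n) ^ (-β) / (n + 1) := by gcongr
          _ ≤ K * (2 * (1 + log (n + 1)) ^ (-β)) / (n + 1) := by gcongr
          _ = K1 * ((1 - β) * (1 + log (n + 1)) ^ (-β) * (1 / (n + 1))) := by
            rw [hK1]; field_simp
          _ ≤ K1 * ((1 - β) * (1 + log (n + 1)) ^ (-β) *
                ((1 + log (n + 1)) - (1 + log n))) := by
            gcongr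
            linarith
          _ ≤ _ := by gcongr
      calc _ ≤ _ := abs_add_three _ _ _
        _ ≤ (K1 * (1 + log n) ^ (1 - β) + τ * (1 - 1 / n)) +
            K1 * ((1 + log (n + 1)) ^ (1 - β) - (1 + log n) ^ (1 - β)) +
            τ * (1 / n - 1 / (n + 1)) := by gcongr
        _ = _ := by ring
  refine ⟨K1 + K + 3 * τ, by positivity, fun x hx => ?_⟩
  set n := ⌊x⌋₊ with hn_def
  have hn : 1 ≤ n := Nat.le_floor (by simpa using hx)
  have hn0 : (1 : ℝ) ≤ n := by exact_mod_cast hn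
  have hnx : (n : ℝ) ≤ x := Nat.floor_le (by linarith)
  have hxn : x ≤ 2 * n := by linarith [Nat.lt_floor_add_one x]
  have hlog0 : 0 ≤ log n := log_natCast_nonneg n
  have hl1 : log n ≤ log x := log_le_log (by linarith) hnx
  have hl2 : log x ≤ 1 + log n := by
    have h1 := log_le_log (by linarith) hxn
    rw [log_mul (by norm_num) (by linarith)] at h1
    linarith [log_two_lt_d9]
  have hD' := hD n hn
  have hs := hSn n hn
  have hpow : (1 + log n) ^ (1 - β) ≤ (1 + log x) ^ (1 - β) := by gcongr
  have hpow1 : 1 ≤ (1 + log x) ^ (1 - β) := one_le_rpow (by linarith) hβ1'.le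
  have hneg : (1 + log n) ^ (-β) ≤ 1 := rpow_le_one_of_one_le_of_nonpos (by linarith) (by linarith)
  set S := ∑ d ∈ Finset.Ioc 0 n, h d
  set P := ∑ d ∈ Finset.Ioc 0 n, h d / d
  have hs' : |S / n - τ| ≤ K := hs.trans (by nlinarith)
  have h1n : τ * (1 - 1 / n) ≤ τ * 1 := by
    gcongr
    have : 0 ≤ 1 / (n : ℝ) := by positivity
    linarith
  have hx' : |τ * (1 - (log x - log n))| ≤ τ * 1 := by
    rw [abs_mul, abs_of_nonneg hτ]
    gcongr
    rw [abs_le]; constructor <;> linarith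
  calc |P - τ * log x|
      = |(P - S / n - τ * log n) + (S / n - τ) + τ * (1 - (log x - log n))| := by
        congr 1; ring
    _ ≤ _ := abs_add_three _ _ _
    _ ≤ (K1 * (1 + log x) ^ (1 - β) + τ * 1) + K + τ * 1 := by
        gcongr
        exact hD'.trans (by gcongr)
    _ ≤ (K1 * (1 + log x) ^ (1 - β) + τ * 1) + K + τ * 1 +
        (K + 3 * τ) * ((1 + log x) ^ (1 - β) - 1) := by
        have : 0 ≤ (K + 3 * τ) * ((1 + log x) ^ (1 - β) - 1) :=
          mul_nonneg (by positivity) (by linarith)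
        linarith
    _ ≤ _ := by nlinarith

theorem abs_mul_log_sub_sum_prime_mul_log_le {f : ℕ → ℝ}
    (hf_nonneg : ∀ n : ℕ, 0 < n → 0 ≤ f n) (hf_le_one : ∀ n : ℕ, 0 < n → f n ≤ 1)
    {x : ℝ} (hx : exp 1 ≤ x) :
    |(∑ p ∈ (Finset.Icc 1 ⌊x⌋₊).filter Nat.Prime, f p) * log x -
      ∑ d ∈ Finset.Ioc 0 ⌊x⌋₊, (if d.Prime then f d * log d else 0)| ≤
      x / log x + (∑ p ∈ (Finset.Icc 1 ⌊x⌋₊).filter Nat.Prime, f p) * (2 * log (log x)) := by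
  have hx0 : 0 < x := (exp_pos 1).trans_le hx
  have hl1 : 1 ≤ log x := by rwa [le_log_iff_exp_le hx0]
  have hll : 0 ≤ log (log x) := log_nonneg hl1
  set z := x / log x ^ 2 with hz
  have hz0 : 0 < z := by positivity
  have e : ∑ d ∈ Finset.Ioc 0 ⌊x⌋₊, (if d.Prime then f d * log d else 0) =
      ∑ p ∈ (Finset.Icc 1 ⌊x⌋₊).filter Nat.Prime, f p * log p := by
    rw [Finset.sum_filter]; rfl
  have hcard : ∑ p ∈ (Finset.Icc 1 ⌊x⌋₊).filter Nat.Prime, (if (p : ℝ) ≤ z then log x else 0) ≤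
      x / log x := by
    calc _ ≤ ∑ p ∈ Finset.Ioc 0 ⌊z⌋₊, log x := by
          rw [← Finset.sum_filter]
          refine Finset.sum_le_sum_of_subset_of_nonneg (fun p hp => ?_) fun _ _ _ => by linarith
          simp only [Finset.mem_filter, Finset.mem_Icc] at hp
          exact Finset.mem_Ioc.2 ⟨hp.1.1.1, Nat.le_floor hp.2⟩
      _ = ⌊z⌋₊ * log x := by simp
      _ ≤ z * log x := by gcongr; exact Nat.floor_le hz0.le
      _ = x / log x := by rw [hz]; field_simp
  have hterm : ∀ p ∈ (Finset.Icc 1 ⌊x⌋₊).filter Nat.Prime, |f p * log x - f p * log p| ≤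
      (if (p : ℝ) ≤ z then log x else 0) + f p * (2 * log (log x)) := by
    intro p hp
    simp only [Finset.mem_filter, Finset.mem_Icc] at hp
    have hp0 : (0 : ℝ) < p := by exact_mod_cast hp.1.1
    have hpx : (p : ℝ) ≤ x := (Nat.le_floor_iff hx0.le).1 hp.1.2
    have hlp : 0 ≤ log p := log_natCast_nonneg p
    have hlpx : log p ≤ log x := log_le_log hp0 hpx
    have f0 := hf_nonneg p hp.1.1
    have f1 := hf_le_one p hp.1.1
    rw [← mul_sub, abs_of_nonneg (mul_nonneg f0 (by linarith))]
    split_ifs with hpz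
    · have : 0 ≤ f p * (2 * log (log x)) := by positivity
      nlinarith
    · rw [zero_add]
      gcongr
      push Not at hpz
      have := log_le_log hz0 hpz.le
      rw [hz, log_div hx0.ne' (by positivity), log_pow] at this
      push_cast at this
      linarith
  rw [e, Finset.sum_mul, ← Finset.sum_sub_distrib]
  refine (Finset.abs_sum_le_sum_abs _ _).trans ((Finset.sum_le_sum hterm).trans ?_)
  rw [Finset.sum_add_distrib, ← Finset.sum_mul]
  gcongr

theorem exists_abs_sum_prime_mul_log_sub_le {f : ℕ → ℝ} {τ β : ℝ} (hβ : 0 < β) (hβ1 : β < 1)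
    (hf_nonneg : ∀ n : ℕ, 0 < n → 0 ≤ f n) (hf_le_one : ∀ n : ℕ, 0 < n → f n ≤ 1)
    (hprimes :
      (fun x : ℝ => (∑ p ∈ (Finset.Icc 1 ⌊x⌋₊).filter Nat.Prime, f p) - τ * x / Real.log x)
        =O[atTop] (fun x : ℝ => x / Real.log x ^ (1 + β))) :
    ∃ K, 0 ≤ K ∧ ∀ x : ℝ, 1 ≤ x →
      |∑ d ∈ Finset.Ioc 0 ⌊x⌋₊, (if d.Prime then f d * log d else 0) - τ * x| ≤
        K * (x * (1 + log x) ^ (-β)) := by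
  set A := fun x : ℝ => ∑ p ∈ (Finset.Icc 1 ⌊x⌋₊).filter Nat.Prime, f p with hA
  set S := fun x : ℝ => ∑ d ∈ Finset.Ioc 0 ⌊x⌋₊, (if d.Prime then f d * log d else 0) with hSdef
  have hA0 (x : ℝ) : 0 ≤ A x := Finset.sum_nonneg fun p hp => by
    simp only [Finset.mem_filter, Finset.mem_Icc] at hp
    exact hf_nonneg p hp.1.1
  have hlogpos : ∀ᶠ x : ℝ in atTop, 1 ≤ log x ∧ 1 ≤ x :=
    (tendsto_log_atTop.eventually_ge_atTop 1).and (eventually_ge_atTop 1)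
  have hpow : (fun x : ℝ => x * log x ^ (-β)) =O[atTop] fun x => x * (1 + log x) ^ (-β) := by
    refine .of_bound (2 ^ β) ?_
    filter_upwards [hlogpos] with x ⟨hl, hx⟩
    rw [norm_of_nonneg (by positivity), norm_of_nonneg (by positivity)]
    have : (2 * log x) ^ (-β) ≤ (1 + log x) ^ (-β) :=
      rpow_le_rpow_of_nonpos (by linarith) (by linarith) (by linarith)
    rw [mul_rpow (by norm_num) (by linarith), rpow_neg (by norm_num), inv_mul_le_iff₀ (by positivity)]
      at this
    calc x * log x ^ (-β) ≤ x * (2 ^ β * (1 + log x) ^ (-β)) := by gcongr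
      _ = _ := by ring
  have h1 : (fun x => A x * log x - τ * x) =O[atTop] fun x => x * log x ^ (-β) := by
    refine (hprimes.mul (Asymptotics.isBigO_refl log atTop)).congr' ?_ ?_
    · filter_upwards [hlogpos] with x ⟨hl, hx⟩
      rw [hA, sub_mul]; field_simp
    · filter_upwards [hlogpos] with x ⟨hl, hx⟩
      rw [rpow_add (by linarith), rpow_one, rpow_neg (by linarith)]
      field_simp
  have hA1 : A =O[atTop] fun x => x / log x := by
    have : (fun x : ℝ => x / log x ^ (1 + β)) =O[atTop] fun x => x / log x := by
      refine .of_bound 1 ?_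
      filter_upwards [hlogpos] with x ⟨hl, hx⟩
      rw [norm_of_nonneg (by positivity), norm_of_nonneg (by positivity), one_mul]
      gcongr
      exact self_le_rpow_of_one_le hl (by linarith)
    have h3 := (hprimes.trans this).add ((Asymptotics.isBigO_refl (fun x : ℝ => x / log x) atTop).const_mul_left τ)
    refine h3.congr_left fun x => ?_
    rw [hA]; ring
  have hll : (fun x : ℝ => log (log x)) =O[atTop] fun x => log x ^ (1 - β) :=
    ((isLittleO_log_rpow_atTop (by linarith : 0 < 1 - β)).comp_tendsto tendsto_log_atTop).isBigO
  have hxl : (fun x : ℝ => x / log x * log x ^ (1 - β)) =ᶠ[atTop] fun x => x * log x ^ (-β) := by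
    filter_upwards [hlogpos] with x ⟨hl, hx⟩
    rw [sub_eq_add_neg, rpow_add (by linarith), rpow_one]
    field_simp
  have h2 : (fun x => A x * log x - S x) =O[atTop] fun x => x * log x ^ (-β) := by
    have hb : (fun x : ℝ => x / log x + A x * (2 * log (log x))) =O[atTop]
        fun x => x * log x ^ (-β) := by
      refine .add ?_ ((hA1.mul (hll.const_mul_left 2)).congr' .rfl hxl)
      refine .trans (.of_bound 1 ?_) hxl.isBigO
      filter_upwards [hlogpos] with x ⟨hl, hx⟩
      rw [norm_of_nonneg (by positivity), norm_of_nonneg (by positivity), one_mul]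
      exact le_mul_of_one_le_right (by positivity) (one_le_rpow hl (by linarith))
    refine .trans (.of_bound 1 ?_) hb
    filter_upwards [eventually_ge_atTop (exp 1)] with x hx
    rw [one_mul]
    exact (abs_mul_log_sub_sum_prime_mul_log_le hf_nonneg hf_le_one hx).trans (le_abs_self _)
  have h3 : (fun x => S x - τ * x) =O[atTop] fun x => x * (1 + log x) ^ (-β) :=
    ((h1.sub h2).congr_left fun x => by ring).trans hpow
  obtain ⟨C, hC0, hC⟩ := h3.exists_pos
  obtain ⟨X, hX⟩ := eventually_atTop.1 (hC.bound.and (eventually_ge_atTop 1))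
  have hX1 : 1 ≤ X := (hX X le_rfl).2
  have hlX : 0 ≤ log X := log_nonneg hX1
  have hd0 (d : ℕ) (hd : 0 < d) : 0 ≤ if d.Prime then f d * log d else 0 := by
    split_ifs
    · exact mul_nonneg (hf_nonneg d hd) (log_natCast_nonneg d)
    · exact le_rfl
  have hS0 (x : ℝ) : 0 ≤ S x := Finset.sum_nonneg fun d hd => hd0 d (Finset.mem_Ioc.1 hd).1
  set B := (S X + |τ| * X) * (1 + log X) ^ β with hB
  have hB0 : 0 ≤ B := by have := hS0 X; positivity
  refine ⟨C + B, by positivity, fun x hx => ?_⟩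
  have hlx : 0 ≤ log x := log_nonneg hx
  have hg0 : 0 ≤ x * (1 + log x) ^ (-β) := by positivity
  rcases le_total X x with h | h
  · have := (hX x h).1
    rw [norm_of_nonneg hg0, norm_eq_abs] at this
    nlinarith
  · have hSX : S x ≤ S X := Finset.sum_le_sum_of_subset_of_nonneg
      (Finset.Ioc_subset_Ioc_right (Nat.floor_mono h))
      fun d hd _ => hd0 d (Finset.mem_Ioc.1 hd).1
    have h5 : |S x - τ * x| ≤ S X + |τ| * X := by
      calc _ ≤ |S x| + |τ * x| := abs_sub _ _
        _ = S x + |τ| * x := by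
          rw [abs_of_nonneg (hS0 x), abs_mul, abs_of_nonneg (by linarith : 0 ≤ x)]
        _ ≤ _ := by gcongr
    have h6 : 1 ≤ (1 + log X) ^ β * (x * (1 + log x) ^ (-β)) := by
      have : (1 + log X) ^ (-β) ≤ (1 + log x) ^ (-β) :=
        rpow_le_rpow_of_nonpos (by linarith) (by gcongr) (by linarith)
      calc (1 : ℝ) = (1 + log X) ^ β * (1 * (1 + log X) ^ (-β)) := by
            rw [one_mul, ← rpow_add (by linarith)]; simp
        _ ≤ _ := by gcongr
    have h7 : 0 ≤ S X + |τ| * X := by have := hS0 X; positivity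
    calc |S x - τ * x| ≤ S X + |τ| * X := h5
      _ ≤ (S X + |τ| * X) * ((1 + log X) ^ β * (x * (1 + log x) ^ (-β))) :=
        le_mul_of_one_le_right h7 h6
      _ = B * (x * (1 + log x) ^ (-β)) := by rw [hB]; ring
      _ ≤ _ := by gcongr; linarith

theorem abs_sum_mul_log_sub_le {f c : ℕ → ℝ}
    (hf_mul : ∀ m n : ℕ, Nat.Coprime m n → f (m * n) = f m * f n)
    (hf_nonneg : ∀ n : ℕ, 0 < n → 0 ≤ f n) (hf_le_one : ∀ n : ℕ, 0 < n → f n ≤ 1)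
    (hc : ∀ n, 0 ≤ c n) (hc_mul : ∀ m n, c (m * n) = c m * c n) (N : ℕ) :
    |∑ n ∈ Finset.Ioc 0 N, f n * c n * log n -
        ∑ m ∈ Finset.Ioc 0 N, f m * c m *
          ∑ d ∈ Finset.Ioc 0 (N / m), (if d.Prime then f d * log d else 0) * c d| ≤
      ∑ m ∈ Finset.Ioc 0 N, f m * c m * ∑ d ∈ Finset.Ioc 0 (N / m), properPrimePowLog d * c d := by
  rw [← sum_Ioc_sum_divisorsAntidiagonal (fun m => f m * c m)
      (fun d => (if d.Prime then f d * log d else 0) * c d),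
    ← sum_Ioc_sum_divisorsAntidiagonal (fun m => f m * c m) (fun d => properPrimePowLog d * c d),
    ← Finset.sum_sub_distrib]
  refine (Finset.abs_sum_le_sum_abs _ _).trans (Finset.sum_le_sum fun n hn => ?_)
  have key := abs_mul_log_sub_sum_le hf_mul hf_nonneg hf_le_one (Finset.mem_Ioc.1 hn).1.ne'
  have e (v : ℕ → ℝ) : ∑ x ∈ n.divisorsAntidiagonal, f x.1 * c x.1 * (v x.2 * c x.2) =
      c n * ∑ x ∈ n.divisorsAntidiagonal, f x.1 * v x.2 := by
    rw [Finset.mul_sum]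
    refine Finset.sum_congr rfl fun x hx => ?_
    rw [← (Nat.mem_divisorsAntidiagonal.1 hx).1, hc_mul]
    ring
  rw [e properPrimePowLog, e (fun d => if d.Prime then f d * log d else 0),
    show f n * c n * log n = c n * (f n * log n) by ring, ← mul_sub, abs_mul,
    abs_of_nonneg (hc n)]
  exact mul_le_mul_of_nonneg_left key (hc n)

theorem one_le_div_of_mem_Ioc_floor {x : ℝ} (hx : 0 ≤ x) {m : ℕ} (hm : m ∈ Finset.Ioc 0 ⌊x⌋₊) :
    1 ≤ x / m := by
  obtain ⟨h0, h1⟩ := Finset.mem_Ioc.1 hm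
  rw [one_le_div (by exact_mod_cast h0)]
  exact (Nat.le_floor_iff hx).1 h1

theorem abs_log_mul_sum_div_sub_le {f : ℕ → ℝ} {τ β K : ℝ}
    (hf_mul : ∀ m n : ℕ, Nat.Coprime m n → f (m * n) = f m * f n)
    (hf_nonneg : ∀ n : ℕ, 0 < n → 0 ≤ f n) (hf_le_one : ∀ n : ℕ, 0 < n → f n ≤ 1)
    (hβ1 : β < 1) (hK : 0 ≤ K)
    (hP : ∀ x : ℝ, 1 ≤ x →
      |∑ d ∈ Finset.Ioc 0 ⌊x⌋₊, (if d.Prime then f d * log d else 0) / (d : ℝ) - τ * log x| ≤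
        K * (1 + log x) ^ (1 - β))
    {x : ℝ} (hx : 1 ≤ x) :
    |log x * ∑ m ∈ Finset.Ioc 0 ⌊x⌋₊, f m / m -
        (τ + 1) * ∑ m ∈ Finset.Ioc 0 ⌊x⌋₊, f m / m * (log x - log m)| ≤
      (K + ∑' d : ℕ, properPrimePowLog d / d) * (1 + log x) ^ (1 - β) *
        ∑ m ∈ Finset.Ioc 0 ⌊x⌋₊, f m / m := by
  set Γ := ∑' d : ℕ, properPrimePowLog d / d with hΓ
  have hΓ0 : 0 ≤ Γ := tsum_nonneg fun d => div_nonneg (properPrimePowLog_nonneg d) d.cast_nonneg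
  have hx0 : 0 < x := by linarith
  have hlx : 0 ≤ log x := log_nonneg hx
  have hw (m : ℕ) (hm : m ∈ Finset.Ioc 0 ⌊x⌋₊) : 0 ≤ f m / m :=
    div_nonneg (hf_nonneg m (Finset.mem_Ioc.1 hm).1) m.cast_nonneg
  have h1 := abs_sum_mul_log_sub_le (c := fun n : ℕ => (n : ℝ)⁻¹) hf_mul hf_nonneg hf_le_one
    (fun n => by positivity) (fun m n => by push_cast; exact mul_inv _ _) ⌊x⌋₊
  simp only [← div_eq_mul_inv] at h1
  have h2 : ∑ m ∈ Finset.Ioc 0 ⌊x⌋₊, f m / m *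
      ∑ d ∈ Finset.Ioc 0 (⌊x⌋₊ / m), properPrimePowLog d / d ≤
      Γ * ∑ m ∈ Finset.Ioc 0 ⌊x⌋₊, f m / m := by
    rw [Finset.mul_sum]
    refine Finset.sum_le_sum fun m hm => ?_
    rw [mul_comm]
    exact mul_le_mul_of_nonneg_right (summable_properPrimePowLog_div.sum_le_tsum _
      fun d _ => div_nonneg (properPrimePowLog_nonneg d) d.cast_nonneg) (hw m hm)
  have h3 : |∑ m ∈ Finset.Ioc 0 ⌊x⌋₊, f m / m *
        ∑ d ∈ Finset.Ioc 0 (⌊x⌋₊ / m), (if d.Prime then f d * log d else 0) / (d : ℝ) -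
      τ * ∑ m ∈ Finset.Ioc 0 ⌊x⌋₊, f m / m * (log x - log m)| ≤
      K * (1 + log x) ^ (1 - β) * ∑ m ∈ Finset.Ioc 0 ⌊x⌋₊, f m / m := by
    rw [Finset.mul_sum, Finset.mul_sum, ← Finset.sum_sub_distrib]
    refine (Finset.abs_sum_le_sum_abs _ _).trans (Finset.sum_le_sum fun m hm => ?_)
    have hm0 : (0 : ℝ) < m := by exact_mod_cast (Finset.mem_Ioc.1 hm).1
    have hy := one_le_div_of_mem_Ioc_floor hx0.le hm
    have h4 := hP _ hy
    rw [Nat.floor_div_natCast, log_div hx0.ne' hm0.ne'] at h4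
    have hly : 0 ≤ log x - log m := by
      rw [← log_div hx0.ne' hm0.ne']; exact log_nonneg hy
    have hlm : 0 ≤ log m := log_natCast_nonneg m
    rw [mul_left_comm, ← mul_sub, abs_mul, abs_of_nonneg (hw m hm), mul_comm]
    refine mul_le_mul_of_nonneg_right (h4.trans ?_) (hw m hm)
    gcongr
    · linarith
  have h4 : Γ * ∑ m ∈ Finset.Ioc 0 ⌊x⌋₊, f m / m ≤
      Γ * (1 + log x) ^ (1 - β) * ∑ m ∈ Finset.Ioc 0 ⌊x⌋₊, f m / m := by
    have := Finset.sum_nonneg hw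
    gcongr
    exact le_mul_of_one_le_right hΓ0 (one_le_rpow (by linarith) (by linarith))
  have h5 : ∑ m ∈ Finset.Ioc 0 ⌊x⌋₊, f m / m * (log x - log m) =
      log x * ∑ m ∈ Finset.Ioc 0 ⌊x⌋₊, f m / m - ∑ n ∈ Finset.Ioc 0 ⌊x⌋₊, f n / n * log n := by
    rw [Finset.mul_sum, ← Finset.sum_sub_distrib]
    exact Finset.sum_congr rfl fun m _ => by ring
  set T := ∑ m ∈ Finset.Ioc 0 ⌊x⌋₊, f m / m * (log x - log m)
  rw [abs_le] at h1 h3 ⊢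
  constructor <;> linarith [h1.1, h1.2, h3.1, h3.2]

theorem hasDerivWithinAt_max_sub_zero (c u : ℝ) :
    HasDerivWithinAt (fun v => max (v - c) 0) (if c ≤ u then 1 else 0) (Set.Ici u) u := by
  split_ifs with h
  · refine ((hasDerivAt_id u).sub_const c).hasDerivWithinAt.congr (fun v hv => ?_) ?_
    · have : u ≤ v := hv
      exact max_eq_left (by linarith)
    · exact max_eq_left (by linarith)
  · push Not at h
    refine ((hasDerivAt_const u (0 : ℝ)).congr_of_eventuallyEq ?_).hasDerivWithinAt
    filter_upwards [eventually_lt_nhds h] with v hv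
    exact max_eq_right (by linarith)

theorem sum_Ioc_floor_exp_mul_sub_log_eq (w : ℕ → ℝ) {u : ℝ} {N : ℕ} (hN : ⌊exp u⌋₊ ≤ N) :
    ∑ m ∈ Finset.Ioc 0 ⌊exp u⌋₊, w m * (u - log m) =
      ∑ m ∈ Finset.Ioc 0 N, w m * max (u - log m) 0 := by
  rw [← Finset.sum_subset (Finset.Ioc_subset_Ioc_right hN)]
  · refine Finset.sum_congr rfl fun m hm => ?_
    obtain ⟨h0, h1⟩ := Finset.mem_Ioc.1 hm
    have : log m ≤ u := by
      rw [log_le_iff_le_exp (by exact_mod_cast h0)]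
      exact (Nat.le_floor_iff (exp_pos u).le).1 h1
    rw [max_eq_left (by linarith)]
  · intro m hm hm'
    have h0 := (Finset.mem_Ioc.1 hm).1
    have h1 : ⌊exp u⌋₊ < m := by
      by_contra! h
      exact hm' (Finset.mem_Ioc.2 ⟨h0, h⟩)
    have : u < log m := by
      rw [lt_log_iff_exp_lt (by exact_mod_cast h0)]
      exact (Nat.floor_lt (exp_pos u).le).1 h1
    rw [max_eq_right (by linarith), mul_zero]

theorem eventually_sum_Ioc_floor_exp_mul_sub_log_eq (w : ℕ → ℝ) (u : ℝ) :
    (fun v => ∑ m ∈ Finset.Ioc 0 ⌊exp v⌋₊, w m * (v - log m)) =ᶠ[nhds u]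
      fun v => ∑ m ∈ Finset.Ioc 0 ⌊exp (u + 1)⌋₊, w m * max (v - log m) 0 := by
  filter_upwards [eventually_lt_nhds (lt_add_one u)] with v hv
  exact sum_Ioc_floor_exp_mul_sub_log_eq w (Nat.floor_mono (exp_le_exp.2 hv.le))

theorem continuous_sum_Ioc_floor_exp_mul_sub_log (w : ℕ → ℝ) :
    Continuous fun u => ∑ m ∈ Finset.Ioc 0 ⌊exp u⌋₊, w m * (u - log m) :=
  continuous_iff_continuousAt.2 fun u => ContinuousAt.congr (by fun_prop)
    (eventually_sum_Ioc_floor_exp_mul_sub_log_eq w u).symm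

theorem hasDerivWithinAt_sum_Ioc_floor_exp_mul_sub_log (w : ℕ → ℝ) (u : ℝ) :
    HasDerivWithinAt (fun u => ∑ m ∈ Finset.Ioc 0 ⌊exp u⌋₊, w m * (u - log m))
      (∑ m ∈ Finset.Ioc 0 ⌊exp u⌋₊, w m) (Set.Ici u) u := by
  have h1 : HasDerivWithinAt
      (fun v => ∑ m ∈ Finset.Ioc 0 ⌊exp (u + 1)⌋₊, w m * max (v - log m) 0)
      (∑ m ∈ Finset.Ioc 0 ⌊exp (u + 1)⌋₊, w m * (if log m ≤ u then 1 else 0)) (Set.Ici u) u :=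
    HasDerivWithinAt.fun_sum fun m _ => (hasDerivWithinAt_max_sub_zero _ u).const_mul _
  have h2 : ∑ m ∈ Finset.Ioc 0 ⌊exp (u + 1)⌋₊, w m * (if log m ≤ u then 1 else 0) =
      ∑ m ∈ Finset.Ioc 0 ⌊exp u⌋₊, w m := by
    simp only [mul_ite, mul_one, mul_zero]
    rw [← Finset.sum_filter]
    refine Finset.sum_congr ?_ fun _ _ => rfl
    ext m
    simp only [Finset.mem_filter, Finset.mem_Ioc]
    constructor
    · rintro ⟨⟨h0, -⟩, h⟩
      rw [log_le_iff_le_exp (by exact_mod_cast h0)] at h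
      exact ⟨h0, Nat.le_floor h⟩
    · rintro ⟨h0, h⟩
      refine ⟨⟨h0, h.trans (Nat.floor_mono (exp_le_exp.2 (by linarith)))⟩, ?_⟩
      rw [log_le_iff_le_exp (by exact_mod_cast h0)]
      exact (Nat.le_floor_iff (exp_pos u).le).1 h
  rw [← h2]
  exact h1.congr_of_eventuallyEq
    ((eventually_sum_Ioc_floor_exp_mul_sub_log_eq w u).filter_mono nhdsWithin_le_nhds)
    (eventually_sum_Ioc_floor_exp_mul_sub_log_eq w u).self_of_nhds

/-- The logarithmic mean value: `∑_{m ≤ x} f m / m ∼ C (log x) ^ τ`. -/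
theorem exists_tendsto_sum_div_div_log_rpow {f : ℕ → ℝ} {τ β K : ℝ} (hτ : 0 < τ) (hβ : 0 < β)
    (hβ1 : β < 1) (hf_one : f 1 = 1)
    (hf_mul : ∀ m n : ℕ, Nat.Coprime m n → f (m * n) = f m * f n)
    (hf_nonneg : ∀ n : ℕ, 0 < n → 0 ≤ f n) (hf_le_one : ∀ n : ℕ, 0 < n → f n ≤ 1) (hK : 0 ≤ K)
    (hP : ∀ x : ℝ, 1 ≤ x →
      |∑ d ∈ Finset.Ioc 0 ⌊x⌋₊, (if d.Prime then f d * log d else 0) / (d : ℝ) - τ * log x| ≤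
        K * (1 + log x) ^ (1 - β)) :
    ∃ C, 0 < C ∧
      Tendsto (fun x : ℝ => (∑ m ∈ Finset.Ioc 0 ⌊x⌋₊, f m / m) / log x ^ τ) atTop (nhds C) := by
  set Γ := ∑' d : ℕ, properPrimePowLog d / d with hΓ
  have hΓ0 : 0 ≤ Γ := tsum_nonneg fun d => div_nonneg (properPrimePowLog_nonneg d) d.cast_nonneg
  have hw (m : ℕ) (hm : 0 < m) : 0 ≤ f m / m := div_nonneg (hf_nonneg m hm) m.cast_nonneg
  have hL (u : ℝ) : 0 ≤ ∑ m ∈ Finset.Ioc 0 ⌊exp u⌋₊, f m / m :=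
    Finset.sum_nonneg fun m hm => hw m (Finset.mem_Ioc.1 hm).1
  obtain ⟨C, hC, hlim⟩ := exists_tendsto_right_deriv_div_rpow (τ := τ) (β := β)
    (K := (K + Γ) * 2) hτ hβ (by positivity)
    (continuous_sum_Ioc_floor_exp_mul_sub_log (fun m => f m / m)).continuousOn
    (fun u _ => hasDerivWithinAt_sum_Ioc_floor_exp_mul_sub_log _ u)
    (fun u hu => by
      refine Finset.sum_pos' (fun m hm => ?_) ⟨1, ?_, ?_⟩
      · obtain ⟨h0, h1⟩ := Finset.mem_Ioc.1 hm
        have : log m ≤ u := by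
          rw [log_le_iff_le_exp (by exact_mod_cast h0)]
          exact (Nat.le_floor_iff (exp_pos u).le).1 h1
        exact mul_nonneg (hw m h0) (by linarith)
      · exact Finset.mem_Ioc.2 ⟨one_pos, Nat.le_floor (by simpa using (by linarith : 0 ≤ u))⟩
      · simp [hf_one]; linarith)
    (fun u _ => hL u)
    (fun u hu => by
      have := abs_log_mul_sum_div_sub_le hf_mul hf_nonneg hf_le_one hβ1 hK hP
        (one_le_exp (by linarith : 0 ≤ u))
      rw [log_exp] at this
      refine this.trans (mul_le_mul_of_nonneg_right ?_ (hL u))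
      rw [mul_assoc]
      gcongr
      calc (1 + u) ^ (1 - β) ≤ (2 * u) ^ (1 - β) := by
            refine rpow_le_rpow (by linarith) (by linarith) (by linarith)
        _ = 2 ^ (1 - β) * u ^ (1 - β) := mul_rpow (by norm_num) (by linarith)
        _ ≤ 2 ^ (1 : ℝ) * u ^ (1 - β) := by
            gcongr
            · norm_num
            · linarith
        _ = _ := by rw [rpow_one])
  refine ⟨C, hC, (hlim.comp tendsto_log_atTop).congr' ?_⟩
  filter_upwards [eventually_gt_atTop 0] with x hx
  simp only [Function.comp, exp_log hx]

theorem tendsto_sum_properPrimePowLog_div :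
    Tendsto (fun y : ℝ => (∑ d ∈ Finset.Ioc 0 ⌊y⌋₊, properPrimePowLog d) / y) atTop (nhds 0) := by
  have h := tendsto_tsum_of_dominated_convergence (𝓕 := atTop) (G := ℝ)
    (f := fun (y : ℝ) (d : ℕ) => if d ∈ Finset.Ioc 0 ⌊y⌋₊ then properPrimePowLog d / y else 0)
    (g := fun _ => 0) summable_properPrimePowLog_div ?_ ?_
  · rw [tsum_zero] at h
    refine h.congr fun y => ?_
    rw [tsum_eq_sum (s := Finset.Ioc 0 ⌊y⌋₊) fun d hd => if_neg hd, Finset.sum_div]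
    exact Finset.sum_congr rfl fun d hd => if_pos hd
  · intro d
    have h0 : Tendsto (fun y : ℝ => properPrimePowLog d / y) atTop (nhds 0) :=
      tendsto_const_nhds.div_atTop tendsto_id
    refine squeeze_zero' ?_ ?_ h0
    · filter_upwards [eventually_ge_atTop 0] with y hy
      have := properPrimePowLog_nonneg d
      positivity
    · filter_upwards [eventually_ge_atTop 0] with y hy
      have : 0 ≤ properPrimePowLog d / y := div_nonneg (properPrimePowLog_nonneg d) hy
      split_ifs
      · exact le_rfl
      · exact this
  · filter_upwards [eventually_gt_atTop 0] with y hy d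
    have hg := properPrimePowLog_nonneg d
    split_ifs with hd
    · obtain ⟨h0, h1⟩ := Finset.mem_Ioc.1 hd
      have hd0 : (0 : ℝ) < d := by exact_mod_cast h0
      have hdy : (d : ℝ) ≤ y := (Nat.le_floor_iff hy.le).1 h1
      rw [norm_of_nonneg (by positivity)]
      gcongr
    · rw [norm_zero]; positivity

theorem sum_properPrimePowLog_le {y : ℝ} (hy : 0 ≤ y) :
    ∑ d ∈ Finset.Ioc 0 ⌊y⌋₊, properPrimePowLog d ≤ (∑' d : ℕ, properPrimePowLog d / d) * y := by
  calc _ ≤ ∑ d ∈ Finset.Ioc 0 ⌊y⌋₊, properPrimePowLog d / d * y := by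
        refine Finset.sum_le_sum fun d hd => ?_
        obtain ⟨h0, h1⟩ := Finset.mem_Ioc.1 hd
        have hd0 : (0 : ℝ) < d := by exact_mod_cast h0
        have hdy : (d : ℝ) ≤ y := (Nat.le_floor_iff hy).1 h1
        rw [div_mul_eq_mul_div, le_div_iff₀ hd0]
        exact mul_le_mul_of_nonneg_left hdy (properPrimePowLog_nonneg d)
    _ ≤ _ := by
        rw [← Finset.sum_mul]
        gcongr
        exact summable_properPrimePowLog_div.sum_le_tsum _
          fun d _ => div_nonneg (properPrimePowLog_nonneg d) d.cast_nonneg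

/-- An error term `r y = o(y)` stays negligible after averaging against `f`. -/
theorem tendsto_sum_mul_div_zero {f : ℕ → ℝ} {r : ℝ → ℝ} {τ C K : ℝ}
    (hf_nonneg : ∀ n : ℕ, 0 < n → 0 ≤ f n) (hC : 0 < C)
    (hL : Tendsto (fun x : ℝ => (∑ m ∈ Finset.Ioc 0 ⌊x⌋₊, f m / m) / log x ^ τ) atTop (nhds C))
    (hr0 : ∀ y, 1 ≤ y → 0 ≤ r y) (hrK : ∀ y, 1 ≤ y → r y ≤ K * y)
    (hr : Tendsto (fun y => r y / y) atTop (nhds 0)) :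
    Tendsto (fun x : ℝ => (∑ m ∈ Finset.Ioc 0 ⌊x⌋₊, f m * r (x / m)) / (x * log x ^ τ))
      atTop (nhds 0) := by
  set L := fun x : ℝ => ∑ m ∈ Finset.Ioc 0 ⌊x⌋₊, f m / m with hLdef
  have hK : 0 ≤ K := by have := (hr0 1 le_rfl).trans (hrK 1 le_rfl); linarith
  have hlogpos : ∀ᶠ x : ℝ in atTop, 0 < log x ∧ 0 < x :=
    (tendsto_log_atTop.eventually_gt_atTop 0).and (eventually_gt_atTop 0)
  have hslow (A : ℝ) (hA : 0 < A) : Tendsto (fun x => L (x / A) / log x ^ τ) atTop (nhds C) := by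
    have h1 : Tendsto (fun x : ℝ => log (x / A) / log x) atTop (nhds 1) := by
      have : Tendsto (fun x : ℝ => 1 - log A / log x) atTop (nhds (1 - 0)) :=
        tendsto_const_nhds.sub (tendsto_const_nhds.div_atTop tendsto_log_atTop)
      rw [sub_zero] at this
      refine this.congr' ?_
      filter_upwards [hlogpos] with x ⟨hl, hx⟩
      rw [log_div hx.ne' hA.ne']; field_simp
    have h2 := (hL.comp (tendsto_id.atTop_div_const hA)).mul
      (h1.rpow_const (p := τ) (Or.inl one_ne_zero))
    rw [one_rpow, mul_one] at h2
    refine h2.congr' ?_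
    filter_upwards [hlogpos,
      (tendsto_log_atTop.comp (tendsto_id.atTop_div_const hA)).eventually_gt_atTop 0]
      with x ⟨hl, hx⟩ hl'
    simp only [Function.comp, id] at hl' ⊢
    rw [div_rpow hl'.le hl.le]
    have := rpow_pos_of_pos hl' τ
    field_simp
    rfl
  rw [tendsto_order]
  refine ⟨fun a ha => ?_, fun ε hε => ?_⟩
  · filter_upwards [hlogpos] with x ⟨hl, hx⟩
    refine ha.trans_le (div_nonneg (Finset.sum_nonneg fun m hm => mul_nonneg
      (hf_nonneg m (Finset.mem_Ioc.1 hm).1) (hr0 _ (one_le_div_of_mem_Ioc_floor hx.le hm))) ?_)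
    positivity
  · set δ := ε / (2 * C) with hδ
    have hδ0 : 0 < δ := by positivity
    obtain ⟨A, hA⟩ := eventually_atTop.1 ((hr.eventually_le_const hδ0).and
      (eventually_ge_atTop 1))
    have hA1 : 1 ≤ A := (hA A le_rfl).2
    have hlim : Tendsto (fun x => δ * (L x / log x ^ τ) +
        K * (L x / log x ^ τ - L (x / A) / log x ^ τ)) atTop (nhds (δ * C + K * (C - C))) :=
      (hL.const_mul δ).add ((hL.sub (hslow A (by linarith))).const_mul K)
    have hlt : δ * C + K * (C - C) < ε := by
      rw [hδ]; field_simp; linarith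
    filter_upwards [hlogpos, hlim.eventually_lt_const hlt] with x ⟨hl, hx⟩ hx2
    refine lt_of_le_of_lt ?_ hx2
    have hsub : ⌊x / A⌋₊ ≤ ⌊x⌋₊ := Nat.floor_mono (div_le_self hx.le hA1)
    have hdiff : ∑ m ∈ Finset.Ioc 0 ⌊x⌋₊, (if m ∈ Finset.Ioc 0 ⌊x / A⌋₊ then 0 else f m / m) =
        L x - L (x / A) := by
      have h1 : ∑ m ∈ Finset.Ioc 0 ⌊x⌋₊, (if m ∈ Finset.Ioc 0 ⌊x / A⌋₊ then f m / m else 0) =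
          L (x / A) := by
        rw [← Finset.sum_filter, Finset.filter_mem_eq_inter, Finset.inter_eq_right.2
          (Finset.Ioc_subset_Ioc_right hsub)]
      rw [← h1, hLdef, ← Finset.sum_sub_distrib]
      refine Finset.sum_congr rfl fun m _ => ?_
      split_ifs <;> simp
    have hmain : ∑ m ∈ Finset.Ioc 0 ⌊x⌋₊, f m * r (x / m) ≤
        x * (δ * L x + K * (L x - L (x / A))) := by
      rw [← hdiff, hLdef, Finset.mul_sum, Finset.mul_sum, ← Finset.sum_add_distrib, Finset.mul_sum]
      refine Finset.sum_le_sum fun m hm => ?_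
      have hy := one_le_div_of_mem_Ioc_floor hx.le hm
      have hm1 := (Finset.mem_Ioc.1 hm).1
      have hm0 : (0 : ℝ) < m := by exact_mod_cast hm1
      have hfm := hf_nonneg m hm1
      split_ifs with h
      · have hAy : A ≤ x / m := by
          have := (Nat.le_floor_iff (by positivity)).1 (Finset.mem_Ioc.1 h).2
          rw [le_div_iff₀ (by linarith)] at this
          rw [le_div_iff₀ hm0]
          linarith
        have h3 := (hA _ hAy).1
        rw [div_le_iff₀ (by linarith)] at h3
        calc f m * r (x / m) ≤ f m * (δ * (x / m)) := by gcongr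
          _ = _ := by ring
      · have h3 := hrK _ hy
        have h4 : 0 ≤ x * (δ * (f m / m)) := by positivity
        calc f m * r (x / m) ≤ f m * (K * (x / m)) := by gcongr
          _ = x * (K * (f m / m)) := by ring
          _ ≤ _ := by linarith
    rw [div_le_iff₀ (by positivity)]
    refine hmain.trans_eq ?_
    have := rpow_pos_of_pos hl τ
    field_simp

theorem abs_sum_mul_log_sub_mul_sum_div_le {f : ℕ → ℝ} {τ x : ℝ}
    (hf_mul : ∀ m n : ℕ, Nat.Coprime m n → f (m * n) = f m * f n)
    (hf_nonneg : ∀ n : ℕ, 0 < n → 0 ≤ f n) (hf_le_one : ∀ n : ℕ, 0 < n → f n ≤ 1) (hx : 0 < x) :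
    |(∑ n ∈ Finset.Ioc 0 ⌊x⌋₊, f n) * log x - τ * x * ∑ m ∈ Finset.Ioc 0 ⌊x⌋₊, f m / m| ≤
      ∑ m ∈ Finset.Ioc 0 ⌊x⌋₊, f m *
        (|∑ d ∈ Finset.Ioc 0 ⌊x / m⌋₊, (if d.Prime then f d * log d else 0) - τ * (x / m)| +
          ∑ d ∈ Finset.Ioc 0 ⌊x / m⌋₊, properPrimePowLog d + log (x / m)) := by
  have h1 := abs_sum_mul_log_sub_le (c := fun _ => 1) hf_mul hf_nonneg hf_le_one
    (fun _ => zero_le_one) (fun _ _ => (mul_one 1).symm) ⌊x⌋₊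
  simp only [mul_one, ← Nat.floor_div_natCast] at h1
  have h2 : |∑ m ∈ Finset.Ioc 0 ⌊x⌋₊, f m *
        ∑ d ∈ Finset.Ioc 0 ⌊x / m⌋₊, (if d.Prime then f d * log d else 0) -
      τ * x * ∑ m ∈ Finset.Ioc 0 ⌊x⌋₊, f m / m| ≤ ∑ m ∈ Finset.Ioc 0 ⌊x⌋₊, f m *
        |∑ d ∈ Finset.Ioc 0 ⌊x / m⌋₊, (if d.Prime then f d * log d else 0) - τ * (x / m)| := by
    rw [Finset.mul_sum, ← Finset.sum_sub_distrib]
    refine (Finset.abs_sum_le_sum_abs _ _).trans_eq (Finset.sum_congr rfl fun m hm => ?_)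
    rw [show τ * x * (f m / m) = f m * (τ * (x / m)) by ring, ← mul_sub, abs_mul,
      abs_of_nonneg (hf_nonneg m (Finset.mem_Ioc.1 hm).1)]
  have h3 : (∑ n ∈ Finset.Ioc 0 ⌊x⌋₊, f n) * log x =
      ∑ n ∈ Finset.Ioc 0 ⌊x⌋₊, f n * log n + ∑ n ∈ Finset.Ioc 0 ⌊x⌋₊, f n * log (x / n) := by
    rw [Finset.sum_mul, ← Finset.sum_add_distrib]
    refine Finset.sum_congr rfl fun m hm => ?_
    have hm0 : (m : ℝ) ≠ 0 := by exact_mod_cast (Finset.mem_Ioc.1 hm).1.ne'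
    rw [log_div hx.ne' hm0]
    ring
  have h4 : 0 ≤ ∑ n ∈ Finset.Ioc 0 ⌊x⌋₊, f n * log (x / n) := Finset.sum_nonneg fun m hm =>
    mul_nonneg (hf_nonneg m (Finset.mem_Ioc.1 hm).1)
      (log_nonneg (one_le_div_of_mem_Ioc_floor hx.le hm))
  simp only [mul_add, Finset.sum_add_distrib]
  rw [h3]
  rw [abs_le] at h1 h2 ⊢
  constructor <;> linarith [h1.1, h1.2, h2.1, h2.2]

/-- **Mean values of multiplicative functions** (Spearman–Williams / Odoni).
If `f : ℕ → ℝ` is multiplicative with `0 ≤ f n ≤ 1` for all `n ≥ 1`, and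
`∑_{p ≤ x, p prime} f p = τ·x/log x + O(x/(log x)^{1+β})` for positive constants
`τ, β`, then `∑_{n ≤ x} f n ∼ C_f · x · (log x)^{τ-1}` for some constant `C_f > 0`. -/
theorem mean_value_of_multiplicative_function
    (f : ℕ → ℝ) (τ β : ℝ) (hτ : 0 < τ) (hβ : 0 < β)
    (hf_one : f 1 = 1)
    (hf_mul : ∀ m n : ℕ, Nat.Coprime m n → f (m * n) = f m * f n)
    (hf_nonneg : ∀ n : ℕ, 0 < n → 0 ≤ f n)
    (hf_le_one : ∀ n : ℕ, 0 < n → f n ≤ 1)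
    (hprimes :
      (fun x : ℝ =>
          (∑ p ∈ (Finset.Icc 1 ⌊x⌋₊).filter Nat.Prime, f p) - τ * x / Real.log x)
        =O[atTop] (fun x : ℝ => x / Real.log x ^ (1 + β))) :
    ∃ C : ℝ, 0 < C ∧
      Tendsto
        (fun x : ℝ =>
          (∑ n ∈ Finset.Icc 1 ⌊x⌋₊, f n) / (C * x * Real.log x ^ (τ - 1)))
        atTop (nhds 1) := by
  have hβ0 : 0 < min β (1 / 2) := lt_min hβ (by norm_num)
  have hβ1 : min β (1 / 2) < 1 := (min_le_right _ _).trans_lt (by norm_num)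
  have hβle : min β (1 / 2) ≤ β := min_le_left _ _
  generalize min β (1 / 2) = γ at hβ0 hβ1 hβle
  have hlogpos : ∀ᶠ x : ℝ in atTop, 1 ≤ log x ∧ 1 ≤ x :=
    (tendsto_log_atTop.eventually_ge_atTop 1).and (eventually_ge_atTop 1)
  obtain ⟨K, hK, hS⟩ := exists_abs_sum_prime_mul_log_sub_le hβ0 hβ1 hf_nonneg hf_le_one
    (hprimes.trans (.of_bound 1 (by
      filter_upwards [hlogpos] with x ⟨hl, hx⟩
      rw [norm_of_nonneg (by positivity), norm_of_nonneg (by positivity), one_mul]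
      gcongr)))
  obtain ⟨K', hK', hP⟩ := exists_abs_sum_div_sub_log_le hτ.le hβ0 hβ1 hK hS
  obtain ⟨C, hC, hL⟩ := exists_tendsto_sum_div_div_log_rpow hτ hβ0 hβ1 hf_one hf_mul hf_nonneg
    hf_le_one hK' hP
  set r : ℝ → ℝ := fun y =>
    |∑ d ∈ Finset.Ioc 0 ⌊y⌋₊, (if d.Prime then f d * log d else 0) - τ * y| +
      ∑ d ∈ Finset.Ioc 0 ⌊y⌋₊, properPrimePowLog d + log y with hr_def
  have hr : Tendsto (fun y => r y / y) atTop (nhds 0) := by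
    have h1 : Tendsto (fun y : ℝ =>
        |∑ d ∈ Finset.Ioc 0 ⌊y⌋₊, (if d.Prime then f d * log d else 0) - τ * y| / y)
        atTop (nhds 0) := by
      have h2 : Tendsto (fun y : ℝ => K * (1 + log y) ^ (-γ)) atTop (nhds 0) := by
        simpa using ((tendsto_rpow_neg_atTop hβ0).comp
          (tendsto_atTop_add_const_left _ 1 tendsto_log_atTop)).const_mul K
      refine squeeze_zero' ?_ ?_ h2
      · filter_upwards [eventually_ge_atTop 0] with y hy using by positivity
      · filter_upwards [eventually_ge_atTop 1] with y hy
        rw [div_le_iff₀ (by linarith)]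
        exact (hS y hy).trans_eq (by ring)
    have h3 : Tendsto (fun y : ℝ => log y / y) atTop (nhds 0) :=
      isLittleO_log_id_atTop.tendsto_div_nhds_zero
    have h4 := (h1.add tendsto_sum_properPrimePowLog_div).add h3
    rw [add_zero, add_zero] at h4
    exact h4.congr fun y => by rw [hr_def]; ring
  have hr0 (y : ℝ) (hy : 1 ≤ y) : 0 ≤ r y := by
    have := Finset.sum_nonneg fun d (_ : d ∈ Finset.Ioc 0 ⌊y⌋₊) => properPrimePowLog_nonneg d
    have := log_nonneg hy
    positivity
  have hrK (y : ℝ) (hy : 1 ≤ y) : r y ≤ (K + (∑' d : ℕ, properPrimePowLog d / d) + 1) * y := by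
    have h1 : (1 + log y) ^ (-γ) ≤ 1 :=
      rpow_le_one_of_one_le_of_nonpos (by linarith [log_nonneg hy]) (by linarith)
    have h2 := hS y hy
    have h3 : K * (y * (1 + log y) ^ (-γ)) ≤ K * (y * 1) := by gcongr
    have h4 := sum_properPrimePowLog_le (zero_le_one.trans hy)
    have h5 := log_le_self (zero_le_one.trans hy)
    simp only [hr_def]
    linarith
  have herr := tendsto_sum_mul_div_zero hf_nonneg hC hL hr0 hrK hr
  have hmain : Tendsto (fun x : ℝ =>
      ((∑ n ∈ Finset.Ioc 0 ⌊x⌋₊, f n) * log x - τ * x * ∑ m ∈ Finset.Ioc 0 ⌊x⌋₊, f m / m) /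
        (x * log x ^ τ)) atTop (nhds 0) := by
    refine squeeze_zero_norm' ?_ herr
    filter_upwards [hlogpos] with x ⟨hl, hx⟩
    rw [norm_div, norm_eq_abs, norm_of_nonneg (by positivity : 0 ≤ x * log x ^ τ)]
    gcongr
    exact abs_sum_mul_log_sub_mul_sum_div_le hf_mul hf_nonneg hf_le_one (by linarith)
  refine ⟨τ * C, by positivity, ?_⟩
  have hfin := (hmain.add (hL.const_mul τ)).div_const (τ * C)
  rw [zero_add, div_self (by positivity)] at hfin
  refine hfin.congr' ?_
  filter_upwards [hlogpos] with x ⟨hl, hx⟩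
  have hx0 : 0 < x := by linarith
  have hl0 : 0 < log x := by linarith
  have := rpow_pos_of_pos hl0 τ
  rw [show Finset.Icc 1 ⌊x⌋₊ = Finset.Ioc 0 ⌊x⌋₊ from rfl, rpow_sub_one hl0.ne']
  field_simp
  ring
end

section
/- Let 𝒫 be a set of rational primes, and suppose there are positive real constants τ and β such that #{p ≤ x : p ∈ 𝒫} = τ·x/log x + O(x/(log x)^{1+β}) as x → ∞. Then there exists a positive constant C_𝒫 such that the number of squarefree positive integers d ≤ x all of whose prime factors belong to 𝒫 is asymptotic to C_𝒫 · x·(log x)^{τ−1} as x → ∞. -/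
open Filter Real

/-- The squarefree positive integers all of whose prime factors lie in `P`. -/
def squarefreeSupported (P : Set ℕ) : Set ℕ :=
  {d | Squarefree d ∧ ∀ p : ℕ, p.Prime → p ∣ d → p ∈ P}

open Classical in
/-- The indicator function of `squarefreeSupported P`. -/
noncomputable def supportInd (P : Set ℕ) (n : ℕ) : ℝ :=
  if n ∈ squarefreeSupported P then 1 else 0

open Classical in
/-- The logarithm restricted to `P`. -/
noncomputable def logWeight (P : Set ℕ) (p : ℕ) : ℝ := if p ∈ P then Real.log p else 0

lemma supportInd_nonneg (P : Set ℕ) (n : ℕ) : 0 ≤ supportInd P n := by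
  unfold supportInd; split_ifs <;> simp

lemma logWeight_nonneg (P : Set ℕ) (n : ℕ) : 0 ≤ logWeight P n := by
  unfold logWeight; split_ifs <;> simp [Real.log_natCast_nonneg]

lemma supportInd_zero (P : Set ℕ) : supportInd P 0 = 0 := by
  simp [supportInd, squarefreeSupported]

lemma supportInd_one (P : Set ℕ) : supportInd P 1 = 1 := by
  have : 1 ∈ squarefreeSupported P :=
    ⟨squarefree_one, fun p hp h => absurd (Nat.dvd_one.1 h) hp.ne_one⟩
  simp [supportInd, this]

lemma supportInd_le_of_dvd (P : Set ℕ) {m n : ℕ} (h : m ∣ n) :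
    supportInd P n ≤ supportInd P m := by
  unfold supportInd
  by_cases hn : n ∈ squarefreeSupported P
  · have hm : m ∈ squarefreeSupported P :=
      ⟨hn.1.squarefree_of_dvd h, fun p hp hpm => hn.2 p hp (hpm.trans h)⟩
    simp [hm, hn]
  · rw [if_neg hn]; split_ifs <;> simp

lemma supportInd_mul_prime (P : Set ℕ) {m p : ℕ} (hp : p.Prime) (hpP : p ∈ P) (h : ¬ p ∣ m) :
    supportInd P (m * p) = supportInd P m := by
  refine le_antisymm (supportInd_le_of_dvd P (dvd_mul_right m p)) ?_
  unfold supportInd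
  by_cases hm : m ∈ squarefreeSupported P
  · have : m * p ∈ squarefreeSupported P := by
      refine ⟨?_, fun q hq hqm => ?_⟩
      · rw [Nat.squarefree_mul ((Nat.Prime.coprime_iff_not_dvd hp).2 h).symm]
        exact ⟨hm.1, hp.prime.squarefree⟩
      · rcases (Nat.Prime.dvd_mul hq).1 hqm with h1 | h1
        · exact hm.2 q hq h1
        · rwa [(Nat.prime_dvd_prime_iff_eq hq hp).1 h1]
    simp [hm, this]
  · rw [if_neg hm]; split_ifs <;> simp

lemma supportInd_mul_log {P : Set ℕ} (hP : ∀ p ∈ P, Nat.Prime p) (n : ℕ) :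
    supportInd P n * Real.log n =
      ∑ x ∈ n.divisorsAntidiagonal with ¬ x.2 ∣ x.1, supportInd P x.1 * logWeight P x.2 := by
  by_cases hn : n ∈ squarefreeSupported P
  · have hn0 : n ≠ 0 := hn.1.ne_zero
    have h1 : Real.log n = ∑ p ∈ n.primeFactors, Real.log p := by
      conv_lhs => rw [← Nat.prod_primeFactors_of_squarefree hn.1]
      rw [Nat.cast_prod, Real.log_prod]
      intro p hp
      exact_mod_cast (Nat.prime_of_mem_primeFactors hp).ne_zero
    have h2 : supportInd P n = 1 := by simp [supportInd, hn]
    rw [h1, h2, one_mul]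
    have h3 : ∑ p ∈ n.primeFactors, Real.log p =
        ∑ x ∈ n.primeFactors.image (fun p => (n / p, p)),
          supportInd P x.1 * logWeight P x.2 := by
      rw [Finset.sum_image (fun a _ b _ h => (Prod.ext_iff.1 h).2)]
      refine Finset.sum_congr rfl fun p hp => ?_
      have hpp := Nat.prime_of_mem_primeFactors hp
      have hpd := Nat.dvd_of_mem_primeFactors hp
      have h4 : supportInd P (n / p) = 1 := by
        refine le_antisymm ?_ (h2.symm.trans_le (supportInd_le_of_dvd P (Nat.div_dvd_of_dvd hpd)))
        unfold supportInd; split_ifs <;> simp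
      simp [h4, logWeight, hn.2 p hpp hpd]
    rw [h3]
    refine Finset.sum_subset ?_ ?_
    · intro x hx
      obtain ⟨p, hp, rfl⟩ := Finset.mem_image.1 hx
      have hpp := Nat.prime_of_mem_primeFactors hp
      have hpd := Nat.dvd_of_mem_primeFactors hp
      simp only [Finset.mem_filter, Nat.mem_divisorsAntidiagonal]
      refine ⟨⟨Nat.div_mul_cancel hpd, hn0⟩, fun hd => ?_⟩
      have : p * p ∣ n := by
        rw [← Nat.div_mul_cancel hpd]; exact mul_dvd_mul_right hd p
      exact hpp.one_lt.ne' (Nat.isUnit_iff.1 (hn.1 p this))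
    · intro x hx hx'
      simp only [Finset.mem_filter, Nat.mem_divisorsAntidiagonal] at hx
      have : x.2 ∉ P := by
        intro hxP
        apply hx'
        refine Finset.mem_image.2 ⟨x.2, ?_, ?_⟩
        · exact Nat.mem_primeFactors.2 ⟨hP _ hxP, ⟨x.1, by rw [← hx.1.1, mul_comm]⟩, hn0⟩
        · ext
          · simp only
            rw [← hx.1.1, Nat.mul_div_cancel _ (hP _ hxP).pos]
          · rfl
      simp [logWeight, this]
  · have h2 : supportInd P n = 0 := by simp [supportInd, hn]
    rw [h2, zero_mul]
    symm
    refine Finset.sum_eq_zero fun x hx => ?_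
    simp only [Finset.mem_filter, Nat.mem_divisorsAntidiagonal] at hx
    by_cases hxP : x.2 ∈ P
    · rw [← supportInd_mul_prime P (hP _ hxP) hxP hx.2, hx.1.1, h2, zero_mul]
    · simp [logWeight, hxP]

lemma sum_divisorsAntidiagonal_eq_sum_prod_filter (g : ℕ × ℕ → ℝ) (N : ℕ) :
    ∑ n ∈ Finset.Ioc 0 N, ∑ x ∈ n.divisorsAntidiagonal, g x =
      ∑ x ∈ Finset.Ioc 0 N ×ˢ Finset.Ioc 0 N with x.1 * x.2 ≤ N, g x := by
  trans ∑ n ∈ Finset.Ioc 0 N, ∑ x ∈ Finset.Ioc 0 N ×ˢ Finset.Ioc 0 N with x.1 * x.2 = n, g x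
  · refine Finset.sum_congr rfl fun n hn ↦ ?_
    simp only [Finset.mem_Ioc] at hn
    rw [Nat.divisorsAntidiagonal_eq_prod_filter_of_le hn.1.ne' hn.2]
  · simp_rw [Finset.sum_filter]
    rw [Finset.sum_comm]
    exact Finset.sum_congr rfl fun _ _ ↦ (by simp_all)

lemma sum_prod_filter_eq_sum_sum (g : ℕ × ℕ → ℝ) (N : ℕ) :
    ∑ x ∈ Finset.Ioc 0 N ×ˢ Finset.Ioc 0 N with x.1 * x.2 ≤ N, g x =
      ∑ m ∈ Finset.Ioc 0 N, ∑ p ∈ Finset.Ioc 0 (N / m), g (m, p) := by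
  rw [Finset.sum_filter, Finset.sum_product]
  refine Finset.sum_congr rfl fun n hn ↦ ?_
  rw [← Finset.sum_filter]
  congr 1
  ext p
  simp only [Finset.mem_filter, Finset.mem_Ioc] at hn ⊢
  rw [Nat.le_div_iff_mul_le hn.1, mul_comm p n]
  constructor
  · rintro ⟨⟨h1, h2⟩, h3⟩; exact ⟨h1, h3⟩
  · rintro ⟨h1, h3⟩; exact ⟨⟨h1, le_trans (Nat.le_mul_of_pos_left p hn.1) h3⟩, h3⟩

/-- Replacing `a n log n` by the Dirichlet convolution of `a` with the logarithmic prime weight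
costs only terms coming from squares of primes. -/
lemma convolution_sub_sum_mul_log_mem {P : Set ℕ} (hP : ∀ p ∈ P, Nat.Prime p) (F : ℕ → ℝ)
    (hF : ∀ n, 0 ≤ F n) (N : ℕ) :
    (∑ m ∈ Finset.Ioc 0 N, ∑ p ∈ Finset.Ioc 0 (N / m),
        supportInd P m * logWeight P p * F (m * p)) -
      ∑ n ∈ Finset.Ioc 0 N, supportInd P n * Real.log n * F n ∈
    Set.Icc 0 (∑ m ∈ Finset.Ioc 0 N, ∑ p ∈ Finset.Ioc 0 N with m * p ^ 2 ≤ N,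
        supportInd P m * logWeight P p * F (m * p ^ 2)) := by
  set g : ℕ × ℕ → ℝ := fun x => supportInd P x.1 * logWeight P x.2 * F (x.1 * x.2) with hg
  have hg0 : ∀ x, 0 ≤ g x := fun x => mul_nonneg
    (mul_nonneg (supportInd_nonneg _ _) (logWeight_nonneg _ _)) (hF _)
  have h1 : ∑ n ∈ Finset.Ioc 0 N, supportInd P n * Real.log n * F n =
      ∑ x ∈ Finset.Ioc 0 N ×ˢ Finset.Ioc 0 N with x.1 * x.2 ≤ N,
        if ¬ x.2 ∣ x.1 then g x else 0 := by
    rw [← sum_divisorsAntidiagonal_eq_sum_prod_filter]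
    refine Finset.sum_congr rfl fun n _ => ?_
    rw [supportInd_mul_log hP, ← Finset.sum_filter, Finset.sum_mul]
    refine Finset.sum_congr rfl fun x hx => ?_
    simp only [Finset.mem_filter, Nat.mem_divisorsAntidiagonal] at hx
    simp only [hg, hx.1.1]
  have h2 : ∑ m ∈ Finset.Ioc 0 N, ∑ p ∈ Finset.Ioc 0 (N / m),
        supportInd P m * logWeight P p * F (m * p) =
      ∑ x ∈ Finset.Ioc 0 N ×ˢ Finset.Ioc 0 N with x.1 * x.2 ≤ N, g x :=
    (sum_prod_filter_eq_sum_sum g N).symm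
  have h3 : (∑ x ∈ Finset.Ioc 0 N ×ˢ Finset.Ioc 0 N with x.1 * x.2 ≤ N, g x) -
      ∑ x ∈ Finset.Ioc 0 N ×ˢ Finset.Ioc 0 N with x.1 * x.2 ≤ N,
        (if ¬ x.2 ∣ x.1 then g x else 0) =
      ∑ x ∈ (Finset.Ioc 0 N ×ˢ Finset.Ioc 0 N).filter (fun x => x.1 * x.2 ≤ N) with x.2 ∣ x.1,
        g x := by
    rw [← Finset.sum_sub_distrib, Finset.sum_filter (fun x : ℕ × ℕ => x.2 ∣ x.1)]
    refine Finset.sum_congr rfl fun x _ => ?_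
    by_cases h : x.2 ∣ x.1 <;> simp [h]
  rw [h1, h2, h3]
  refine ⟨Finset.sum_nonneg fun x _ => hg0 x, ?_⟩
  set G : ℕ × ℕ → ℝ := fun x => supportInd P x.1 * logWeight P x.2 * F (x.1 * x.2 ^ 2) with hG
  have hG0 : ∀ x, 0 ≤ G x := fun x => mul_nonneg
    (mul_nonneg (supportInd_nonneg _ _) (logWeight_nonneg _ _)) (hF _)
  have h4 : ∑ m ∈ Finset.Ioc 0 N, ∑ p ∈ Finset.Ioc 0 N with m * p ^ 2 ≤ N,
        supportInd P m * logWeight P p * F (m * p ^ 2) =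
      ∑ x ∈ Finset.Ioc 0 N ×ˢ Finset.Ioc 0 N with x.1 * x.2 ^ 2 ≤ N, G x := by
    rw [Finset.sum_filter, Finset.sum_product]
    simp_rw [Finset.sum_filter]
    rfl
  rw [h4]
  set D := {x ∈ (Finset.Ioc 0 N ×ˢ Finset.Ioc 0 N).filter (fun x => x.1 * x.2 ≤ N) | x.2 ∣ x.1}
    with hD
  have hinj : Set.InjOn (fun x : ℕ × ℕ => (x.1 / x.2, x.2)) D := by
    rintro ⟨a, b⟩ hx ⟨c, d⟩ hy hxy
    simp only [hD, Finset.coe_filter, Finset.mem_filter, Set.mem_ofPred_eq] at hx hy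
    simp only [Prod.mk.injEq] at hxy ⊢
    obtain ⟨h, rfl⟩ := hxy
    exact ⟨by rw [← Nat.div_mul_cancel hx.2, h, Nat.div_mul_cancel hy.2], rfl⟩
  calc ∑ x ∈ D, g x ≤ ∑ x ∈ D, G (x.1 / x.2, x.2) := by
        refine Finset.sum_le_sum fun x hx => ?_
        have hd : x.2 ∣ x.1 := (Finset.mem_filter.1 hx).2
        have : x.1 / x.2 * x.2 ^ 2 = x.1 * x.2 := by
          rw [pow_two, ← mul_assoc, Nat.div_mul_cancel hd]
        simp only [hg, hG, this]
        exact mul_le_mul_of_nonneg_right (mul_le_mul_of_nonneg_right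
          (supportInd_le_of_dvd P (Nat.div_dvd_of_dvd hd)) (logWeight_nonneg _ _)) (hF _)
    _ = ∑ x ∈ D.image (fun x => (x.1 / x.2, x.2)), G x := by rw [Finset.sum_image hinj]
    _ ≤ _ := by
        refine Finset.sum_le_sum_of_subset_of_nonneg ?_ fun x _ _ => hG0 x
        intro y hy
        obtain ⟨x, hx, rfl⟩ := Finset.mem_image.1 hy
        simp only [hD, Finset.mem_filter, Finset.mem_product, Finset.mem_Ioc] at hx ⊢
        obtain ⟨⟨⟨⟨h1, h2⟩, h3, h4⟩, h5⟩, h6⟩ := hx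
        refine ⟨⟨⟨Nat.div_pos (Nat.le_of_dvd h1 h6) h3, (Nat.div_le_self _ _).trans h2⟩, h3, h4⟩, ?_⟩
        rwa [pow_two, ← mul_assoc, Nat.div_mul_cancel h6]

open Classical in
/-- The number of elements of `P` in `[0, x]`. -/
noncomputable def countUpTo (P : Set ℕ) (x : ℝ) : ℝ :=
  ∑ k ∈ Finset.Icc 0 ⌊x⌋₊, if k ∈ P then (1 : ℝ) else 0

/-- The Chebyshev function of a set of primes. -/
noncomputable def thetaOn (P : Set ℕ) (x : ℝ) : ℝ := ∑ p ∈ Finset.Ioc 0 ⌊x⌋₊, logWeight P p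

/-- The sum of `log p / p` over the elements of `P` up to `x`. -/
noncomputable def mertensOn (P : Set ℕ) (x : ℝ) : ℝ :=
  ∑ p ∈ Finset.Ioc 0 ⌊x⌋₊, logWeight P p / p

lemma ncard_eq_sum_ite {S : Set ℕ} [DecidablePred (· ∈ S)] (s : Finset ℕ) {T : Set ℕ}
    (h : ∀ n, n ∈ T ↔ n ∈ s ∧ n ∈ S) :
    (T.ncard : ℝ) = ∑ k ∈ s, if k ∈ S then (1 : ℝ) else 0 := by
  have : T = (s.filter (· ∈ S) : Finset ℕ) := by ext n; simp [h]
  rw [this, Set.ncard_coe_finset, Finset.sum_boole]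

lemma ncard_eq_countUpTo (P : Set ℕ) {x : ℝ} (hx : 0 ≤ x) :
    (({p : ℕ | p ∈ P ∧ (p : ℝ) ≤ x}.ncard : ℝ)) = countUpTo P x := by
  classical
  unfold countUpTo
  convert ncard_eq_sum_ite (S := P) (Finset.Icc 0 ⌊x⌋₊) _
  intro n
  simp [Nat.le_floor_iff hx, and_comm]

lemma countUpTo_nonneg (P : Set ℕ) (x : ℝ) : 0 ≤ countUpTo P x :=
  Finset.sum_nonneg fun _ _ => by split_ifs <;> simp

lemma countUpTo_le {P : Set ℕ} (hP : ∀ p ∈ P, Nat.Prime p) {x : ℝ} (hx : 0 ≤ x) :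
    countUpTo P x ≤ x := by
  classical
  have h0 : 0 ∉ P := fun h => Nat.not_prime_zero (hP 0 h)
  unfold countUpTo
  rw [← Finset.add_sum_Ioc_eq_sum_Icc (Nat.zero_le _), if_neg h0, zero_add]
  calc _ ≤ ∑ k ∈ Finset.Ioc 0 ⌊x⌋₊, (1 : ℝ) :=
        Finset.sum_le_sum fun _ _ => by split_ifs <;> simp
    _ = ⌊x⌋₊ := by simp
    _ ≤ x := Nat.floor_le hx

lemma logWeight_le_log_prime {P : Set ℕ} (hP : ∀ p ∈ P, Nat.Prime p) (p : ℕ) :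
    logWeight P p ≤ if p.Prime then Real.log p else 0 := by
  unfold logWeight
  split_ifs with h1 h2 h2
  · exact le_rfl
  · exact absurd (hP p h1) h2
  · exact Real.log_natCast_nonneg p
  · exact le_rfl

lemma thetaOn_le {P : Set ℕ} (hP : ∀ p ∈ P, Nat.Prime p) {x : ℝ} (hx : 0 ≤ x) :
    thetaOn P x ≤ Real.log 4 * x := by
  refine le_trans ?_ (Chebyshev.theta_le_log4_mul_x hx)
  unfold thetaOn Chebyshev.theta
  rw [Finset.sum_filter]
  exact Finset.sum_le_sum fun p _ => logWeight_le_log_prime hP p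

lemma thetaOn_nonneg (P : Set ℕ) (x : ℝ) : 0 ≤ thetaOn P x :=
  Finset.sum_nonneg fun _ _ => logWeight_nonneg _ _

lemma countUpTo_mul_log_sub_thetaOn_mem {P : Set ℕ} (hP : ∀ p ∈ P, Nat.Prime p) {x : ℝ}
    (hx : 1 ≤ x) :
    countUpTo P x * Real.log x - thetaOn P x ∈
      Set.Icc 0 ((Nat.primeCounting ⌊x⌋₊ : ℝ) * Real.log x - Chebyshev.theta x) := by
  classical
  have h0 : 0 ∉ P := fun h => Nat.not_prime_zero (hP 0 h)
  have hc : countUpTo P x * Real.log x - thetaOn P x =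
      ∑ p ∈ Finset.Ioc 0 ⌊x⌋₊, if p ∈ P then Real.log x - Real.log p else 0 := by
    unfold countUpTo thetaOn logWeight
    rw [← Finset.add_sum_Ioc_eq_sum_Icc (Nat.zero_le _), if_neg h0, zero_add, Finset.sum_mul,
      ← Finset.sum_sub_distrib]
    refine Finset.sum_congr rfl fun p _ => ?_
    by_cases h : p ∈ P <;> simp [h]
  have hp : (Nat.primeCounting ⌊x⌋₊ : ℝ) * Real.log x - Chebyshev.theta x =
      ∑ p ∈ Finset.Ioc 0 ⌊x⌋₊, if p.Prime then Real.log x - Real.log p else 0 := by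
    have : Nat.primesLE ⌊x⌋₊ = (Finset.Ioc 0 ⌊x⌋₊).filter Nat.Prime := by
      ext p
      simp only [Nat.mem_primesLE, Finset.mem_filter, Finset.mem_Ioc]
      exact ⟨fun h => ⟨⟨h.2.pos, h.1⟩, h.2⟩, fun h => ⟨h.1.2, h.2⟩⟩
    unfold Chebyshev.theta
    rw [← Nat.primesLE_card_eq_primeCounting, this, ← Finset.sum_filter, Finset.sum_sub_distrib]
    simp
  have hnn : ∀ p ∈ Finset.Ioc 0 ⌊x⌋₊, 0 ≤ Real.log x - Real.log p := by
    intro p hp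
    rw [Finset.mem_Ioc] at hp
    have : (p : ℝ) ≤ x := (Nat.le_floor_iff (by linarith)).1 hp.2
    have h1 : (0 : ℝ) < p := by exact_mod_cast hp.1
    linarith [Real.log_le_log h1 this]
  rw [hc, hp]
  refine ⟨Finset.sum_nonneg fun p hp => ?_, Finset.sum_le_sum fun p hp => ?_⟩
  · split_ifs
    · exact hnn p hp
    · exact le_rfl
  · split_ifs with h1 h2 h2
    · exact le_rfl
    · exact absurd (hP p h1) h2
    · exact hnn p hp
    · exact le_rfl

lemma tendsto_thetaOn_div {P : Set ℕ} (hP : ∀ p ∈ P, Nat.Prime p) {τ β : ℝ} (hβ : 0 < β)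
    (h : (fun x : ℝ => countUpTo P x - τ * x / Real.log x)
        =O[atTop] (fun x : ℝ => x / Real.log x ^ (1 + β))) :
    Tendsto (fun x => thetaOn P x / x) atTop (nhds τ) := by
  have h1 : Tendsto (fun x => (countUpTo P x - τ * x / Real.log x) * (Real.log x / x))
      atTop (nhds 0) := by
    have : (fun x : ℝ => (countUpTo P x - τ * x / Real.log x) * (Real.log x / x))
        =O[atTop] fun x => (x / Real.log x ^ (1 + β)) * (Real.log x / x) :=
      h.mul (Asymptotics.isBigO_refl _ _)
    refine this.trans_tendsto ?_
    have h2 : Tendsto (fun x => Real.log x ^ (-β)) atTop (nhds 0) :=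
      (tendsto_rpow_neg_atTop hβ).comp tendsto_log_atTop
    refine h2.congr' ?_
    filter_upwards [eventually_gt_atTop 1] with x hx
    have hl : 0 < Real.log x := Real.log_pos hx
    have hx0 : x ≠ 0 := by positivity
    rw [Real.rpow_add hl, Real.rpow_one, Real.rpow_neg hl.le]
    field_simp
  have h3 : Tendsto (fun x => ((Nat.primeCounting ⌊x⌋₊ : ℝ) - Chebyshev.theta x / Real.log x) *
      (Real.log x / x)) atTop (nhds 0) := by
    have : (fun x : ℝ => ((Nat.primeCounting ⌊x⌋₊ : ℝ) - Chebyshev.theta x / Real.log x) *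
        (Real.log x / x)) =O[atTop] fun x => (x / Real.log x ^ 2) * (Real.log x / x) :=
      Chebyshev.primeCounting_sub_theta_div_log_isBigO.mul (Asymptotics.isBigO_refl _ _)
    refine this.trans_tendsto ?_
    refine (tendsto_inv_atTop_zero.comp tendsto_log_atTop).congr' ?_
    filter_upwards [eventually_gt_atTop 1] with x hx
    have hl : 0 < Real.log x := Real.log_pos hx
    have hx0 : x ≠ 0 := by positivity
    simp only [Function.comp]
    field_simp
  have h4 : Tendsto (fun x => (countUpTo P x * Real.log x - thetaOn P x) / x) atTop (nhds 0) := by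
    refine squeeze_zero' ?_ ?_ h3
    · filter_upwards [eventually_gt_atTop 1] with x hx
      exact div_nonneg (countUpTo_mul_log_sub_thetaOn_mem hP hx.le).1 (by linarith)
    · filter_upwards [eventually_gt_atTop 1] with x hx
      have hl : 0 < Real.log x := Real.log_pos hx
      have hx0 : 0 < x := by positivity
      calc _ ≤ _ := div_le_div_of_nonneg_right
            (countUpTo_mul_log_sub_thetaOn_mem hP hx.le).2 hx0.le
        _ = _ := by field_simp
  have h5 := (h1.sub h4).add_const τ
  simp only [sub_zero, zero_add] at h5
  refine h5.congr' ?_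
  filter_upwards [eventually_gt_atTop 1] with x hx
  have hl : 0 < Real.log x := Real.log_pos hx
  have hx0 : x ≠ 0 := by positivity
  field_simp
  ring

lemma exists_abs_countUpTo_sub_le {P : Set ℕ} (hP : ∀ p ∈ P, Nat.Prime p) {τ β : ℝ} (hτ : 0 < τ)
    (hβ : 0 < β)
    (h : (fun x : ℝ => countUpTo P x - τ * x / Real.log x)
        =O[atTop] (fun x : ℝ => x / Real.log x ^ (1 + β))) :
    ∃ K, 0 < K ∧ ∀ x, 2 ≤ x →
      |countUpTo P x - τ * x / Real.log x| ≤ K * (x / Real.log x ^ (1 + β)) := by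
  obtain ⟨C, hC⟩ := h.bound
  obtain ⟨x₀, hx₀⟩ := eventually_atTop.1 hC
  have hl2 : 0 < Real.log 2 := Real.log_pos (by norm_num)
  set M := (1 + τ / Real.log 2) * Real.log (max x₀ 2) ^ (1 + β) with hM
  have hlm : 0 < Real.log (max x₀ 2) := Real.log_pos (by have := le_max_right x₀ 2; linarith)
  have hM0 : 0 < M := by positivity
  refine ⟨|C| + M, by positivity, fun x hx => ?_⟩
  have hl : 0 < Real.log x := Real.log_pos (by linarith)
  have hq : 0 ≤ x / Real.log x ^ (1 + β) := by positivity
  rcases le_total x₀ x with hx' | hx'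
  · have := hx₀ x hx'
    rw [Real.norm_eq_abs, Real.norm_eq_abs, abs_of_nonneg hq] at this
    refine this.trans (mul_le_mul_of_nonneg_right ?_ hq)
    linarith [le_abs_self C]
  · have h1 : |countUpTo P x - τ * x / Real.log x| ≤ (1 + τ / Real.log 2) * x := by
      have h2 := countUpTo_nonneg P x
      have h3 := countUpTo_le hP (x := x) (by linarith)
      have h4 : 0 ≤ τ * x / Real.log x := by positivity
      have h5 : τ * x / Real.log x ≤ τ / Real.log 2 * x := by
        rw [mul_div_right_comm]
        gcongr
      rw [abs_le]
      have h6 : 0 ≤ τ / Real.log 2 * x := by positivity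
      constructor <;> linarith
    refine h1.trans ?_
    have h7 : Real.log x ^ (1 + β) ≤ Real.log (max x₀ 2) ^ (1 + β) :=
      Real.rpow_le_rpow hl.le (Real.log_le_log (by linarith) (hx'.trans (le_max_left _ _)))
        (by linarith)
    have h8 : 0 < Real.log x ^ (1 + β) := by positivity
    calc (1 + τ / Real.log 2) * x
        = (1 + τ / Real.log 2) * Real.log x ^ (1 + β) * (x / Real.log x ^ (1 + β)) := by
          field_simp
      _ ≤ M * (x / Real.log x ^ (1 + β)) := by
          refine mul_le_mul_of_nonneg_right ?_ hq
          exact mul_le_mul_of_nonneg_left h7 (by positivity)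
      _ ≤ _ := mul_le_mul_of_nonneg_right (by linarith [abs_nonneg C]) hq

lemma integral_inv_mul_log_rpow_neg_le {β : ℝ} (hβ1 : β < 1) {x : ℝ} (hx : 2 ≤ x) :
    (∫ t in (2 : ℝ)..x, t⁻¹ * Real.log t ^ (-β)) ≤ Real.log x ^ (1 - β) / (1 - β) ∧
      IntervalIntegrable (fun t : ℝ => t⁻¹ * Real.log t ^ (-β)) MeasureTheory.volume 2 x := by
  have hpos : ∀ t ∈ Set.uIcc 2 x, 0 < t ∧ 0 < Real.log t := by
    intro t ht
    rw [Set.uIcc_of_le hx] at ht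
    exact ⟨by linarith [ht.1], Real.log_pos (by linarith [ht.1])⟩
  have hint : IntervalIntegrable (fun t : ℝ => t⁻¹ * Real.log t ^ (-β))
      MeasureTheory.volume 2 x := by
    refine ContinuousOn.intervalIntegrable fun t ht => ContinuousAt.continuousWithinAt ?_
    obtain ⟨h1, h2⟩ := hpos t ht
    exact (continuousAt_inv₀ h1.ne').mul
      ((Real.continuousAt_log h1.ne').rpow_const (Or.inl h2.ne'))
  refine ⟨?_, hint⟩
  have hd : ∀ t ∈ Set.uIcc 2 x, HasDerivAt (fun t : ℝ => Real.log t ^ (1 - β) / (1 - β))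
      (t⁻¹ * Real.log t ^ (-β)) t := by
    intro t ht
    obtain ⟨h1, h2⟩ := hpos t ht
    have := ((Real.hasDerivAt_log h1.ne').rpow_const (p := 1 - β) (Or.inl h2.ne')).div_const (1 - β)
    refine this.congr_deriv ?_
    have : 1 - β ≠ 0 := by linarith
    rw [show 1 - β - 1 = -β by ring]
    field_simp
  rw [intervalIntegral.integral_eq_sub_of_hasDerivAt hd hint]
  have : 0 ≤ Real.log 2 ^ (1 - β) / (1 - β) :=
    div_nonneg (Real.rpow_nonneg (Real.log_nonneg (by norm_num)) _) (by linarith)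
  linarith

lemma mertensOn_eq {P : Set ℕ} (hP : ∀ p ∈ P, Nat.Prime p) {x : ℝ} (hx : 2 ≤ x) :
    IntervalIntegrable (fun t => (Real.log t - 1) / t ^ 2 * countUpTo P t)
      MeasureTheory.volume 2 x ∧
    mertensOn P x = Real.log x / x * countUpTo P x +
      ∫ t in (2 : ℝ)..x, (Real.log t - 1) / t ^ 2 * countUpTo P t := by
  classical
  have h0 : 0 ∉ P := fun h => Nat.not_prime_zero (hP 0 h)
  have h1 : 1 ∉ P := fun h => Nat.not_prime_one (hP 1 h)
  set c : ℕ → ℝ := fun k => if k ∈ P then (1 : ℝ) else 0 with hc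
  have hcount : ∀ t, countUpTo P t = ∑ k ∈ Finset.Icc 0 ⌊t⌋₊, c k := fun t => by
    unfold countUpTo; simp only [hc]
  have hd : ∀ t : ℝ, 2 ≤ t →
      HasDerivAt (fun t : ℝ => Real.log t / t) (-((Real.log t - 1) / t ^ 2)) t := by
    intro t ht
    have ht0 : t ≠ 0 := by linarith
    refine ((Real.hasDerivAt_log ht0).div (hasDerivAt_id' t) ht0).congr_deriv ?_
    field_simp
    ring
  have hcont : ContinuousOn (fun t : ℝ => (Real.log t - 1) / t ^ 2) (Set.Icc 2 x) := by
    intro t ht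
    have ht0 : t ≠ 0 := by linarith [ht.1]
    exact (((Real.continuousAt_log ht0).sub continuousAt_const).div
      (continuousAt_id.pow 2) (pow_ne_zero 2 ht0)).continuousWithinAt
  have hg : MeasureTheory.IntegrableOn (fun t : ℝ => (Real.log t - 1) / t ^ 2) (Set.Icc 2 x) :=
    hcont.integrableOn_Icc
  have hint := integrableOn_mul_sum_Icc (m := 0) c (zero_le_two) hg
  have hint' : IntervalIntegrable (fun t => (Real.log t - 1) / t ^ 2 * countUpTo P t)
      MeasureTheory.volume 2 x := by
    rw [intervalIntegrable_iff_integrableOn_Icc_of_le hx]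
    simpa only [hcount] using hint
  refine ⟨hint', ?_⟩
  have habel := sum_mul_eq_sub_integral_mul₁ c (f := fun t : ℝ => Real.log t / t)
    (by simp [hc, h0]) (by simp [hc, h1]) x (fun t ht => (hd t ht.1).differentiableAt)
    (hg.neg.congr_fun (fun t ht => ((hd t ht.1).deriv).symm) measurableSet_Icc)
  have hm : mertensOn P x = ∑ k ∈ Finset.Icc 0 ⌊x⌋₊, Real.log k / k * c k := by
    unfold mertensOn logWeight
    rw [← Finset.add_sum_Ioc_eq_sum_Icc (Nat.zero_le _)]
    simp only [hc, h0, if_false, mul_zero, zero_add]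
    refine Finset.sum_congr rfl fun p _ => ?_
    by_cases h : p ∈ P <;> simp [h]
  rw [hm, habel, hcount, sub_eq_add_neg, intervalIntegral.integral_of_le hx,
    ← MeasureTheory.integral_neg]
  congr 1
  refine MeasureTheory.setIntegral_congr_fun measurableSet_Ioc fun t ht => ?_
  simp only [(hd t ht.1.le).deriv, hcount]
  ring

lemma exists_abs_mertensOn_sub_le {P : Set ℕ} (hP : ∀ p ∈ P, Nat.Prime p) {τ β : ℝ}
    (hτ : 0 < τ) (hβ : 0 < β) (hβ1 : β < 1)
    (h : (fun x : ℝ => countUpTo P x - τ * x / Real.log x)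
        =O[atTop] (fun x : ℝ => x / Real.log x ^ (1 + β))) :
    ∃ K, 0 < K ∧ ∀ x, 1 ≤ x →
      |mertensOn P x - τ * Real.log x| ≤ K * (1 + Real.log x) ^ (1 - β) := by
  obtain ⟨K, hK, hb⟩ := exists_abs_countUpTo_sub_le hP hτ hβ h
  have hl2 : 1 / 2 < Real.log 2 := by linarith [Real.log_two_gt_d9]
  have hl20 : 0 < Real.log 2 := by linarith
  set K₂ := τ * Real.log 2 ^ (β - 1) + K with hK₂
  have hK₂0 : 0 < K₂ := by positivity
  have hβ' : 0 < 1 - β := by linarith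
  refine ⟨τ + K * Real.log 2 ^ (-β) + τ * Real.log 2 + K₂ / (1 - β), by positivity, fun x hx => ?_⟩
  have hlx : 0 ≤ Real.log x := Real.log_nonneg hx
  have hone : 1 ≤ (1 + Real.log x) ^ (1 - β) := Real.one_le_rpow (by linarith) hβ'.le
  rcases lt_or_ge x 2 with hx2 | hx2
  · have hm : mertensOn P x = 0 := by
      unfold mertensOn
      refine Finset.sum_eq_zero fun p hp => ?_
      have : p ∉ P := by
        intro hpP
        have h1 := (hP p hpP).two_le
        have h2 : ⌊x⌋₊ < 2 := (Nat.floor_lt (by linarith)).2 (by exact_mod_cast hx2)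
        rw [Finset.mem_Ioc] at hp
        omega
      simp [logWeight, this]
    rw [hm, zero_sub, abs_neg, abs_of_nonneg (by positivity)]
    calc τ * Real.log x ≤ τ * Real.log 2 := by gcongr
      _ ≤ τ + K * Real.log 2 ^ (-β) + τ * Real.log 2 + K₂ / (1 - β) := by
        have : 0 ≤ τ + K * Real.log 2 ^ (-β) + K₂ / (1 - β) := by positivity
        linarith
      _ ≤ _ := le_mul_of_one_le_right (by positivity) hone
  · obtain ⟨hint, heq⟩ := mertensOn_eq hP hx2
    obtain ⟨hJ, hJint⟩ := integral_inv_mul_log_rpow_neg_le hβ1 hx2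
    have hlx2 : Real.log 2 ≤ Real.log x := Real.log_le_log (by norm_num) hx2
    have hx0 : 0 < x := by linarith
    have hlx0 : 0 < Real.log x := by linarith
    have hinv : IntervalIntegrable (fun t : ℝ => τ * t⁻¹) MeasureTheory.volume 2 x := by
      refine ContinuousOn.intervalIntegrable fun t ht => ?_
      rw [Set.uIcc_of_le hx2] at ht
      exact ((continuousAt_inv₀ (by linarith [ht.1])).const_mul τ).continuousWithinAt
    have hinvval : ∫ t in (2 : ℝ)..x, τ * t⁻¹ = τ * (Real.log x - Real.log 2) := by
      rw [intervalIntegral.integral_const_mul, integral_inv_of_pos (by norm_num) hx0,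
        Real.log_div hx0.ne' (by norm_num)]
    have hfirst : |Real.log x / x * countUpTo P x| ≤ τ + K * Real.log 2 ^ (-β) := by
      have hc := (abs_le.1 (hb x hx2)).2
      rw [abs_of_nonneg (mul_nonneg (by positivity) (countUpTo_nonneg P x))]
      calc Real.log x / x * countUpTo P x
          ≤ Real.log x / x * (τ * x / Real.log x + K * (x / Real.log x ^ (1 + β))) := by
            refine mul_le_mul_of_nonneg_left ?_ (by positivity)
            linarith
        _ = τ + K * Real.log x ^ (-β) := by
            rw [Real.rpow_add hlx0, Real.rpow_one, Real.rpow_neg hlx0.le]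
            field_simp
        _ ≤ τ + K * Real.log 2 ^ (-β) := by
            exact add_le_add_right (mul_le_mul_of_nonneg_left
              (Real.rpow_le_rpow_of_nonpos hl20 hlx2 (by linarith)) hK.le) _
    have hbound : ∀ t ∈ Set.Ioc 2 x,
        ‖(Real.log t - 1) / t ^ 2 * countUpTo P t - τ * t⁻¹‖ ≤
          K₂ * (t⁻¹ * Real.log t ^ (-β)) := by
      intro t ht
      have ht2 : 2 ≤ t := ht.1.le
      have ht0 : 0 < t := by linarith
      have hlt2 : Real.log 2 ≤ Real.log t := Real.log_le_log (by norm_num) ht2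
      have hlt : 0 < Real.log t := by linarith
      have hE := hb t ht2
      set E := countUpTo P t - τ * t / Real.log t with hEdef
      have hce : countUpTo P t = τ * t / Real.log t + E := by rw [hEdef]; ring
      have hsplit : (Real.log t - 1) / t ^ 2 * countUpTo P t - τ * t⁻¹ =
          -(τ * t⁻¹ * (Real.log t)⁻¹) + (Real.log t - 1) / t ^ 2 * E := by
        rw [hce]; field_simp; ring
      have hA : τ * t⁻¹ * (Real.log t)⁻¹ ≤
          τ * Real.log 2 ^ (β - 1) * (t⁻¹ * Real.log t ^ (-β)) := by
        have h1 : (Real.log t)⁻¹ = Real.log t ^ (β - 1) * Real.log t ^ (-β) := by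
          rw [← Real.rpow_add hlt, ← Real.rpow_neg_one]; congr 1; ring
        have h2 : Real.log t ^ (β - 1) ≤ Real.log 2 ^ (β - 1) :=
          Real.rpow_le_rpow_of_nonpos hl20 hlt2 (by linarith)
        rw [h1]
        calc _ = Real.log t ^ (β - 1) * (τ * t⁻¹ * Real.log t ^ (-β)) := by ring
          _ ≤ Real.log 2 ^ (β - 1) * (τ * t⁻¹ * Real.log t ^ (-β)) := by gcongr
          _ = _ := by ring
      have hB : |(Real.log t - 1) / t ^ 2 * E| ≤ K * (t⁻¹ * Real.log t ^ (-β)) := by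
        rw [abs_mul, abs_div, abs_of_pos (pow_pos ht0 2)]
        have h1 : |Real.log t - 1| ≤ Real.log t := by
          rw [abs_le]; constructor <;> linarith
        calc |Real.log t - 1| / t ^ 2 * |E|
            ≤ Real.log t / t ^ 2 * (K * (t / Real.log t ^ (1 + β))) := by gcongr
          _ = _ := by
            rw [Real.rpow_add hlt, Real.rpow_one, Real.rpow_neg hlt.le]
            field_simp
      rw [hsplit, Real.norm_eq_abs]
      refine (abs_add_le _ _).trans ?_
      rw [abs_neg, abs_of_nonneg (by positivity : 0 ≤ τ * t⁻¹ * (Real.log t)⁻¹), hK₂, add_mul]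
      exact add_le_add hA hB
    have hI := intervalIntegral.norm_integral_le_of_norm_le hx2
      (MeasureTheory.ae_of_all _ hbound) (hJint.const_mul K₂)
    rw [intervalIntegral.integral_sub hint hinv, hinvval, intervalIntegral.integral_const_mul,
      Real.norm_eq_abs] at hI
    have hpow : Real.log x ^ (1 - β) ≤ (1 + Real.log x) ^ (1 - β) :=
      Real.rpow_le_rpow hlx0.le (by linarith) hβ'.le
    set I := ∫ t in (2 : ℝ)..x, (Real.log t - 1) / t ^ 2 * countUpTo P t
    have hfin : mertensOn P x - τ * Real.log x =
        Real.log x / x * countUpTo P x + (I - τ * (Real.log x - Real.log 2)) -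
          τ * Real.log 2 := by rw [heq]; ring
    have hI2 : |I - τ * (Real.log x - Real.log 2)| ≤
        K₂ / (1 - β) * (1 + Real.log x) ^ (1 - β) := by
      refine hI.trans ?_
      calc _ ≤ K₂ * (Real.log x ^ (1 - β) / (1 - β)) := by gcongr
        _ = K₂ / (1 - β) * Real.log x ^ (1 - β) := by ring
        _ ≤ _ := by gcongr
    have hc0 : 0 ≤ τ + K * Real.log 2 ^ (-β) + τ * Real.log 2 := by positivity
    rw [hfin]
    calc _ ≤ |Real.log x / x * countUpTo P x| + |I - τ * (Real.log x - Real.log 2)| +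
          |τ * Real.log 2| := (abs_sub _ _).trans (add_le_add (abs_add_le _ _) le_rfl)
      _ ≤ (τ + K * Real.log 2 ^ (-β)) + K₂ / (1 - β) * (1 + Real.log x) ^ (1 - β) +
          τ * Real.log 2 := by
          rw [abs_of_nonneg (by positivity : 0 ≤ τ * Real.log 2)]
          gcongr
      _ ≤ _ := by nlinarith [mul_le_mul_of_nonneg_left hone hc0]

/-- The sum of `b m` over positive integers `m ≤ x`. -/
noncomputable def summatory (b : ℕ → ℝ) (x : ℝ) : ℝ := ∑ m ∈ Finset.Ioc 0 ⌊x⌋₊, b m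

/-- The logarithmic primitive `∑_{m ≤ x} b m * log (x / m)` at `x = exp u`. -/
noncomputable def logPrimitive (b : ℕ → ℝ) (u : ℝ) : ℝ :=
  ∑ m ∈ Finset.Ioc 0 ⌊Real.exp u⌋₊, b m * (u - Real.log m)

lemma mem_Ioc_floor_exp {u : ℝ} {m : ℕ} :
    m ∈ Finset.Ioc 0 ⌊Real.exp u⌋₊ ↔ 0 < m ∧ Real.log m ≤ u := by
  rw [Finset.mem_Ioc]
  refine and_congr_right fun hm => ?_
  rw [Nat.le_floor_iff (Real.exp_pos u).le, Real.log_le_iff_le_exp (by exact_mod_cast hm)]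

lemma logPrimitive_eq_sum_max (b : ℕ → ℝ) {u v : ℝ} (huv : u ≤ v) :
    logPrimitive b u = ∑ m ∈ Finset.Ioc 0 ⌊Real.exp v⌋₊, b m * max 0 (u - Real.log m) := by
  unfold logPrimitive
  have hsub : Finset.Ioc 0 ⌊Real.exp u⌋₊ ⊆ Finset.Ioc 0 ⌊Real.exp v⌋₊ :=
    Finset.Ioc_subset_Ioc_right (Nat.floor_le_floor (Real.exp_le_exp.2 huv))
  rw [← Finset.sum_subset hsub]
  · refine Finset.sum_congr rfl fun m hm => ?_
    rw [max_eq_right (by linarith [(mem_Ioc_floor_exp.1 hm).2])]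
  · intro m hm hm'
    have : ¬ Real.log m ≤ u := fun h => hm' (mem_Ioc_floor_exp.2 ⟨(mem_Ioc_floor_exp.1 hm).1, h⟩)
    rw [max_eq_left (by linarith), mul_zero]

lemma summatory_exp_eq_sum_ite (b : ℕ → ℝ) {u v : ℝ} (huv : u ≤ v) :
    summatory b (Real.exp u) =
      ∑ m ∈ Finset.Ioc 0 ⌊Real.exp v⌋₊, b m * (if Real.log m ≤ u then 1 else 0) := by
  unfold summatory
  have hsub : Finset.Ioc 0 ⌊Real.exp u⌋₊ ⊆ Finset.Ioc 0 ⌊Real.exp v⌋₊ :=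
    Finset.Ioc_subset_Ioc_right (Nat.floor_le_floor (Real.exp_le_exp.2 huv))
  rw [← Finset.sum_subset hsub]
  · refine Finset.sum_congr rfl fun m hm => ?_
    rw [if_pos (mem_Ioc_floor_exp.1 hm).2, mul_one]
  · intro m hm hm'
    have : ¬ Real.log m ≤ u := fun h => hm' (mem_Ioc_floor_exp.2 ⟨(mem_Ioc_floor_exp.1 hm).1, h⟩)
    rw [if_neg this, mul_zero]

lemma continuous_logPrimitive (b : ℕ → ℝ) : Continuous (logPrimitive b) := by
  rw [continuous_iff_continuousAt]
  intro u
  have h : Continuous fun v : ℝ =>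
      ∑ m ∈ Finset.Ioc 0 ⌊Real.exp (u + 1)⌋₊, b m * max 0 (v - Real.log m) := by fun_prop
  refine h.continuousAt.congr ?_
  filter_upwards [eventually_lt_nhds (lt_add_one u)] with v hv
  exact (logPrimitive_eq_sum_max b hv.le).symm

lemma hasDerivWithinAt_max_sub (c u : ℝ) :
    HasDerivWithinAt (fun v : ℝ => max 0 (v - c)) (if c ≤ u then 1 else 0) (Set.Ici u) u := by
  split_ifs with h
  · refine ((hasDerivAt_id' u).sub_const c).hasDerivWithinAt.congr (fun v hv => ?_) ?_
    · exact max_eq_right (by linarith [Set.mem_Ici.1 hv])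
    · exact max_eq_right (by linarith)
  · refine ((hasDerivAt_const u (0 : ℝ)).congr_of_eventuallyEq ?_).hasDerivWithinAt
    filter_upwards [eventually_lt_nhds (not_le.1 h)] with v hv
    exact max_eq_left (by linarith)

lemma hasDerivWithinAt_logPrimitive (b : ℕ → ℝ) (u : ℝ) :
    HasDerivWithinAt (logPrimitive b) (summatory b (Real.exp u)) (Set.Ici u) u := by
  rw [summatory_exp_eq_sum_ite b (lt_add_one u).le]
  have h : HasDerivWithinAt (fun v : ℝ =>
      ∑ m ∈ Finset.Ioc 0 ⌊Real.exp (u + 1)⌋₊, b m * max 0 (v - Real.log m))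
      (∑ m ∈ Finset.Ioc 0 ⌊Real.exp (u + 1)⌋₊, b m * (if Real.log m ≤ u then 1 else 0))
      (Set.Ici u) u :=
    HasDerivWithinAt.fun_sum fun m _ => (hasDerivWithinAt_max_sub (Real.log m) u).const_mul (b m)
  refine h.congr_of_eventuallyEq ?_ (logPrimitive_eq_sum_max b (lt_add_one u).le)
  filter_upwards [nhdsWithin_le_nhds (eventually_lt_nhds (lt_add_one u))] with v hv
  exact logPrimitive_eq_sum_max b hv.le

lemma le_logPrimitive {b : ℕ → ℝ} (hb : ∀ n, 0 ≤ b n) (hb1 : b 1 = 1) {u : ℝ} (hu : 0 ≤ u) :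
    u ≤ logPrimitive b u := by
  have h1 : 1 ∈ Finset.Ioc 0 ⌊Real.exp u⌋₊ := mem_Ioc_floor_exp.2 ⟨one_pos, by simpa using hu⟩
  have := Finset.single_le_sum (f := fun m : ℕ => b m * (u - Real.log m))
    (fun m hm => mul_nonneg (hb m) (by linarith [(mem_Ioc_floor_exp.1 hm).2])) h1
  unfold logPrimitive
  simpa [hb1] using this

/-- A function on a half line whose right derivative is `O(u ^ (-1 - β))` converges. -/
lemma exists_tendsto_of_abs_rightDeriv_le {W w : ℝ → ℝ} {u₀ K β : ℝ} (hu₀ : 0 < u₀) (hβ : 0 < β)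
    (hK : 0 ≤ K) (hW : ContinuousOn W (Set.Ici u₀))
    (hd : ∀ u, u₀ ≤ u → HasDerivWithinAt W (w u) (Set.Ici u) u)
    (hw : ∀ u, u₀ ≤ u → |w u| ≤ K * u ^ (-β - 1)) :
    ∃ l, Tendsto W atTop (nhds l) := by
  have key : ∀ u v, u₀ ≤ u → u ≤ v → |W v - W u| ≤ K / β * u ^ (-β) := by
    intro u v hu huv
    have hu0 : 0 < u := hu₀.trans_le hu
    have hBd : ∀ x, u ≤ x →
        HasDerivAt (fun x : ℝ => K / β * (u ^ (-β) - x ^ (-β))) (K * x ^ (-β - 1)) x := by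
      intro x hx
      have hx0 : 0 < x := hu0.trans_le hx
      refine (((Real.hasDerivAt_rpow_const (p := -β) (Or.inl hx0.ne')).const_sub
        (u ^ (-β))).const_mul (K / β)).congr_deriv ?_
      field_simp
    have := image_norm_le_of_norm_deriv_right_le_deriv_boundary' (f := fun x => W x - W u)
      (f' := w) (a := u) (b := v) (B := fun x : ℝ => K / β * (u ^ (-β) - x ^ (-β)))
      (B' := fun x => K * x ^ (-β - 1))
      ((hW.mono fun x hx => hu.trans hx.1).sub continuousOn_const)
      (fun x hx => (hd x (hu.trans hx.1)).sub_const (W u)) (by simp)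
      (fun x hx => (hBd x hx.1).continuousAt.continuousWithinAt)
      (fun x hx => (hBd x hx.1).hasDerivWithinAt)
      (fun x hx => hw x (hu.trans hx.1)) ⟨huv, le_rfl⟩
    refine this.trans (mul_le_mul_of_nonneg_left ?_ (by positivity))
    have : 0 ≤ v ^ (-β) := Real.rpow_nonneg (hu0.le.trans huv) _
    linarith
  refine cauchySeq_tendsto_of_complete (Metric.cauchySeq_iff'.2 fun ε hε => ?_)
  have hlim : Tendsto (fun u : ℝ => K / β * u ^ (-β)) atTop (nhds 0) := by
    simpa using (tendsto_rpow_neg_atTop hβ).const_mul (K / β)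
  obtain ⟨N, hN, hN'⟩ :=
    ((hlim.eventually (gt_mem_nhds hε)).and (eventually_ge_atTop u₀)).exists
  refine ⟨N, fun n hn => ?_⟩
  rw [Real.dist_eq]
  exact (key N n hN' hn).trans_lt hN

/-- A Levin–Fainleib type theorem. -/
lemma exists_tendsto_summatory_exp_div {b : ℕ → ℝ} (hb : ∀ n, 0 ≤ b n) (hb1 : b 1 = 1)
    {κ K β : ℝ} (hκ : 0 < κ) (hK : 0 < K) (hβ : 0 < β) (hβ1 : β < 1)
    (h : ∀ u, 0 ≤ u → |u * summatory b (Real.exp u) - κ * logPrimitive b u| ≤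
      K * summatory b (Real.exp u) * (1 + u) ^ (1 - β)) :
    ∃ c, 0 < c ∧
      Tendsto (fun u => summatory b (Real.exp u) / u ^ (κ - 1)) atTop (nhds c) := by
  set l : ℝ → ℝ := fun u => summatory b (Real.exp u) with hl
  set T := logPrimitive b with hT
  have hl0 : ∀ u, 0 ≤ l u := fun u => Finset.sum_nonneg fun m _ => hb m
  have hTpos : ∀ u, 0 < u → 0 < T u := fun u hu => hu.trans_le (le_logPrimitive hb hb1 hu.le)
  have hneg : Tendsto (fun u : ℝ => u ^ (-β)) atTop (nhds 0) := tendsto_rpow_neg_atTop hβ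
  obtain ⟨u₀, hu₀⟩ := eventually_atTop.1
    ((hneg.eventually (gt_mem_nhds (by positivity : 0 < 1 / (4 * K)))).and (eventually_ge_atTop 1))
  have hu₀1 : 1 ≤ u₀ := (hu₀ u₀ le_rfl).2
  have herr : ∀ u, u₀ ≤ u → |u * l u - κ * T u| ≤ 2 * K * (u * l u) * u ^ (-β) := by
    intro u hu
    have hu1 : 1 ≤ u := (hu₀ u hu).2
    have hu0 : 0 < u := by linarith
    refine (h u hu0.le).trans ?_
    have h1 : (1 + u) ^ (1 - β) ≤ 2 * (u * u ^ (-β)) := by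
      calc (1 + u) ^ (1 - β) ≤ (2 * u) ^ (1 - β) :=
            Real.rpow_le_rpow (by linarith) (by linarith) (by linarith)
        _ = 2 ^ (1 - β) * u ^ (1 - β) := Real.mul_rpow (by norm_num) hu0.le
        _ ≤ 2 * u ^ (1 - β) := by
            refine mul_le_mul_of_nonneg_right ?_ (by positivity)
            calc (2 : ℝ) ^ (1 - β) ≤ 2 ^ (1 : ℝ) :=
                  Real.rpow_le_rpow_of_exponent_le (by norm_num) (by linarith)
              _ = 2 := Real.rpow_one 2
        _ = 2 * (u * u ^ (-β)) := by
            rw [sub_eq_add_neg, Real.rpow_add hu0, Real.rpow_one]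
    calc K * l u * (1 + u) ^ (1 - β) ≤ K * l u * (2 * (u * u ^ (-β))) :=
          mul_le_mul_of_nonneg_left h1 (mul_nonneg hK.le (hl0 u))
      _ = _ := by ring
  have hlT : ∀ u, u₀ ≤ u → u * l u ≤ 2 * κ * T u := by
    intro u hu
    have hu0 : 0 < u := by linarith
    have h1 := (hu₀ u hu).1
    rw [lt_div_iff₀ (by positivity)] at h1
    have h2 := (abs_le.1 (herr u hu)).2
    have h3 : 0 ≤ u * l u := mul_nonneg hu0.le (hl0 u)
    nlinarith [mul_le_mul_of_nonneg_left h1.le h3]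
  have hratio : ∀ u, u₀ ≤ u → |u * l u / T u - κ| ≤ 4 * K * κ * u ^ (-β) := by
    intro u hu
    have hu0 : 0 < u := by linarith
    have hTu := hTpos u hu0
    have h1 : u * l u / T u - κ = (u * l u - κ * T u) / T u := by field_simp
    rw [h1, abs_div, abs_of_pos hTu, div_le_iff₀ hTu]
    refine (herr u hu).trans ?_
    have h2 : 0 ≤ 2 * K * u ^ (-β) := by positivity
    nlinarith [mul_le_mul_of_nonneg_left (hlT u hu) h2]
  have hWconv : ∃ w, Tendsto (fun u => Real.log (T u) - κ * Real.log u) atTop (nhds w) := by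
    refine exists_tendsto_of_abs_rightDeriv_le (w := fun u => l u / T u - κ * u⁻¹)
      (K := 4 * K * κ) (by linarith : 0 < u₀) hβ (by positivity) ?_ ?_ ?_
    · intro u hu
      have hu0 : 0 < u := by linarith [Set.mem_Ici.1 hu]
      exact (((continuous_logPrimitive b).continuousAt.log (hTpos u hu0).ne').sub
        ((Real.continuousAt_log hu0.ne').const_mul κ)).continuousWithinAt
    · intro u hu
      have hu0 : 0 < u := by linarith
      exact ((hasDerivWithinAt_logPrimitive b u).log (hTpos u hu0).ne').sub
        ((Real.hasDerivAt_log hu0.ne').hasDerivWithinAt.const_mul κ)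
    · intro u hu
      have hu0 : 0 < u := by linarith
      have h1 : l u / T u - κ * u⁻¹ = (u * l u / T u - κ) * u⁻¹ := by field_simp
      rw [h1, abs_mul, abs_of_pos (inv_pos.2 hu0), Real.rpow_sub_one hu0.ne', div_eq_mul_inv (u ^ (-β)),
        ← mul_assoc]
      exact mul_le_mul_of_nonneg_right (hratio u hu) (inv_pos.2 hu0).le
  obtain ⟨w, hw⟩ := hWconv
  refine ⟨κ * Real.exp w, by positivity, ?_⟩
  have h1 : Tendsto (fun u => u * l u / T u) atTop (nhds κ) := by
    rw [tendsto_iff_norm_sub_tendsto_zero]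
    refine squeeze_zero' (Eventually.of_forall fun u => norm_nonneg _)
      ((eventually_ge_atTop u₀).mono hratio) ?_
    simpa using hneg.const_mul (4 * K * κ)
  refine (h1.mul ((Real.continuous_exp.tendsto w).comp hw)).congr' ?_
  filter_upwards [eventually_gt_atTop 0] with u hu
  have hTu := hTpos u hu
  simp only [Function.comp, hl]
  rw [Real.exp_sub, Real.exp_log hTu, mul_comm κ, ← Real.rpow_def_of_pos hu, Real.rpow_sub hu,
    Real.rpow_one]
  field_simp

/-- Convolving with a function tending to zero is negligible against a slowly varying summatory
function. -/
lemma tendsto_sum_mul_div_log_rpow {b : ℕ → ℝ} (hb : ∀ n, 0 ≤ b n) {τ c M : ℝ} (hc : 0 < c)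
    (hL : Tendsto (fun x => summatory b x / Real.log x ^ τ) atTop (nhds c)) {g : ℝ → ℝ}
    (hg0 : ∀ y, 1 ≤ y → 0 ≤ g y) (hgM : ∀ y, 1 ≤ y → g y ≤ M)
    (hg : Tendsto g atTop (nhds 0)) :
    Tendsto (fun x => (∑ m ∈ Finset.Ioc 0 ⌊x⌋₊, b m * g (x / m)) / Real.log x ^ τ)
      atTop (nhds 0) := by
  have hmem : ∀ {x : ℝ} {m : ℕ}, 1 ≤ x → m ∈ Finset.Ioc 0 ⌊x⌋₊ → 0 < (m : ℝ) ∧ (m : ℝ) ≤ x := by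
    intro x m hx hm
    rw [Finset.mem_Ioc, Nat.le_floor_iff (by linarith)] at hm
    exact ⟨by exact_mod_cast hm.1, hm.2⟩
  have hM0 : 0 ≤ M := (hg0 1 le_rfl).trans (hgM 1 le_rfl)
  have hslow : ∀ Y : ℝ, 1 ≤ Y →
      Tendsto (fun x => summatory b (x / Y) / Real.log x ^ τ) atTop (nhds c) := by
    intro Y hY
    have hY0 : 0 < Y := by linarith
    have h1 := hL.comp (tendsto_id.atTop_div_const hY0)
    have h2 : Tendsto (fun x : ℝ => (Real.log (x / Y) / Real.log x) ^ τ) atTop (nhds 1) := by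
      have h3 : Tendsto (fun x : ℝ => Real.log (x / Y) / Real.log x) atTop (nhds 1) := by
        have h4 : Tendsto (fun x : ℝ => 1 - Real.log Y / Real.log x) atTop (nhds (1 - 0)) :=
          (tendsto_log_atTop.const_div_atTop (Real.log Y)).const_sub 1
        rw [sub_zero] at h4
        refine h4.congr' ?_
        filter_upwards [eventually_gt_atTop 1] with x hx
        have : Real.log x ≠ 0 := (Real.log_pos hx).ne'
        rw [Real.log_div (by linarith) hY0.ne']
        field_simp
      simpa using h3.rpow_const (p := τ) (Or.inl one_ne_zero)
    have h5 := h1.mul h2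
    rw [mul_one] at h5
    refine h5.congr' ?_
    filter_upwards [eventually_gt_atTop Y] with x hx
    have h6 : 0 < Real.log (x / Y) := Real.log_pos ((one_lt_div hY0).2 hx)
    have h7 : 0 < Real.log x := Real.log_pos (by linarith)
    simp only [Function.comp, id]
    rw [Real.div_rpow h6.le h7.le]
    have := (Real.rpow_pos_of_pos h6 τ).ne'
    field_simp
  rw [tendsto_order]
  constructor
  · intro a ha
    filter_upwards [eventually_ge_atTop 1] with x hx
    refine ha.trans_le (div_nonneg (Finset.sum_nonneg fun m hm => ?_)
      (Real.rpow_nonneg (Real.log_nonneg hx) _))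
    obtain ⟨h1, h2⟩ := hmem hx hm
    exact mul_nonneg (hb m) (hg0 _ ((one_le_div h1).2 h2))
  · intro δ hδ
    set ε := δ / (2 * c) with hε
    have hε0 : 0 < ε := by positivity
    obtain ⟨Y, hY⟩ := eventually_atTop.1
      ((hg.eventually (gt_mem_nhds hε0)).and (eventually_ge_atTop 1))
    have hY1 : 1 ≤ Y := (hY Y le_rfl).2
    have hY0 : 0 < Y := by linarith
    have hlim := (hL.const_mul ε).add ((hL.sub (hslow Y hY1)).const_mul M)
    have hval : ε * c + M * (c - c) = δ / 2 := by rw [hε]; field_simp; ring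
    rw [hval] at hlim
    filter_upwards [hlim.eventually (gt_mem_nhds (half_lt_self hδ)), eventually_gt_atTop 1]
      with x hx hx1
    refine lt_of_le_of_lt ?_ hx
    have hlog : 0 < Real.log x ^ τ := Real.rpow_pos_of_pos (Real.log_pos hx1) _
    rw [← sub_div, mul_div_assoc', mul_div_assoc', ← add_div]
    refine div_le_div_of_nonneg_right ?_ hlog.le
    have hsub : Finset.Ioc 0 ⌊x / Y⌋₊ ⊆ Finset.Ioc 0 ⌊x⌋₊ :=
      Finset.Ioc_subset_Ioc_right (Nat.floor_le_floor (div_le_self (by linarith) hY1))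
    have hdiff : summatory b x - summatory b (x / Y) =
        ∑ m ∈ Finset.Ioc 0 ⌊x⌋₊ \ Finset.Ioc 0 ⌊x / Y⌋₊, b m := by
      unfold summatory
      rw [← Finset.sum_sdiff hsub]; ring
    rw [hdiff, ← Finset.sum_sdiff hsub, add_comm]
    refine add_le_add ?_ ?_
    · calc _ ≤ ∑ m ∈ Finset.Ioc 0 ⌊x / Y⌋₊, ε * b m := by
            refine Finset.sum_le_sum fun m hm => ?_
            obtain ⟨h1, -⟩ := hmem hx1.le (hsub hm)
            rw [Finset.mem_Ioc, Nat.le_floor_iff (by positivity), le_div_iff₀ hY0] at hm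
            rw [mul_comm]
            refine mul_le_mul_of_nonneg_right (hY _ ?_).1.le (hb m)
            rw [le_div_iff₀ h1, mul_comm]
            exact hm.2
        _ = ε * ∑ m ∈ Finset.Ioc 0 ⌊x / Y⌋₊, b m := by rw [Finset.mul_sum]
        _ ≤ _ := mul_le_mul_of_nonneg_left
            (Finset.sum_le_sum_of_subset_of_nonneg hsub fun m _ _ => hb m) hε0.le
    · rw [Finset.mul_sum]
      refine Finset.sum_le_sum fun m hm => ?_
      obtain ⟨h1, h2⟩ := hmem hx1.le (Finset.sdiff_subset hm)
      rw [mul_comm]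
      exact mul_le_mul_of_nonneg_right (hgM _ ((one_le_div h1).2 h2)) (hb m)

lemma summable_log_div_sq : Summable fun n : ℕ => Real.log n / (n : ℝ) ^ 2 := by
  refine Summable.of_nonneg_of_le
    (fun n => div_nonneg (Real.log_natCast_nonneg n) (by positivity)) (fun n => ?_)
    ((Real.summable_nat_rpow.2 (by norm_num : (-(3 / 2) : ℝ) < -1)).mul_left 2)
  rcases Nat.eq_zero_or_pos n with rfl | hn
  · simp [Real.zero_rpow]
  · have hn0 : (0 : ℝ) < n := by exact_mod_cast hn
    have h1 := Real.log_le_rpow_div hn0.le (by norm_num : (0 : ℝ) < 1 / 2)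
    rw [div_le_iff₀ (by positivity)]
    refine h1.trans_eq ?_
    have h2 : (n : ℝ) ^ (-(3 / 2) : ℝ) * (n : ℝ) ^ 2 = (n : ℝ) ^ (1 / 2 : ℝ) := by
      rw [← Real.rpow_natCast, ← Real.rpow_add hn0]
      norm_num
    rw [mul_assoc, h2]
    ring

lemma sum_logWeight_div_sq_le (P : Set ℕ) (s : Finset ℕ) :
    ∑ p ∈ s, logWeight P p / (p : ℝ) ^ 2 ≤ ∑' n : ℕ, Real.log n / (n : ℝ) ^ 2 := by
  refine (Finset.sum_le_sum fun p _ => ?_).trans (summable_log_div_sq.sum_le_tsum s fun n _ =>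
    div_nonneg (Real.log_natCast_nonneg n) (by positivity))
  refine div_le_div_of_nonneg_right ?_ (by positivity)
  unfold logWeight
  split_ifs
  · exact le_rfl
  · exact Real.log_natCast_nonneg p

lemma abs_mul_summatory_sub_logPrimitive_le {P : Set ℕ} (hP : ∀ p ∈ P, Nat.Prime p)
    {τ β K : ℝ} (hβ1 : β < 1)
    (hm : ∀ x, 1 ≤ x → |mertensOn P x - τ * Real.log x| ≤ K * (1 + Real.log x) ^ (1 - β))
    (hK : 0 < K) {u : ℝ} (hu : 0 ≤ u) :
    |u * summatory (fun n => supportInd P n / n) (Real.exp u) -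
        (τ + 1) * logPrimitive (fun n => supportInd P n / n) u| ≤
      (K + ∑' n : ℕ, Real.log n / (n : ℝ) ^ 2) *
        summatory (fun n => supportInd P n / n) (Real.exp u) * (1 + u) ^ (1 - β) := by
  set b : ℕ → ℝ := fun n => supportInd P n / n with hb
  set S := ∑' n : ℕ, Real.log n / (n : ℝ) ^ 2 with hS
  set N := ⌊Real.exp u⌋₊ with hN
  have hb0 : ∀ n, 0 ≤ b n := fun n => div_nonneg (supportInd_nonneg P n) (Nat.cast_nonneg n)
  have hS0 : 0 ≤ S := tsum_nonneg fun n => div_nonneg (Real.log_natCast_nonneg n) (by positivity)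
  have hone : 1 ≤ (1 + u) ^ (1 - β) := Real.one_le_rpow (by linarith) (by linarith)
  have hL0 : 0 ≤ summatory b (Real.exp u) := Finset.sum_nonneg fun m _ => hb0 m
  have hconv := convolution_sub_sum_mul_log_mem hP (fun n => ((n : ℝ))⁻¹)
    (fun n => by positivity) N
  have h1 : ∑ m ∈ Finset.Ioc 0 N, ∑ p ∈ Finset.Ioc 0 (N / m),
      supportInd P m * logWeight P p * (((m * p : ℕ) : ℝ))⁻¹ =
      ∑ m ∈ Finset.Ioc 0 N, b m * mertensOn P (Real.exp u / m) := by
    refine Finset.sum_congr rfl fun m _ => ?_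
    unfold mertensOn
    rw [Nat.floor_div_natCast, Finset.mul_sum]
    refine Finset.sum_congr rfl fun p _ => ?_
    simp only [hb]
    push_cast
    rw [mul_inv]
    ring
  have h2 : ∑ m ∈ Finset.Ioc 0 N, ∑ p ∈ Finset.Ioc 0 N with m * p ^ 2 ≤ N,
      supportInd P m * logWeight P p * (((m * p ^ 2 : ℕ) : ℝ))⁻¹ ≤
      S * summatory b (Real.exp u) := by
    unfold summatory
    rw [Finset.mul_sum]
    refine Finset.sum_le_sum fun m _ => ?_
    calc _ = b m * ∑ p ∈ Finset.Ioc 0 N with m * p ^ 2 ≤ N, logWeight P p / (p : ℝ) ^ 2 := by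
          rw [Finset.mul_sum]
          refine Finset.sum_congr rfl fun p _ => ?_
          simp only [hb]
          push_cast
          rw [mul_inv]
          ring
      _ ≤ b m * S := mul_le_mul_of_nonneg_left (sum_logWeight_div_sq_le P _) (hb0 m)
      _ = S * b m := mul_comm _ _
  rw [h1] at hconv
  set D := (∑ m ∈ Finset.Ioc 0 N, b m * mertensOn P (Real.exp u / m)) -
    ∑ n ∈ Finset.Ioc 0 N, supportInd P n * Real.log n * (n : ℝ)⁻¹ with hD
  have hident : u * summatory b (Real.exp u) - (τ + 1) * logPrimitive b u =
      (∑ m ∈ Finset.Ioc 0 N,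
        b m * (mertensOn P (Real.exp u / m) - τ * (u - Real.log m))) - D := by
    unfold summatory logPrimitive
    rw [hD, Finset.mul_sum, Finset.mul_sum, ← Finset.sum_sub_distrib, ← Finset.sum_sub_distrib,
      ← Finset.sum_sub_distrib]
    refine Finset.sum_congr rfl fun m _ => ?_
    simp only [hb]
    ring
  have hmain : |∑ m ∈ Finset.Ioc 0 N,
      b m * (mertensOn P (Real.exp u / m) - τ * (u - Real.log m))| ≤
      K * summatory b (Real.exp u) * (1 + u) ^ (1 - β) := by
    refine (Finset.abs_sum_le_sum_abs _ _).trans ?_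
    unfold summatory
    rw [Finset.mul_sum, Finset.sum_mul]
    refine Finset.sum_le_sum fun m hmN => ?_
    obtain ⟨hm0, hmu⟩ := mem_Ioc_floor_exp.1 hmN
    have hm0' : (0 : ℝ) < m := by exact_mod_cast hm0
    have hlog : Real.log (Real.exp u / m) = u - Real.log m := by
      rw [Real.log_div (Real.exp_pos u).ne' hm0'.ne', Real.log_exp]
    have hge : 1 ≤ Real.exp u / m := by
      rw [one_le_div hm0']
      exact (Real.log_le_iff_le_exp hm0').1 hmu
    have h3 := hm _ hge
    rw [hlog] at h3
    have h4 : (1 + (u - Real.log m)) ^ (1 - β) ≤ (1 + u) ^ (1 - β) :=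
      Real.rpow_le_rpow (by linarith) (by linarith [Real.log_natCast_nonneg m]) (by linarith)
    rw [abs_mul, abs_of_nonneg (hb0 m)]
    calc _ ≤ b m * (K * (1 + (u - Real.log m)) ^ (1 - β)) :=
          mul_le_mul_of_nonneg_left h3 (hb0 m)
      _ ≤ b m * (K * (1 + u) ^ (1 - β)) :=
          mul_le_mul_of_nonneg_left (mul_le_mul_of_nonneg_left h4 hK.le) (hb0 m)
      _ = _ := by ring
  rw [hident]
  calc _ ≤ K * summatory b (Real.exp u) * (1 + u) ^ (1 - β) + S * summatory b (Real.exp u) := by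
        refine (abs_sub _ _).trans (add_le_add hmain ?_)
        rw [abs_of_nonneg hconv.1]
        exact hconv.2.trans h2
    _ ≤ _ := by
        nlinarith [mul_le_mul_of_nonneg_left hone (mul_nonneg hS0 hL0)]

/-- The logarithmically weighted count of `squarefreeSupported P` has order `(log x) ^ τ`. -/
lemma exists_tendsto_summatory_supportInd_div {P : Set ℕ} (hP : ∀ p ∈ P, Nat.Prime p)
    {τ β : ℝ} (hτ : 0 < τ) (hβ : 0 < β) (hβ1 : β < 1)
    (h : (fun x : ℝ => countUpTo P x - τ * x / Real.log x)
        =O[atTop] (fun x : ℝ => x / Real.log x ^ (1 + β))) :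
    ∃ c, 0 < c ∧ Tendsto (fun x => summatory (fun n => supportInd P n / n) x / Real.log x ^ τ)
      atTop (nhds c) := by
  obtain ⟨K, hK, hm⟩ := exists_abs_mertensOn_sub_le hP hτ hβ hβ1 h
  have hS0 : 0 ≤ ∑' n : ℕ, Real.log n / (n : ℝ) ^ 2 :=
    tsum_nonneg fun n => div_nonneg (Real.log_natCast_nonneg n) (by positivity)
  obtain ⟨c, hc, hlim⟩ := exists_tendsto_summatory_exp_div
    (b := fun n => supportInd P n / n) (κ := τ + 1)
    (fun n => div_nonneg (supportInd_nonneg P n) (Nat.cast_nonneg n)) (by simp [supportInd_one])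
    (by linarith) (add_pos_of_pos_of_nonneg hK hS0) hβ hβ1
    (fun u hu => abs_mul_summatory_sub_logPrimitive_le hP hβ1 hm hK hu)
  refine ⟨c, hc, (hlim.comp tendsto_log_atTop).congr' ?_⟩
  filter_upwards [eventually_gt_atTop 0] with x hx
  simp only [Function.comp, Real.exp_log hx, add_sub_cancel_right]

lemma abs_summatory_mul_log_sub_le {P : Set ℕ} (hP : ∀ p ∈ P, Nat.Prime p) (τ : ℝ) {x : ℝ}
    (hx : 1 ≤ x) :
    |summatory (supportInd P) x * Real.log x -
        τ * x * summatory (fun n => supportInd P n / n) x| ≤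
      x * ∑ m ∈ Finset.Ioc 0 ⌊x⌋₊, supportInd P m / m *
        ((Real.log (x / m) + |thetaOn P (x / m) - τ * (x / m)| +
          Real.log 4 * √(x / m)) / (x / m)) := by
  set N := ⌊x⌋₊ with hN
  have hx0 : 0 < x := by linarith
  have hmem : ∀ {m : ℕ}, m ∈ Finset.Ioc 0 N → 0 < (m : ℝ) ∧ 1 ≤ x / m := by
    intro m hm
    rw [Finset.mem_Ioc, Nat.le_floor_iff (by linarith)] at hm
    have : (0 : ℝ) < m := by exact_mod_cast hm.1
    exact ⟨this, (one_le_div this).2 hm.2⟩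
  have hconv := convolution_sub_sum_mul_log_mem hP (fun _ => 1) (fun _ => zero_le_one) N
  simp only [mul_one] at hconv
  have h1 : ∑ m ∈ Finset.Ioc 0 N, ∑ p ∈ Finset.Ioc 0 (N / m), supportInd P m * logWeight P p =
      ∑ m ∈ Finset.Ioc 0 N, supportInd P m * thetaOn P (x / m) := by
    refine Finset.sum_congr rfl fun m _ => ?_
    unfold thetaOn
    rw [Nat.floor_div_natCast, Finset.mul_sum]
  have h2 : ∑ m ∈ Finset.Ioc 0 N, ∑ p ∈ Finset.Ioc 0 N with m * p ^ 2 ≤ N,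
      supportInd P m * logWeight P p ≤
      ∑ m ∈ Finset.Ioc 0 N, supportInd P m * (Real.log 4 * √(x / m)) := by
    refine Finset.sum_le_sum fun m hm => ?_
    obtain ⟨hm0, hm1⟩ := hmem hm
    rw [← Finset.mul_sum]
    refine mul_le_mul_of_nonneg_left ?_ (supportInd_nonneg P m)
    refine le_trans ?_ (thetaOn_le hP (Real.sqrt_nonneg _))
    unfold thetaOn
    refine Finset.sum_le_sum_of_subset_of_nonneg (fun p hp => ?_) fun p _ _ => logWeight_nonneg P p
    simp only [Finset.mem_filter, Finset.mem_Ioc] at hp ⊢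
    refine ⟨hp.1.1, ?_⟩
    rw [Nat.le_floor_iff (Real.sqrt_nonneg _)]
    refine Real.le_sqrt_of_sq_le ?_
    have h3 := (Nat.le_floor_iff hx0.le).1 hp.2
    push_cast at h3
    rw [le_div_iff₀ hm0, mul_comm]
    exact h3
  rw [h1] at hconv
  set D := (∑ m ∈ Finset.Ioc 0 N, supportInd P m * thetaOn P (x / m)) -
    ∑ n ∈ Finset.Ioc 0 N, supportInd P n * Real.log n with hD
  have hident : summatory (supportInd P) x * Real.log x -
        τ * x * summatory (fun n => supportInd P n / n) x =
      (∑ m ∈ Finset.Ioc 0 N, supportInd P m *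
        (Real.log (x / m) + (thetaOn P (x / m) - τ * (x / m)))) - D := by
    unfold summatory
    rw [hD, Finset.mul_sum, Finset.sum_mul, ← Finset.sum_sub_distrib, ← Finset.sum_sub_distrib,
      ← Finset.sum_sub_distrib]
    refine Finset.sum_congr rfl fun m hm => ?_
    rw [Real.log_div hx0.ne' (hmem hm).1.ne']
    ring
  rw [hident]
  calc _ ≤ (∑ m ∈ Finset.Ioc 0 N, supportInd P m *
        (Real.log (x / m) + |thetaOn P (x / m) - τ * (x / m)|)) +
        ∑ m ∈ Finset.Ioc 0 N, supportInd P m * (Real.log 4 * √(x / m)) := by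
        refine (abs_sub _ _).trans (add_le_add ?_ ?_)
        · refine (Finset.abs_sum_le_sum_abs _ _).trans (Finset.sum_le_sum fun m hm => ?_)
          rw [abs_mul, abs_of_nonneg (supportInd_nonneg P m)]
          refine mul_le_mul_of_nonneg_left ((abs_add_le _ _).trans ?_) (supportInd_nonneg P m)
          rw [abs_of_nonneg (Real.log_nonneg (hmem hm).2)]
        · rw [abs_of_nonneg hconv.1]
          exact hconv.2.trans h2
    _ = _ := by
        rw [← Finset.sum_add_distrib, Finset.mul_sum]
        refine Finset.sum_congr rfl fun m hm => ?_
        have := (hmem hm).1.ne'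
        field_simp

lemma tendsto_summatory_supportInd_div {P : Set ℕ} (hP : ∀ p ∈ P, Nat.Prime p) {τ c : ℝ}
    (hτ : 0 < τ) (hθ : Tendsto (fun x => thetaOn P x / x) atTop (nhds τ)) (hc : 0 < c)
    (hL : Tendsto (fun x => summatory (fun n => supportInd P n / n) x / Real.log x ^ τ)
      atTop (nhds c)) :
    Tendsto (fun x => summatory (supportInd P) x / (x * Real.log x ^ (τ - 1)))
      atTop (nhds (τ * c)) := by
  set g : ℝ → ℝ := fun y =>
    (Real.log y + |thetaOn P y - τ * y| + Real.log 4 * √y) / y with hg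
  have hl4 : 0 ≤ Real.log 4 := Real.log_nonneg (by norm_num)
  have hg0 : ∀ y, 1 ≤ y → 0 ≤ g y := fun y hy => by
    have := Real.log_nonneg hy
    positivity
  have hgM : ∀ y, 1 ≤ y → g y ≤ 1 + (Real.log 4 + τ) + Real.log 4 := fun y hy => by
    have hy0 : 0 < y := by linarith
    have h1 : Real.log y ≤ y := (Real.log_le_sub_one_of_pos hy0).trans (by linarith)
    have h2 : |thetaOn P y - τ * y| ≤ (Real.log 4 + τ) * y := by
      have h3 := thetaOn_le hP hy0.le
      have h4 := thetaOn_nonneg P y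
      have h5 : 0 ≤ τ * y := by positivity
      have h6 : 0 ≤ Real.log 4 * y := by positivity
      rw [abs_le]
      constructor <;> linarith
    have h3 : √y ≤ y := by
      rw [Real.sqrt_le_left hy0.le]
      nlinarith
    rw [hg, div_le_iff₀ hy0]
    nlinarith [mul_le_mul_of_nonneg_left h3 hl4]
  have hglim : Tendsto g atTop (nhds 0) := by
    have h1 : Tendsto (fun y : ℝ => Real.log y / y) atTop (nhds 0) :=
      Real.isLittleO_log_id_atTop.tendsto_div_nhds_zero
    have h2 : Tendsto (fun y : ℝ => |thetaOn P y / y - τ|) atTop (nhds 0) := by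
      simpa using (hθ.sub_const τ).abs
    have h3 : Tendsto (fun y : ℝ => Real.log 4 * (√y)⁻¹) atTop (nhds 0) := by
      simpa using (tendsto_inv_atTop_zero.comp tendsto_sqrt_atTop).const_mul (Real.log 4)
    have h4 := (h1.add h2).add h3
    simp only [add_zero] at h4
    refine h4.congr' ?_
    filter_upwards [eventually_gt_atTop 0] with y hy
    have h5 : thetaOn P y / y - τ = (thetaOn P y - τ * y) / y := by field_simp
    have h6 : (√y)⁻¹ = √y / y := by
      rw [inv_eq_one_div, div_eq_div_iff (Real.sqrt_pos.2 hy).ne' hy.ne', one_mul,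
        Real.mul_self_sqrt hy.le]
    rw [h5, abs_div, abs_of_pos hy, h6, hg]
    ring
  have hsum := tendsto_sum_mul_div_log_rpow
    (fun n => div_nonneg (supportInd_nonneg P n) (Nat.cast_nonneg n)) hc hL hg0 hgM hglim
  have hdiff : Tendsto (fun x => (summatory (supportInd P) x * Real.log x -
      τ * x * summatory (fun n => supportInd P n / n) x) / (x * Real.log x ^ τ))
      atTop (nhds 0) := by
    refine squeeze_zero_norm' ?_ hsum
    filter_upwards [eventually_gt_atTop 1] with x hx
    have hx0 : 0 < x := by linarith
    have hlog : 0 < Real.log x ^ τ := Real.rpow_pos_of_pos (Real.log_pos hx) _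
    rw [Real.norm_eq_abs, abs_div, abs_of_pos (mul_pos hx0 hlog),
      div_le_div_iff₀ (mul_pos hx0 hlog) hlog, ← mul_assoc]
    exact mul_le_mul_of_nonneg_right
      ((abs_summatory_mul_log_sub_le hP τ hx.le).trans_eq (mul_comm _ _)) hlog.le
  have hfin := hdiff.add (hL.const_mul τ)
  rw [zero_add] at hfin
  refine hfin.congr' ?_
  filter_upwards [eventually_gt_atTop 1] with x hx
  have hx0 : 0 < x := by linarith
  have hl : 0 < Real.log x := Real.log_pos hx
  have hlog : 0 < Real.log x ^ τ := Real.rpow_pos_of_pos hl _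
  rw [Real.rpow_sub_one hl.ne']
  field_simp
  ring

lemma ncard_eq_summatory_supportInd (P : Set ℕ) {x : ℝ} (hx : 0 ≤ x) :
    (({d : ℕ | 0 < d ∧ (d : ℝ) ≤ x ∧ Squarefree d ∧
      ∀ p : ℕ, p.Prime → p ∣ d → p ∈ P}.ncard : ℝ)) = summatory (supportInd P) x := by
  classical
  unfold summatory supportInd
  convert ncard_eq_sum_ite (S := squarefreeSupported P) (Finset.Ioc 0 ⌊x⌋₊) _
  intro n
  simp [Nat.le_floor_iff hx, and_assoc, squarefreeSupported]

/-- **Counting squarefree numbers with prime factors in a prescribed set.**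
If `𝒫` is a set of primes with `#{p ≤ x : p ∈ 𝒫} = τ·x/log x + O(x/(log x)^{1+β})`
for positive constants `τ, β`, then the number of squarefree positive integers
`d ≤ x` composed entirely of primes from `𝒫` is asymptotic to
`C_𝒫 · x · (log x)^{τ-1}` for some constant `C_𝒫 > 0`. -/
theorem squarefree_with_prime_factors_in_set_asymptotic
    (P : Set ℕ) (hP : ∀ p ∈ P, Nat.Prime p)
    (τ β : ℝ) (hτ : 0 < τ) (hβ : 0 < β)
    (hprimes :
      (fun x : ℝ =>
          (({p : ℕ | p ∈ P ∧ (p : ℝ) ≤ x}.ncard : ℝ)) - τ * x / Real.log x)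
        =O[atTop] (fun x : ℝ => x / Real.log x ^ (1 + β))) :
    ∃ C : ℝ, 0 < C ∧
      Tendsto
        (fun x : ℝ =>
          (({d : ℕ | 0 < d ∧ (d : ℝ) ≤ x ∧ Squarefree d ∧
              ∀ p : ℕ, p.Prime → p ∣ d → p ∈ P}.ncard : ℝ)) /
            (C * x * Real.log x ^ (τ - 1)))
        atTop (nhds 1) := by
  have hβ' : 0 < min β (1 / 2) := lt_min hβ (by norm_num)
  have hβ1 : min β (1 / 2) < 1 := (min_le_right _ _).trans_lt (by norm_num)
  have hcount : (fun x : ℝ => countUpTo P x - τ * x / Real.log x)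
      =O[atTop] (fun x : ℝ => x / Real.log x ^ (1 + min β (1 / 2))) := by
    have h1 : (fun x : ℝ => countUpTo P x - τ * x / Real.log x)
        =O[atTop] (fun x : ℝ => x / Real.log x ^ (1 + β)) := by
      refine hprimes.congr' ?_ EventuallyEq.rfl
      filter_upwards [eventually_ge_atTop 0] with x hx
      rw [ncard_eq_countUpTo P hx]
    refine h1.trans (Asymptotics.IsBigO.of_bound 1 ?_)
    filter_upwards [eventually_ge_atTop (Real.exp 1)] with x hx
    have hx0 : 0 < x := (Real.exp_pos 1).trans_le hx
    have hl : 1 ≤ Real.log x := (Real.le_log_iff_exp_le hx0).2 hx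
    have hl0 : 0 < Real.log x := by linarith
    rw [one_mul, Real.norm_eq_abs, Real.norm_eq_abs, abs_of_nonneg (by positivity),
      abs_of_nonneg (by positivity)]
    refine div_le_div_of_nonneg_left hx0.le (by positivity)
      (Real.rpow_le_rpow_of_exponent_le hl ?_)
    linarith [min_le_left β (1 / 2)]
  obtain ⟨c, hc, hL⟩ := exists_tendsto_summatory_supportInd_div hP hτ hβ' hβ1 hcount
  have hA := tendsto_summatory_supportInd_div hP hτ (tendsto_thetaOn_div hP hβ' hcount) hc hL
  have hτc : 0 < τ * c := mul_pos hτ hc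
  refine ⟨τ * c, hτc, ?_⟩
  have h1 := hA.div_const (τ * c)
  rw [div_self hτc.ne'] at h1
  refine h1.congr' ?_
  filter_upwards [eventually_ge_atTop 0] with x hx
  rw [ncard_eq_summatory_supportInd P hx, div_div]
  congr 1
  ring
end

section
/- Let k ⊂ ℂ be an imaginary quadratic field of discriminant Δ_k and let ε > 0. There is a constant c(k,ε) > 0 such that for every positive integer n there exist quadratic extensions L₁, …, Lₙ ⊂ ℂ of k with the following properties: (i) none of the degree-4 extensions L_i/ℚ is Galois; (ii) if L₁′, …, Lₙ′ denote the images of L₁, …, Lₙ under complex conjugation, then the compositum of L₁, …, Lₙ, L₁′, …, Lₙ′ has degree 2^{2n} over k; and (iii) the absolute values of the discriminants of the quartic fields L_i all satisfy |Δ_{L_i}| ≤ c(k,ε)·n^{8+ε}. -/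
open NumberField

/-- The image of an intermediate field of `ℂ/ℚ` under complex conjugation. -/
noncomputable def conjField (L : IntermediateField ℚ ℂ) : IntermediateField ℚ ℂ :=
  L.map (RingHom.toRatAlgHom (starRingEnd ℂ))

/-- At most two residue classes modulo a prime power `q` satisfy `q ∣ D * y ^ 2 + 1`. -/
lemma card_filter_dvd_le (D X p j : ℕ) (hp : p.Prime) (hD : 2 ∣ D) (hj : j ≠ 0) :
    ((Finset.Icc 1 X).filter (fun y => p ^ j ∣ D * y ^ 2 + 1)).card ≤ 2 * (X / p ^ j + 1) := by
  set q := p ^ j with hq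
  have hq0 : 0 < q := pow_pos hp.pos _
  rcases ((Finset.Icc 1 X).filter (fun y => q ∣ D * y ^ 2 + 1)).eq_empty_or_nonempty with h | ⟨z, hz⟩
  · simp [h]
  rw [Finset.mem_filter] at hz
  have hpz : p ∣ D * z ^ 2 + 1 := (dvd_pow_self p hj).trans hz.2
  have hpDz : ¬ p ∣ D * z ^ 2 := fun h => hp.one_lt.ne' (Nat.dvd_one.1 ((Nat.dvd_add_right h).1 hpz))
  have hpD : ¬ p ∣ D := fun h => hpDz (h.mul_right _)
  have hpz' : ¬ p ∣ z := fun h => hpDz ((h.trans (dvd_pow_self z two_ne_zero)).mul_left _)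
  have hp2 : ¬ p ∣ 2 := fun h => hpD (h.trans hD)
  have key : ∀ y, q ∣ D * y ^ 2 + 1 → (q : ℤ) ∣ y - z ∨ (q : ℤ) ∣ y + z := by
    intro y hy
    have hpI : Prime (p : ℤ) := Nat.prime_iff_prime_int.1 hp
    have h1 : (q : ℤ) ∣ D * ((y - z) * (y + z)) := by
      have h2 : (q : ℤ) ∣ ((D * y ^ 2 + 1 : ℕ) : ℤ) := Int.natCast_dvd_natCast.2 hy
      have h3 : (q : ℤ) ∣ ((D * z ^ 2 + 1 : ℕ) : ℤ) := Int.natCast_dvd_natCast.2 hz.2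
      rw [show (D : ℤ) * ((y - z) * (y + z)) = ((D * y ^ 2 + 1 : ℕ) : ℤ) - ((D * z ^ 2 + 1 : ℕ) : ℤ)
        by push_cast; ring]
      exact dvd_sub h2 h3
    have hqp : (q : ℤ) = (p : ℤ) ^ j := by rw [hq]; push_cast; rfl
    rw [hqp] at h1 ⊢
    have h4 : (p : ℤ) ^ j ∣ (y - z) * (y + z) :=
      hpI.pow_dvd_of_dvd_mul_left j (by exact_mod_cast hpD) h1
    by_cases h5 : (p : ℤ) ∣ y - z
    · left
      refine hpI.pow_dvd_of_dvd_mul_right j (fun h6 => ?_) h4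
      have h7 : (p : ℤ) ∣ 2 * z := by
        rw [show (2 : ℤ) * z = (y + z) - (y - z) by ring]
        exact dvd_sub h6 h5
      rcases hpI.dvd_or_dvd h7 with h | h
      · exact hp2 (by exact_mod_cast h)
      · exact hpz' (by exact_mod_cast h)
    · exact Or.inr (hpI.pow_dvd_of_dvd_mul_left j h5 h4)
  have hcount : ∀ w : ℤ, ((Finset.Icc 1 X).filter (fun y : ℕ => (q : ℤ) ∣ y - w)).card
      ≤ X / q + 1 := by
    intro w
    rw [← Finset.card_range (X / q + 1)]
    refine Finset.card_le_card_of_injOn (fun y => y / q) ?_ ?_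
    · intro y hy
      simp only [Finset.coe_filter, Finset.mem_Icc, Set.mem_ofPred_eq] at hy
      simp only [Finset.coe_range, Set.mem_Iio]
      exact Nat.lt_succ_of_le (Nat.div_le_div_right hy.1.2)
    · intro y hy y' hy' h
      simp only [Finset.coe_filter, Set.mem_ofPred_eq] at hy hy' h
      have h1 : (q : ℤ) ∣ y - y' := by
        rw [show (y : ℤ) - y' = (y - w) - (y' - w) by ring]
        exact dvd_sub hy.2 hy'.2
      have h2 : y' % q = y % q := (Nat.modEq_iff_dvd (n := q)).2 h1
      rw [← Nat.div_add_mod y q, ← Nat.div_add_mod y' q, h, h2]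
  calc _ ≤ (((Finset.Icc 1 X).filter (fun y : ℕ => (q : ℤ) ∣ y - (z : ℤ))) ∪
        ((Finset.Icc 1 X).filter (fun y : ℕ => (q : ℤ) ∣ y - (-z : ℤ)))).card := by
        refine Finset.card_le_card fun y hy => ?_
        simp only [Finset.mem_filter, Finset.mem_union] at hy ⊢
        rcases key y hy.2 with h | h
        · exact Or.inl ⟨hy.1, h⟩
        · exact Or.inr ⟨hy.1, by simpa using h⟩
    _ ≤ _ := Finset.card_union_le _ _
    _ ≤ _ := by linarith [hcount z, hcount (-z)]

/-- The product of the values at `1, …, X` of the polynomial `D * y ^ 2 + 1`. -/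
def quadProd (D X : ℕ) : ℕ := ∏ y ∈ Finset.Icc 1 X, (D * y ^ 2 + 1)

lemma quadProd_ne_zero (D X : ℕ) : quadProd D X ≠ 0 :=
  Finset.prod_ne_zero_iff.2 fun _ _ => Nat.succ_ne_zero _

lemma factorization_quadProd_le (D X p : ℕ) (hp : p.Prime) (hD : 2 ∣ D) (hD0 : 0 < D) :
    (quadProd D X).factorization p ≤
      2 * X.factorial.factorization p + 2 * Nat.log p (D * X ^ 2 + 1) := by
  set b := Nat.log p (D * X ^ 2 + 1) + 1 with hb
  have hXle : X ≤ D * X ^ 2 + 1 := by nlinarith [Nat.le_self_pow two_ne_zero X, Nat.zero_le (X ^ 2)]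
  have h1 : (quadProd D X).factorization p =
      ∑ y ∈ Finset.Icc 1 X, ((Finset.Ico 1 b).filter (fun j => p ^ j ∣ D * y ^ 2 + 1)).card := by
    rw [quadProd, Nat.factorization_prod (fun _ _ => Nat.succ_ne_zero _), Finset.sum_apply']
    refine Finset.sum_congr rfl fun y hy => ?_
    refine Nat.factorization_eq_card_pow_dvd_of_lt hp (Nat.succ_pos _) ?_
    refine lt_of_le_of_lt ?_ (Nat.lt_pow_succ_log_self hp.one_lt (D * X ^ 2 + 1))
    exact Nat.succ_le_succ (Nat.mul_le_mul_left D (Nat.pow_le_pow_left (Finset.mem_Icc.1 hy).2 2))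
  have h2 : X.factorial.factorization p = ∑ j ∈ Finset.Ico 1 b, X / p ^ j :=
    Nat.factorization_factorial hp (Nat.lt_succ_of_le (Nat.log_mono_right hXle))
  rw [h1, h2]
  simp only [Finset.card_filter]
  rw [Finset.sum_comm]
  simp only [← Finset.card_filter]
  calc _ ≤ ∑ j ∈ Finset.Ico 1 b, 2 * (X / p ^ j + 1) := by
        refine Finset.sum_le_sum fun j hj => card_filter_dvd_le D X p j hp hD ?_
        have := (Finset.mem_Ico.1 hj).1
        omega
    _ = _ := by
        rw [← Finset.mul_sum, Finset.sum_add_distrib]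
        simp [hb, mul_add]

lemma prod_Icc_one_eq_factorial (X : ℕ) : ∏ y ∈ Finset.Icc 1 X, y = X.factorial := by
  induction X with
  | zero => simp
  | succ X ih => rw [Finset.prod_Icc_succ_top (by omega), ih, Nat.factorial_succ, mul_comm]

/-- The values of `D * y ^ 2 + 1` for `1 ≤ y ≤ X` have many different prime divisors. -/
lemma le_card_primeFactors_quadProd (D X l : ℕ) (hD : 2 ∣ D) (hD4 : 4 ≤ D)
    (hl : D * X ^ 2 + 1 ≤ 2 ^ l) : X ≤ (quadProd D X).primeFactors.card * l := by
  set P := (quadProd D X).primeFactors with hP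
  have hprime : ∀ p ∈ P, p.Prime := fun p hp => Nat.prime_of_mem_primeFactors hp
  have hup : quadProd D X ≤ (X.factorial) ^ 2 * (2 ^ l) ^ (2 * P.card) := by
    calc quadProd D X = ∏ p ∈ P, p ^ (quadProd D X).factorization p :=
          (Nat.prod_factorization_pow_eq_self (quadProd_ne_zero D X)).symm
      _ ≤ ∏ p ∈ P, ((p ^ X.factorial.factorization p) ^ 2 * (2 ^ l) ^ 2) := by
          refine Finset.prod_le_prod' fun p hp => ?_
          calc _ ≤ p ^ (2 * X.factorial.factorization p + 2 * Nat.log p (D * X ^ 2 + 1)) :=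
                Nat.pow_le_pow_right (hprime p hp).pos
                  (factorization_quadProd_le D X p (hprime p hp) hD (by omega))
            _ = (p ^ X.factorial.factorization p) ^ 2 * (p ^ Nat.log p (D * X ^ 2 + 1)) ^ 2 := by
                rw [pow_add, ← pow_mul, ← pow_mul, mul_comm 2, mul_comm 2]
            _ ≤ _ := by
                exact Nat.mul_le_mul_left _ (Nat.pow_le_pow_left
                  ((Nat.pow_log_le_self p (Nat.succ_ne_zero _)).trans hl) 2)
      _ = (∏ p ∈ P, p ^ X.factorial.factorization p) ^ 2 * (2 ^ l) ^ (2 * P.card) := by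
          rw [Finset.prod_mul_distrib, Finset.prod_pow, Finset.prod_const, ← pow_mul (2 ^ l)]
      _ ≤ _ := by
          gcongr
          calc _ ≤ ∏ p ∈ P ∪ X.factorial.primeFactors, p ^ X.factorial.factorization p := by
                refine Finset.prod_le_prod_of_subset_of_one_le' Finset.subset_union_left ?_
                intro p hp _
                refine Nat.one_le_pow _ _ ?_
                rcases Finset.mem_union.1 hp with h | h
                · exact (hprime p h).pos
                · exact (Nat.prime_of_mem_primeFactors h).pos
            _ = ∏ p ∈ X.factorial.primeFactors, p ^ X.factorial.factorization p := by
                refine (Finset.prod_subset Finset.subset_union_right ?_).symm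
                intro p _ hp
                rw [← Nat.support_factorization, Finsupp.notMem_support_iff] at hp
                simp [hp]
            _ = _ := Nat.prod_factorization_pow_eq_self (Nat.factorial_ne_zero X)
            _ ≤ _ := le_rfl
  have hlow : 4 ^ X * X.factorial ^ 2 ≤ quadProd D X := by
    have h : 4 ^ X * X.factorial ^ 2 = ∏ y ∈ Finset.Icc 1 X, 4 * y ^ 2 := by
      rw [Finset.prod_mul_distrib, Finset.prod_pow, prod_Icc_one_eq_factorial]
      simp
    rw [h, quadProd]
    refine Finset.prod_le_prod' fun y _ => ?_
    nlinarith [Nat.zero_le (y ^ 2)]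
  have h : 4 ^ X ≤ (2 ^ l) ^ (2 * P.card) := by
    have h0 : 0 < X.factorial ^ 2 := pow_pos (Nat.factorial_pos X) 2
    refine Nat.le_of_mul_le_mul_right ((hlow.trans hup).trans_eq ?_) h0
    ring
  rw [show (4 : ℕ) = 2 ^ 2 by norm_num, ← pow_mul, ← pow_mul] at h
  have := (Nat.pow_le_pow_iff_right one_lt_two).1 h
  nlinarith

/-- If `p` divides `4 * d * y ^ 2 + 1`, then `p` exactly divides a small number of the form
`a ^ 2 + d`. -/
lemma exists_exactly_dvd (d y p : ℕ) (hp : p.Prime) (h : p ∣ 4 * d * y ^ 2 + 1) :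
    ∃ a < 2 * p, p ∣ a ^ 2 + d ∧ ¬ p ^ 2 ∣ a ^ 2 + d := by
  have h0 : ¬ p ∣ 4 * d * y ^ 2 := fun h' =>
    hp.one_lt.ne' (Nat.dvd_one.1 ((Nat.dvd_add_right h').1 h))
  set b := (2 * d * y) % p with hb
  have hbp : b < p := Nat.mod_lt _ hp.pos
  have hb2 : p ∣ b ^ 2 + d := by
    have h1 : b ^ 2 + d ≡ (2 * d * y) ^ 2 + d [MOD p] :=
      ((Nat.mod_modEq _ _).pow 2).add_right d
    refine (h1.dvd_iff dvd_rfl).2 ?_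
    rw [show (2 * d * y) ^ 2 + d = d * (4 * d * y ^ 2 + 1) by ring]
    exact h.mul_left d
  by_cases hsq : p ^ 2 ∣ b ^ 2 + d
  · have key : ∀ c, (b + p) ^ 2 + d = c → p ∣ c ∧ ¬ p ^ 2 ∣ c := by
      rintro c rfl
      have e : (b + p) ^ 2 + d = (b ^ 2 + d + p ^ 2) + p * (2 * b) := by ring
      rw [e]
      refine ⟨dvd_add (dvd_add hb2 (dvd_pow_self p two_ne_zero)) (dvd_mul_right _ _), fun h' => ?_⟩
      have h2 := (Nat.dvd_add_right (dvd_add hsq (dvd_refl (p ^ 2)))).1 h'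
      rw [pow_two] at h2
      have h3 : p ∣ 2 * b := Nat.dvd_of_mul_dvd_mul_left hp.pos h2
      have h4 : p ∣ 2 * (2 * d * y) := by
        have : 2 * b ≡ 2 * (2 * d * y) [MOD p] := (Nat.mod_modEq _ _).mul_left 2
        exact (this.dvd_iff dvd_rfl).1 h3
      exact h0 ((h4.mul_right y).trans (dvd_of_eq (by ring)))
    exact ⟨b + p, by omega, key _ rfl⟩
  · exact ⟨b, by omega, hb2, hsq⟩

lemma not_isSquare_of_exactly_dvd {p m : ℕ} (hp : p.Prime) (h1 : p ∣ m) (h2 : ¬ p ^ 2 ∣ m) :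
    ¬ IsSquare m := by
  rintro ⟨t, rfl⟩
  rw [hp.dvd_mul, or_self] at h1
  exact h2 (by rw [pow_two]; exact mul_dvd_mul h1 h1)

lemma two_pow_card_primeFactors_le {m : ℕ} (hm : m ≠ 0) : 2 ^ m.primeFactors.card ≤ m := by
  calc 2 ^ m.primeFactors.card = ∏ _p ∈ m.primeFactors, 2 := by simp
    _ ≤ ∏ p ∈ m.primeFactors, p :=
        Finset.prod_le_prod' fun p hp => (Nat.prime_of_mem_primeFactors hp).two_le
    _ ≤ m := Nat.le_of_dvd (Nat.pos_of_ne_zero hm) (Nat.prod_primeFactors_dvd m)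

/-- Greedy choice of integers `a` such that the `a ^ 2 + d` are multiplicatively independent
modulo squares. -/
lemma exists_finset_independent (d X l : ℕ) (hd : 0 < d) (hl : 4 * d * X ^ 2 + 1 ≤ 2 ^ l) (n : ℕ)
    (hn : n * (l * (2 * l + 3)) < X) :
    ∃ A : Finset ℕ, A.card = n ∧ (∀ a ∈ A, a < 2 * (4 * d * X ^ 2 + 1)) ∧
      ∀ S ⊆ A, S.Nonempty → ¬ IsSquare (∏ a ∈ S, (a ^ 2 + d)) := by
  induction n with
  | zero => exact ⟨∅, by simp, by simp, fun S hS h => by simp_all⟩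
  | succ n ih =>
    obtain ⟨A, hA, hAb, hAi⟩ := ih (lt_of_le_of_lt (Nat.mul_le_mul_right _ n.le_succ) hn)
    set M := ∏ a ∈ A, (a ^ 2 + d) with hM
    have hM0 : M ≠ 0 := Finset.prod_ne_zero_iff.2 fun a _ => by omega
    have hMle : M ≤ 2 ^ (n * (2 * l + 3)) := by
      calc M ≤ ∏ _a ∈ A, 2 ^ (2 * l + 3) := by
            refine Finset.prod_le_prod' fun a ha => ?_
            have h1 := hAb a ha
            have h2 : a < 2 * 2 ^ l := by omega
            have hX : 1 ≤ X := by omega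
            have h3 : d ≤ 2 ^ l := by nlinarith [Nat.mul_le_mul_left d (Nat.one_le_pow 2 X hX)]
            have h4 : 1 ≤ 2 ^ l := Nat.one_le_two_pow
            have h5 : 2 ^ (2 * l + 3) = 8 * (2 ^ l) ^ 2 := by ring
            rw [h5]
            nlinarith
        _ = _ := by rw [Finset.prod_const, hA, ← pow_mul, mul_comm]
    have hMc : M.primeFactors.card ≤ n * (2 * l + 3) :=
      (Nat.pow_le_pow_iff_right one_lt_two).1 ((two_pow_card_primeFactors_le hM0).trans hMle)
    have hQ := le_card_primeFactors_quadProd (4 * d) X l ⟨2 * d, by ring⟩ (by omega) hl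
    have hlt : M.primeFactors.card < (quadProd (4 * d) X).primeFactors.card := by
      by_contra! h
      have : (quadProd (4 * d) X).primeFactors.card * l ≤ n * (2 * l + 3) * l :=
        Nat.mul_le_mul_right l (h.trans hMc)
      nlinarith
    obtain ⟨p, hpQ, hpM⟩ := Finset.exists_mem_notMem_of_card_lt_card hlt
    have hp := Nat.prime_of_mem_primeFactors hpQ
    have hpM' : ¬ p ∣ M := fun h => hpM (Nat.mem_primeFactors.2 ⟨hp, h, hM0⟩)
    obtain ⟨y, hy, hpy⟩ := (hp.prime.dvd_finsetProd_iff _).1 (Nat.dvd_of_mem_primeFactors hpQ)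
    obtain ⟨a, ha, hpa, hpa2⟩ := exists_exactly_dvd d y p hp hpy
    have haA : a ∉ A := fun h => hpM' (hpa.trans (Finset.dvd_prod_of_mem _ h))
    refine ⟨insert a A, by rw [Finset.card_insert_of_notMem haA, hA], ?_, ?_⟩
    · intro b hb
      rcases Finset.mem_insert.1 hb with rfl | hb
      · refine ha.trans_le (Nat.mul_le_mul_left 2 ((Nat.le_of_dvd (Nat.succ_pos _) hpy).trans ?_))
        exact Nat.succ_le_succ
          (Nat.mul_le_mul_left _ (Nat.pow_le_pow_left (Finset.mem_Icc.1 hy).2 2))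
      · exact hAb b hb
    · intro S hS hSn
      by_cases haS : a ∈ S
      · have hsub : S.erase a ⊆ A := by
          intro b hb
          have := hS (Finset.mem_of_mem_erase hb)
          exact (Finset.mem_insert.1 this).resolve_left (Finset.ne_of_mem_erase hb)
        rw [← Finset.mul_prod_erase S _ haS]
        refine not_isSquare_of_exactly_dvd hp (hpa.mul_right _) fun h => ?_
        have hcop : Nat.Coprime (p ^ 2) (∏ b ∈ S.erase a, (b ^ 2 + d)) := by
          refine Nat.Coprime.pow_left 2 ((Nat.Prime.coprime_iff_not_dvd hp).2 fun h' => ?_)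
          exact hpM' (h'.trans (Finset.prod_dvd_prod_of_subset _ _ _ hsub))
        exact hpa2 (hcop.dvd_of_dvd_mul_right h)
      · refine hAi S (fun b hb => ?_) hSn
        refine (Finset.mem_insert.1 (hS hb)).resolve_left ?_
        rintro rfl
        exact haS hb

/-- There are `n` integers `a` of size at most `C * n ^ 4` such that the `a ^ 2 + d` are
multiplicatively independent modulo squares. -/
lemma exists_independent_le (d : ℕ) (hd : 0 < d) :
    ∃ C : ℕ, ∀ n : ℕ, 1 ≤ n → ∃ a : Fin n → ℕ, (∀ i, a i ≤ C * n ^ 4) ∧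
      ∀ S : Finset (Fin n), S.Nonempty → ¬ IsSquare (∏ i ∈ S, (a i ^ 2 + d)) := by
  have hev : ∃ m₀ : ℕ, ∀ m : ℕ, m₀ ≤ m → ∃ l : ℕ, 4 * d * (m ^ 2) ^ 2 + 1 ≤ 2 ^ l ∧
      m * (l * (2 * l + 3)) < m ^ 2 := by
    have h1 : ∀ᶠ x : ℝ in Filter.atTop, Real.log x ^ 2 ≤ 1 / 1000 * x := by
      have := (Real.isLittleO_pow_log_id_atTop (n := 2)).bound (show (0 : ℝ) < 1 / 1000 by norm_num)
      filter_upwards [this, Filter.eventually_ge_atTop 0] with x hx hx0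
      simpa [abs_of_nonneg hx0] using hx
    have h2 := tendsto_natCast_atTop_atTop (R := ℝ)
    obtain ⟨m₀, hm₀⟩ := Filter.eventually_atTop.1 (h2.eventually h1)
    refine ⟨max (max m₀ (5 * d)) 3, fun m hm => ⟨Nat.clog 2 (4 * d * (m ^ 2) ^ 2 + 1),
      Nat.le_pow_clog one_lt_two _, ?_⟩⟩
    set l := Nat.clog 2 (4 * d * (m ^ 2) ^ 2 + 1) with hl
    have hm1 : m₀ ≤ m := by omega
    have hm2 : 5 * d ≤ m := by omega
    have hm3 : 3 ≤ m := by omega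
    have hlog := hm₀ m hm1
    have hmR : (3 : ℝ) ≤ m := by exact_mod_cast hm3
    have hlog1 : 1 ≤ Real.log m := by
      rw [Real.le_log_iff_exp_le (by linarith)]
      exact Real.exp_one_lt_three.le.trans hmR
    have hle : 4 * d * (m ^ 2) ^ 2 + 1 ≤ m ^ 5 := by
      have : 1 ≤ m ^ 4 := Nat.one_le_pow _ _ (by omega)
      nlinarith [Nat.mul_le_mul_right (m ^ 4) hm2, Nat.mul_le_mul_right (m ^ 4) hd]
    have hlR : (l : ℝ) ≤ 10 * Real.log m := by
      have h3 : 2 ^ (l - 1) < m ^ 5 :=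
        (Nat.pow_pred_clog_lt_self one_lt_two (by nlinarith [Nat.one_le_pow 4 m (by omega)])).trans_le hle
      have h4 : ((l - 1 : ℕ) : ℝ) * Real.log 2 ≤ 5 * Real.log m := by
        have : ((2 : ℝ) ^ (l - 1)) ≤ (m : ℝ) ^ 5 := by exact_mod_cast h3.le
        have := Real.log_le_log (by positivity) this
        rwa [Real.log_pow, Real.log_pow] at this
      have h5 : (l : ℝ) - 1 ≤ ((l - 1 : ℕ) : ℝ) := by
        have : l ≤ (l - 1) + 1 := by omega
        have : (l : ℝ) ≤ ((l - 1 : ℕ) : ℝ) + 1 := by exact_mod_cast this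
        linarith
      nlinarith [Real.log_two_gt_d9]
    have hfin : (l * (2 * l + 3) : ℝ) < m := by
      have h0 : (0 : ℝ) ≤ l := Nat.cast_nonneg l
      nlinarith
    have hfin' : l * (2 * l + 3) < m := by exact_mod_cast hfin
    nlinarith
  obtain ⟨m₀, hm₀⟩ := hev
  refine ⟨2 * (4 * d + 1) * (m₀ + 1) ^ 4, fun n hn => ?_⟩
  obtain ⟨l, hl1, hl2⟩ := hm₀ (m₀ + n) (by omega)
  have hle : n * (l * (2 * l + 3)) < (m₀ + n) ^ 2 :=
    lt_of_le_of_lt (Nat.mul_le_mul_right _ (by omega)) hl2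
  obtain ⟨A, hA, hAb, hAi⟩ := exists_finset_independent d ((m₀ + n) ^ 2) l hd hl1 n hle
  refine ⟨fun i => A.orderEmbOfFin hA i, fun i => ?_, fun S hS => ?_⟩
  · refine (hAb _ (Finset.orderEmbOfFin_mem A hA i)).le.trans ?_
    have h1 : m₀ + n ≤ (m₀ + 1) * n := by nlinarith
    have h2 : (m₀ + n) ^ 4 ≤ (m₀ + 1) ^ 4 * n ^ 4 := by
      rw [← mul_pow]
      gcongr
    have h3 : 1 ≤ (m₀ + n) ^ 4 := Nat.one_le_pow _ _ (by omega)
    calc 2 * (4 * d * ((m₀ + n) ^ 2) ^ 2 + 1) ≤ 2 * (4 * d + 1) * (m₀ + n) ^ 4 := by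
          nlinarith
      _ ≤ 2 * (4 * d + 1) * ((m₀ + 1) ^ 4 * n ^ 4) := by gcongr
      _ = _ := by ring
  · have := hAi (S.map (A.orderEmbOfFin hA).toEmbedding) ?_ (hS.map)
    · simpa using this
    · intro b hb
      obtain ⟨i, _, rfl⟩ := Finset.mem_map.1 hb
      exact Finset.orderEmbOfFin_mem A hA i

/-- The discriminant of a number field is bounded by the discriminant of any integral primitive
element. -/
lemma abs_discr_le_abs_norm {K : Type*} [Field K] [NumberField K] (θ : K) (hθ : IsIntegral ℤ θ)
    (htop : IntermediateField.adjoin ℚ {θ} = ⊤) :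
    |(discr K : ℚ)| ≤
      |Algebra.norm ℚ (Polynomial.aeval θ (Polynomial.derivative (minpoly ℚ θ)))| := by
  have hθQ : IsIntegral ℚ θ := hθ.tower_top
  have htop' : Algebra.adjoin ℚ {θ} = ⊤ := by
    rw [← IntermediateField.adjoin_simple_toSubalgebra_of_isAlgebraic hθQ.isAlgebraic, htop,
      IntermediateField.top_toSubalgebra]
  set pb := PowerBasis.ofAdjoinEqTop hθQ htop' with hpb
  have hgen : pb.gen = θ := PowerBasis.ofAdjoinEqTop_gen hθQ htop'
  have h1 := Algebra.discr_powerBasis_eq_norm ℚ pb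
  set b := (integralBasis K).reindex ((integralBasis K).indexEquiv pb.basis) with hb
  have h2 : Algebra.discr ℚ pb.basis = (b.toMatrix pb.basis).det ^ 2 * discr K := by
    conv_lhs => rw [← b.toMatrix_map_vecMul pb.basis]
    rw [Algebra.discr_of_matrix_vecMul, hb, Module.Basis.coe_reindex, Algebra.discr_reindex,
      coe_discr]
  have hint : IsIntegral ℤ (b.toMatrix pb.basis).det := by
    refine IsIntegral.det fun i j => ?_
    have hj : IsIntegral ℤ (pb.basis j) := by
      rw [PowerBasis.coe_basis, hgen]
      exact hθ.pow _
    obtain ⟨x, hx⟩ : ∃ x : 𝓞 K, algebraMap (𝓞 K) K x = pb.basis j := ⟨⟨_, hj⟩, rfl⟩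
    rw [Module.Basis.toMatrix_apply, hb, Module.Basis.repr_reindex_apply, ← hx,
      integralBasis_repr_apply]
    exact isIntegral_algebraMap
  obtain ⟨r, hr⟩ := IsIntegrallyClosed.isIntegral_iff.1 hint
  rw [← hr] at h2
  have hne : Algebra.discr ℚ pb.basis ≠ 0 := Algebra.discr_not_zero_of_basis ℚ pb.basis
  have hr0 : r ≠ 0 := by
    rintro rfl
    exact hne (by rw [h2]; simp)
  have habs : |Algebra.discr ℚ pb.basis| =
      |Algebra.norm ℚ (Polynomial.aeval θ (Polynomial.derivative (minpoly ℚ θ)))| := by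
    rw [h1, abs_mul, abs_pow, abs_neg, abs_one, one_pow, one_mul, hgen]
  rw [← habs, h2, abs_mul]
  refine le_mul_of_one_le_left (abs_nonneg _) ?_
  have : (1 : ℤ) ≤ |r ^ 2| := Int.one_le_abs (pow_ne_zero 2 hr0)
  simpa using (show (1 : ℚ) ≤ |((r ^ 2 : ℤ) : ℚ)| by exact_mod_cast this)

/-- The absolute value of `a ± √-d`. -/
lemma norm_sq_of_sub_sq_eq (a d : ℕ) (z : ℂ) (h : (z - a) ^ 2 = -d) :
    ‖z‖ ^ 2 = a ^ 2 + d := by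
  have hre := congrArg Complex.re h
  have him := congrArg Complex.im h
  simp [pow_two] at hre him
  rw [← Complex.normSq_eq_norm_sq, Complex.normSq_apply]
  have h0 : (z.re - a) * z.im = 0 := by linarith
  rcases mul_eq_zero.1 h0 with h | h
  · have : z.re = a := by linarith
    rw [this] at hre ⊢
    nlinarith
  · rw [h] at hre ⊢
    have hd : (0 : ℝ) ≤ d := Nat.cast_nonneg d
    have : (z.re - a) ^ 2 ≤ 0 := by nlinarith
    have h1 : z.re - a = 0 := by nlinarith [sq_nonneg (z.re - a)]
    rw [h1] at hre
    have : z.re = a := by linarith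
    rw [this]
    nlinarith

lemma abs_discr_quartic_le {K : Type*} [Field K] [NumberField K]
    (hK : Module.finrank ℚ K = 4) (a d : ℕ) (θ : K) (hθ : (θ ^ 2 - a) ^ 2 = -d)
    (htop : IntermediateField.adjoin ℚ {θ} = ⊤) :
    |(discr K : ℝ)| ≤ 256 * d ^ 2 * (a ^ 2 + d) := by
  have hint : IsIntegral ℤ θ := by
    have h1 : IsIntegral ℤ (θ ^ 2 - a) := by
      refine IsIntegral.of_pow two_pos ?_
      rw [hθ]
      exact (isIntegral_natCast d).neg
    refine IsIntegral.of_pow two_pos (n := 2) ?_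
    rw [show θ ^ 2 = (θ ^ 2 - a) + a by ring]
    exact h1.add (isIntegral_natCast a)
  have hmin : minpoly ℚ θ = (Polynomial.X ^ 2 - Polynomial.C (a : ℚ)) ^ 2
      + Polynomial.C (d : ℚ) := by
    open Polynomial in
    have hm : ((X ^ 2 - C (a : ℚ)) ^ 2 + C (d : ℚ)).Monic := by monicity!
    have hdeg : ((X ^ 2 - C (a : ℚ)) ^ 2 + C (d : ℚ)).natDegree = 4 := by compute_degree!
    refine (Polynomial.eq_of_monic_of_dvd_of_natDegree_le (minpoly.monic hint.tower_top) hm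
      (minpoly.dvd ℚ θ ?_) ?_).symm
    · rw [map_add, map_pow, map_sub, map_pow, aeval_X, aeval_C, aeval_C, map_natCast, map_natCast,
        hθ, neg_add_cancel]
    rw [hdeg, (Field.primitive_element_iff_minpoly_natDegree_eq ℚ θ).1 htop, hK]
  have h := abs_discr_le_abs_norm θ hint htop
  rw [hmin] at h
  have hder : Polynomial.aeval θ (Polynomial.derivative
      ((Polynomial.X ^ 2 - Polynomial.C (a : ℚ)) ^ 2 + Polynomial.C (d : ℚ))) =
      4 * (θ ^ 2 - a) * θ := by
    simp only [Polynomial.derivative_pow, Polynomial.derivative_X, map_mul, map_sub, map_pow,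
      map_add, Polynomial.aeval_X, map_natCast]
    simp
    ring
  rw [hder] at h
  set M : ℝ := 256 * d ^ 2 * (a ^ 2 + d) with hM
  have hM0 : 0 ≤ M := by positivity
  have hnorm := congrArg norm (Algebra.norm_eq_prod_embeddings ℚ ℂ (4 * (θ ^ 2 - a) * θ))
  rw [norm_prod] at hnorm
  have hσ : ∀ σ : K →ₐ[ℚ] ℂ, ‖σ (4 * (θ ^ 2 - a) * θ)‖ ^ 4 = M := by
    intro σ
    have ht : (σ θ ^ 2 - a) ^ 2 = -d := by
      have := congrArg σ hθ
      simpa using this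
    have h1 := norm_sq_of_sub_sq_eq a d _ ht
    have h2 : ‖σ θ ^ 2 - a‖ ^ 2 = d := by
      rw [← norm_pow, ht]
      simp
    have h3 : ‖σ (4 * (θ ^ 2 - a) * θ)‖ = 4 * ‖σ θ ^ 2 - a‖ * ‖σ θ‖ := by
      rw [map_mul, map_mul, map_sub, map_pow, map_natCast, map_ofNat, norm_mul, norm_mul]
      simp
    rw [norm_pow] at h1
    rw [h3, hM, ← h1, mul_pow, mul_pow, show ‖σ θ ^ 2 - a‖ ^ 4 = (‖σ θ ^ 2 - a‖ ^ 2) ^ 2 by ring, h2]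
    ring
  have hprod : (∏ σ : K →ₐ[ℚ] ℂ, ‖σ (4 * (θ ^ 2 - a) * θ)‖) = M := by
    refine (pow_left_inj₀ (Finset.prod_nonneg fun _ _ => norm_nonneg _) hM0 four_ne_zero).1 ?_
    simp only [← Finset.prod_pow, hσ, Finset.prod_const, Finset.card_univ]
    rw [← hK, AlgHom.card]
  rw [hprod] at hnorm
  have h' : |(discr K : ℝ)| ≤ |((Algebra.norm ℚ (4 * (θ ^ 2 - a) * θ) : ℚ) : ℝ)| := by
    exact_mod_cast h
  refine h'.trans (le_of_eq ?_)
  rw [← hnorm]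
  simp

open IntermediateField

section SquareRoots

variable {F E : Type*} [Field F] [Field E] [Algebra F E]

lemma exists_eq_add_mul_of_mem_sup (K : IntermediateField F E) (s : E) (hs : s ^ 2 ∈ K) {z : E}
    (hz : z ∈ K ⊔ adjoin F {s}) : ∃ u ∈ K, ∃ v ∈ K, z = u + v * s := by
  have hsK : IsAlgebraic K s := by
    refine IsIntegral.isAlgebraic (IsIntegral.of_pow two_pos (n := 2) ?_)
    exact isIntegral_algebraMap (x := (⟨s ^ 2, hs⟩ : K))
  rw [← restrictScalars_adjoin_eq_sup, mem_restrictScalars, ← mem_toSubalgebra,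
    adjoin_simple_toSubalgebra_of_isAlgebraic hsK] at hz
  induction hz using Algebra.adjoin_induction with
  | mem x hx =>
    rw [Set.mem_singleton_iff] at hx
    exact ⟨0, zero_mem _, 1, one_mem _, by rw [hx]; ring⟩
  | algebraMap r => exact ⟨r, r.2, 0, zero_mem _, by simp [IntermediateField.algebraMap_apply]⟩
  | add x y _ _ hx hy =>
    obtain ⟨u, hu, v, hv, rfl⟩ := hx
    obtain ⟨u', hu', v', hv', rfl⟩ := hy
    exact ⟨u + u', add_mem hu hu', v + v', add_mem hv hv', by ring⟩
  | mul x y _ _ hx hy =>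
    obtain ⟨u, hu, v, hv, rfl⟩ := hx
    obtain ⟨u', hu', v', hv', rfl⟩ := hy
    exact ⟨u * u' + v * v' * s ^ 2, add_mem (mul_mem hu hu') (mul_mem (mul_mem hv hv') hs),
      u * v' + v * u', add_mem (mul_mem hu hv') (mul_mem hv hu'), by ring⟩

lemma finrank_sup_adjoin_sqrt (K : IntermediateField F E) (s : E) (hs : s ^ 2 ∈ K) (hsK : s ∉ K) :
    Module.finrank F ↥(K ⊔ adjoin F {s}) = 2 * Module.finrank F K := by
  have hint : IsIntegral K s := by
    refine IsIntegral.of_pow two_pos (n := 2) ?_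
    exact isIntegral_algebraMap (x := (⟨s ^ 2, hs⟩ : K))
  have hdeg : (minpoly K s).natDegree = 2 := by
    refine le_antisymm ?_ ?_
    · have hm : (Polynomial.X ^ 2 - Polynomial.C (⟨s ^ 2, hs⟩ : K)).Monic :=
        Polynomial.monic_X_pow_sub_C _ two_ne_zero
      have := Polynomial.natDegree_le_of_dvd (minpoly.dvd K s
        (p := Polynomial.X ^ 2 - Polynomial.C (⟨s ^ 2, hs⟩ : K))
        (by simp [IntermediateField.algebraMap_apply])) hm.ne_zero
      rwa [Polynomial.natDegree_X_pow_sub_C] at this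
    · rw [minpoly.two_le_natDegree_iff hint]
      rintro ⟨x, rfl⟩
      exact hsK x.2
  have h := Module.finrank_mul_finrank F K (adjoin K {s})
  rw [adjoin.finrank hint, hdeg] at h
  rw [← restrictScalars_adjoin_eq_sup, mul_comm, h]
  rfl

variable {ι : Type*}

/-- An element whose square lies in `k` and which lies in the extension of `k` generated by square
roots is, up to `k`, a product of some of these square roots. -/
lemma exists_eq_mul_prod_of_mem_sup [CharZero E] [DecidableEq ι] (k : IntermediateField F E)
    (s : ι → E) (hs : ∀ i, s i ^ 2 ∈ k) (S : Finset ι) {z : E} (hz2 : z ^ 2 ∈ k)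
    (hz : z ∈ k ⊔ adjoin F (s '' S)) : ∃ T ⊆ S, ∃ w ∈ k, z = w * ∏ i ∈ T, s i := by
  induction S using Finset.induction_on generalizing z with
  | empty => exact ⟨∅, subset_rfl, z, by simpa using hz, by simp⟩
  | insert a S ha ih =>
    have hle : k ≤ k ⊔ adjoin F (s '' S) := le_sup_left
    have of_mem : z ∈ k ⊔ adjoin F (s '' S) →
        ∃ T ⊆ insert a S, ∃ w ∈ k, z = w * ∏ i ∈ T, s i := fun h => by
      obtain ⟨T, hT, h⟩ := ih hz2 h
      exact ⟨T, hT.trans (Finset.subset_insert a S), h⟩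
    rw [Finset.coe_insert, Set.image_insert_eq, Set.insert_eq, Set.union_comm, adjoin_union,
      ← sup_assoc] at hz
    obtain ⟨u, hu, v, hv, rfl⟩ := exists_eq_add_mul_of_mem_sup _ _ (hle (hs a)) hz
    by_cases hsa : s a ∈ k ⊔ adjoin F (s '' S)
    · exact of_mem (add_mem hu (mul_mem hv hsa))
    have huv : u * v = 0 := by
      by_contra h
      refine hsa ?_
      obtain ⟨hu0, hv0⟩ := mul_ne_zero_iff.1 h
      have h2 : s a = ((u + v * s a) ^ 2 - u ^ 2 - v ^ 2 * s a ^ 2) / (2 * (u * v)) := by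
        field_simp
        ring
      rw [h2]
      refine div_mem (sub_mem (sub_mem (hle hz2) (pow_mem hu 2))
        (mul_mem (pow_mem hv 2) (hle (hs a)))) (mul_mem (ofNat_mem _ 2) (mul_mem hu hv))
    rcases mul_eq_zero.1 huv with rfl | rfl
    · have hsa0 : s a ≠ 0 := fun h => hsa (h ▸ zero_mem _)
      have hv2 : v ^ 2 ∈ k := by
        have : v ^ 2 = (0 + v * s a) ^ 2 / s a ^ 2 := by field_simp; ring
        rw [this]
        exact div_mem hz2 (hs a)
      obtain ⟨T, hT, w, hw, h⟩ := ih hv2 hv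
      refine ⟨insert a T, Finset.insert_subset_insert a hT, w, hw, ?_⟩
      rw [Finset.prod_insert (fun h => ha (hT h)), h]
      ring
    · refine of_mem ?_
      simpa using hu

lemma notMem_sup_of_prod_notMem [CharZero E] [DecidableEq ι] (k : IntermediateField F E)
    (s : ι → E) (hs : ∀ i, s i ^ 2 ∈ k)
    (hind : ∀ T : Finset ι, T.Nonempty → ∏ i ∈ T, s i ∉ k)
    (S : Finset ι) (a : ι) (ha : a ∉ S) : s a ∉ k ⊔ adjoin F (s '' S) := by
  intro h
  obtain ⟨T, hT, w, hw, e⟩ := exists_eq_mul_prod_of_mem_sup k s hs S (hs a) h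
  have hsa0 : s a ≠ 0 := fun h0 =>
    hind {a} (Finset.singleton_nonempty a) (by simp [h0])
  have hw0 : w ≠ 0 := by
    rintro rfl
    exact hsa0 (by rw [e, zero_mul])
  refine hind (insert a T) (Finset.insert_nonempty a T) ?_
  rw [Finset.prod_insert (fun h => ha (hT h))]
  have : s a * ∏ i ∈ T, s i = s a ^ 2 / w := by
    rw [eq_div_iff hw0, pow_two]
    nth_rewrite 3 [e]
    ring
  rw [this]
  exact div_mem (hs a) hw

lemma finrank_sup_adjoin_sqrts [CharZero E] [DecidableEq ι] (k : IntermediateField F E)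
    (s : ι → E) (hs : ∀ i, s i ^ 2 ∈ k)
    (hind : ∀ T : Finset ι, T.Nonempty → ∏ i ∈ T, s i ∉ k) (S : Finset ι) :
    Module.finrank F ↥(k ⊔ adjoin F (s '' S)) = 2 ^ S.card * Module.finrank F k := by
  induction S using Finset.induction_on with
  | empty => rw [Finset.coe_empty, Set.image_empty, adjoin_empty, sup_bot_eq]; simp
  | insert a S ha ih =>
    rw [Finset.coe_insert, Set.image_insert_eq, Set.insert_eq, Set.union_comm, adjoin_union,
      ← sup_assoc, finrank_sup_adjoin_sqrt _ _ ((le_sup_left : k ≤ _) (hs a))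
        (notMem_sup_of_prod_notMem k s hs hind S a ha), ih, Finset.card_insert_of_notMem ha]
    ring

end SquareRoots

/-- An imaginary quadratic field contains some `√-d` with `d` a positive integer. -/
lemma exists_sq_eq_neg_natCast (k : IntermediateField ℚ ℂ) (hquad : Module.finrank ℚ k = 2)
    (himag : ¬ (k : Set ℂ) ⊆ Set.range Complex.ofReal) :
    ∃ d : ℕ, 0 < d ∧ ∃ δ ∈ k, δ ^ 2 = -(d : ℂ) := by
  obtain ⟨x, hx, hxr⟩ := Set.not_subset.1 himag
  have hfd : FiniteDimensional ℚ k := Module.finite_of_finrank_eq_succ hquad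
  have hdep : ¬ LinearIndependent ℚ ![(1 : k), ⟨x, hx⟩, ⟨x, hx⟩ ^ 2] := by
    intro h
    have := h.fintype_card_le_finrank
    simp [hquad] at this
  obtain ⟨g, hg, hne⟩ := Fintype.not_linearIndependent_iff.1 hdep
  replace hg := congrArg (algebraMap k ℂ) hg
  simp [Fin.sum_univ_three, Algebra.smul_def, IntermediateField.algebraMap_apply] at hg
  have hreal : ∀ y : ℝ, (y : ℂ) ≠ x := fun y h => hxr ⟨y, h⟩
  have h2 : g 2 ≠ 0 := by
    intro h2
    rw [h2] at hg
    by_cases h1 : g 1 = 0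
    · rw [h1] at hg
      obtain ⟨i, hi⟩ := hne
      have h0 : g 0 = 0 := by simpa using hg
      fin_cases i
      · exact hi h0
      · exact hi h1
      · exact hi h2
    · refine hreal (-(g 0) / g 1 : ℝ) ?_
      have h1' : (g 1 : ℂ) ≠ 0 := by exact_mod_cast h1
      push_cast
      rw [div_eq_iff h1']
      linear_combination -hg
  set p : ℚ := g 1 / (2 * g 2) with hp
  set q : ℚ := p ^ 2 - g 0 / g 2 with hq
  have h2' : (g 2 : ℂ) ≠ 0 := by exact_mod_cast h2
  have hsq : (x + p) ^ 2 = q := by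
    rw [hq, hp]
    push_cast
    field_simp
    linear_combination 4 * (g 2 : ℂ) * hg
  have hqneg : q < 0 := by
    by_contra! hq0
    have hsq' : (x + p) ^ 2 = ((√(q : ℝ) : ℝ) : ℂ) ^ 2 := by
      rw [hsq, ← Complex.ofReal_pow, Real.sq_sqrt (by exact_mod_cast hq0)]
      simp
    rcases sq_eq_sq_iff_eq_or_eq_neg.1 hsq' with h | h
    · exact hreal (√q - p) (by push_cast; linear_combination -h)
    · exact hreal (-√q - p) (by push_cast; linear_combination -h)
  refine ⟨(-q.num).toNat * q.den, ?_, q.den * (x + p), ?_, ?_⟩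
  · have := Rat.num_neg.2 hqneg
    have := q.den_pos
    have h3 : 0 < (-q.num).toNat := by omega
    positivity
  · refine mul_mem (_root_.natCast_mem _ _) (add_mem hx ?_)
    exact k.algebraMap_mem p
  · have hnum : (((-q.num).toNat : ℤ)) = -q.num := Int.toNat_of_nonneg (by
      have := Rat.num_neg.2 hqneg
      omega)
    have hnum' : (((-q.num).toNat : ℕ) : ℂ) = -(q.num : ℂ) := by exact_mod_cast hnum
    have hden : (q.den : ℂ) ≠ 0 := by exact_mod_cast q.den_pos.ne'
    push_cast
    rw [mul_pow, hsq, hnum']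
    have hqd : (q : ℂ) * q.den = q.num := by exact_mod_cast Rat.mul_den_eq_num q
    linear_combination (q.den : ℂ) * hqd

section ImaginaryQuadratic

variable {k : IntermediateField ℚ ℂ} {d : ℕ} {δ : ℂ}

lemma re_im_of_sq_eq_neg (hd : 0 < d) (hδ : δ ^ 2 = -(d : ℂ)) : δ.re = 0 ∧ δ.im ≠ 0 := by
  have hre := congrArg Complex.re hδ
  have him := congrArg Complex.im hδ
  simp [pow_two] at hre him
  have hd' : (0 : ℝ) < d := by exact_mod_cast hd
  have him' : δ.im ≠ 0 := by
    intro h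
    rw [h] at hre
    nlinarith [mul_self_nonneg δ.re]
  refine ⟨?_, him'⟩
  have : δ.re * δ.im = 0 := by linarith
  exact (mul_eq_zero.1 this).resolve_right him'

lemma exists_eq_add_mul_of_mem (hquad : Module.finrank ℚ k = 2) (hd : 0 < d)
    (hδ : δ ^ 2 = -(d : ℂ)) (hδk : δ ∈ k) {x : ℂ} (hx : x ∈ k) :
    ∃ u v : ℚ, x = u + v * δ := by
  have hsq : δ ^ 2 ∈ (⊥ : IntermediateField ℚ ℂ) := by
    rw [hδ]
    exact neg_mem (_root_.natCast_mem _ _)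
  have hbot : δ ∉ (⊥ : IntermediateField ℚ ℂ) := by
    intro h
    obtain ⟨r, hr⟩ := IntermediateField.mem_bot.1 h
    refine (re_im_of_sq_eq_neg hd hδ).2 ?_
    rw [← hr]
    simp
  have hfd : FiniteDimensional ℚ k := Module.finite_of_finrank_eq_succ hquad
  have hk : ⊥ ⊔ adjoin ℚ {δ} = k := by
    refine IntermediateField.eq_of_le_of_finrank_eq ?_ ?_
    · exact sup_le bot_le (adjoin_simple_le_iff.2 hδk)
    · rw [finrank_sup_adjoin_sqrt _ _ hsq hbot, hquad, IntermediateField.finrank_bot]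
  rw [← hk] at hx
  obtain ⟨u, hu, v, hv, rfl⟩ := exists_eq_add_mul_of_mem_sup _ _ hsq hx
  obtain ⟨u, rfl⟩ := IntermediateField.mem_bot.1 hu
  obtain ⟨v, rfl⟩ := IntermediateField.mem_bot.1 hv
  exact ⟨u, v, by simp⟩

lemma exists_eq_ratCast_of_im_eq_zero (hquad : Module.finrank ℚ k = 2) (hd : 0 < d)
    (hδ : δ ^ 2 = -(d : ℂ)) (hδk : δ ∈ k) {x : ℂ} (hx : x ∈ k) (him : x.im = 0) :
    ∃ u : ℚ, x = u := by
  obtain ⟨u, v, rfl⟩ := exists_eq_add_mul_of_mem hquad hd hδ hδk hx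
  obtain ⟨_, hδim⟩ := re_im_of_sq_eq_neg hd hδ
  have hv : v = 0 := by
    simpa [hδim] using him
  exact ⟨u, by simp [hv]⟩

lemma conj_mem_of_mem (hquad : Module.finrank ℚ k = 2) (hd : 0 < d)
    (hδ : δ ^ 2 = -(d : ℂ)) (hδk : δ ∈ k) {x : ℂ} (hx : x ∈ k) : starRingEnd ℂ x ∈ k := by
  obtain ⟨u, v, rfl⟩ := exists_eq_add_mul_of_mem hquad hd hδ hδk hx
  obtain ⟨hre, _⟩ := re_im_of_sq_eq_neg hd hδ
  have hconj : starRingEnd ℂ δ = -δ := Complex.ext (by simp [hre]) (by simp)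
  rw [map_add, map_mul, hconj, map_ratCast, map_ratCast]
  exact add_mem (SubfieldClass.ratCast_mem k u) (mul_mem (SubfieldClass.ratCast_mem k v) (neg_mem hδk))

variable {ι : Type*} {a : ι → ℕ} {θ : ι → ℂ}

lemma conj_mul_self_sq (hd : 0 < d) (hδ : δ ^ 2 = -(d : ℂ)) (hθ : ∀ i, θ i ^ 2 = a i + δ)
    (i : ι) : (θ i * starRingEnd ℂ (θ i)) ^ 2 = ((a i ^ 2 + d : ℕ) : ℂ) := by
  obtain ⟨hre, _⟩ := re_im_of_sq_eq_neg hd hδ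
  have hconj : starRingEnd ℂ δ = -δ := Complex.ext (by simp [hre]) (by simp)
  rw [mul_pow, ← map_pow, hθ, map_add, hconj, map_natCast]
  push_cast
  linear_combination -hδ

/-- If the `a i ^ 2 + d` are independent modulo squares, then so are the `a i + √-d` together with
their conjugates. -/
lemma prod_notMem_of_independent [DecidableEq ι] (hquad : Module.finrank ℚ k = 2) (hd : 0 < d)
    (hδ : δ ^ 2 = -(d : ℂ)) (hδk : δ ∈ k) (hθ : ∀ i, θ i ^ 2 = a i + δ)
    (ha : ∀ S : Finset ι, S.Nonempty → ¬ IsSquare (∏ i ∈ S, (a i ^ 2 + d)))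
    (T : Finset (ι ⊕ ι)) (hT : T.Nonempty) :
    ∏ i ∈ T, Sum.elim θ (fun i => starRingEnd ℂ (θ i)) i ∉ k := by
  set ν : ι → ℂ := fun i => θ i * starRingEnd ℂ (θ i) with hν
  have hν2 : ∀ i, ν i ^ 2 = ((a i ^ 2 + d : ℕ) : ℂ) := conj_mul_self_sq hd hδ hθ
  have hνreal : ∀ i, ν i = ((Complex.normSq (θ i) : ℝ) : ℂ) := fun i => Complex.mul_conj (θ i)
  have key : ∀ S : Finset ι, ∏ i ∈ S, ν i ∈ k → S = ∅ := by
    intro S hS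
    by_contra hne
    have him : (∏ i ∈ S, ν i).im = 0 := by
      simp only [hνreal]
      rw [← Complex.ofReal_prod, Complex.ofReal_im]
    obtain ⟨r, hr⟩ := exists_eq_ratCast_of_im_eq_zero hquad hd hδ hδk hS him
    refine ha S (Finset.nonempty_iff_ne_empty.2 hne) ?_
    rw [← Rat.isSquare_natCast_iff]
    refine ⟨r, ?_⟩
    have h : ((∏ i ∈ S, (a i ^ 2 + d) : ℕ) : ℂ) = r * r := by
      rw [← hr, ← pow_two, ← Finset.prod_pow, Nat.cast_prod]
      exact Finset.prod_congr rfl fun i _ => (hν2 i).symm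
    exact_mod_cast h
  intro hw
  set T₁ := T.toLeft with hT₁
  set T₂ := T.toRight with hT₂
  have hT12 : T = T₁.disjSum T₂ := (Finset.toLeft_disjSum_toRight).symm
  rw [hT12, Finset.prod_disjSum] at hw
  simp only [Sum.elim_inl, Sum.elim_inr] at hw
  have hw' := conj_mem_of_mem hquad hd hδ hδk hw
  have hmul : (∏ i ∈ T₁, ν i) * ∏ i ∈ T₂, ν i ∈ k := by
    convert mul_mem hw hw' using 1
    simp only [hν, Finset.prod_mul_distrib, map_mul, map_prod, Complex.conj_conj]
    ring
  set I := T₁ ∩ T₂ with hI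
  have hsub : I ⊆ T₁ ∪ T₂ := Finset.inter_subset_left.trans Finset.subset_union_left
  rw [← Finset.prod_union_inter, ← Finset.prod_sdiff hsub, mul_assoc,
    ← Finset.prod_mul_distrib] at hmul
  have hI0 : ∏ i ∈ I, ν i * ν i = ((∏ i ∈ I, (a i ^ 2 + d) : ℕ) : ℂ) := by
    rw [Nat.cast_prod]
    exact Finset.prod_congr rfl fun i _ => by rw [← hν2, pow_two]
  have hIne : ((∏ i ∈ I, (a i ^ 2 + d) : ℕ) : ℂ) ≠ 0 := by
    rw [Nat.cast_ne_zero]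
    exact Finset.prod_ne_zero_iff.2 fun i _ => by omega
  rw [hI0] at hmul
  have hU : ∏ i ∈ (T₁ ∪ T₂) \ I, ν i ∈ k := by
    rw [← mul_div_cancel_right₀ (∏ i ∈ (T₁ ∪ T₂) \ I, ν i) hIne]
    exact div_mem hmul (_root_.natCast_mem _ _)
  have hUI : T₁ ∪ T₂ ⊆ I := Finset.sdiff_eq_empty_iff_subset.1 (key _ hU)
  have h12 : T₁ = T₂ := le_antisymm
    (Finset.subset_union_left.trans (hUI.trans Finset.inter_subset_right))
    (Finset.subset_union_right.trans (hUI.trans Finset.inter_subset_left))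
  rw [← h12, ← Finset.prod_mul_distrib] at hw
  have h1 := key _ hw
  rw [hT12, ← h12, h1] at hT
  simp at hT

end ImaginaryQuadratic

lemma adjoin_simple_eq_top_of_eq {F E : Type*} [Field F] [Field E] [Algebra F E]
    {K : IntermediateField F E} {x : E} (hx : x ∈ K) (hK : K = adjoin F {x}) :
    adjoin F {(⟨x, hx⟩ : K)} = ⊤ := by
  apply IntermediateField.lift_injective
  rw [IntermediateField.lift_adjoin_simple, IntermediateField.lift_top]
  exact hK.symm

lemma map_mem_of_normal {F E : Type*} [Field F] [Field E] [Algebra F E]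
    {K : IntermediateField F E} (hK : Normal F K) (σ : E →ₐ[F] E) {x : E} (hx : x ∈ K) :
    σ x ∈ K := by
  rw [← AlgHom.fieldRange_of_normal (σ.comp K.val)]
  exact ⟨⟨x, hx⟩, rfl⟩

lemma conjField_sup_adjoin (k : IntermediateField ℚ ℂ) (θ : ℂ) :
    conjField (k ⊔ adjoin ℚ {θ}) = conjField k ⊔ adjoin ℚ {starRingEnd ℂ θ} := by
  rw [conjField, conjField, IntermediateField.map_sup, IntermediateField.adjoin_map,
    Set.image_singleton]
  rfl

/-- Let `k ⊂ ℂ` be an imaginary quadratic field and `ε > 0`.  There is a constant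
`c = c(k,ε) > 0` such that for every `n ≥ 1` there are quadratic extensions
`L₁, …, Lₙ ⊂ ℂ` of `k` such that: (i) no `L_i/ℚ` is Galois; (ii) the compositum of the
`L_i` and their complex conjugates `L_i'` has degree `2^(2n)` over `k`; and (iii) the
absolute discriminants satisfy `|Δ_{L_i}| ≤ c·n^(8+ε)`. -/
theorem exists_quadratic_extensions_small_discriminant
    (k : IntermediateField ℚ ℂ) [NumberField ↥k]
    (hquad : Module.finrank ℚ ↥k = 2)
    (himag : ¬ (k : Set ℂ) ⊆ Set.range (Complex.ofReal))
    (ε : ℝ) (hε : 0 < ε) :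
    ∃ c : ℝ, 0 < c ∧
      ∀ n : ℕ, 1 ≤ n →
        ∃ L : Fin n → IntermediateField ℚ ℂ,
          (∀ i, k ≤ L i) ∧
          (∀ i, Module.finrank ℚ ↥(L i) = 2 * Module.finrank ℚ ↥k) ∧
          (∀ i, ¬ IsGalois ℚ ↥(L i)) ∧
          (Module.finrank ℚ ↥(⨆ i, L i ⊔ conjField (L i)) =
            2 ^ (2 * n) * Module.finrank ℚ ↥k) ∧
          (∀ i, ∀ _ : NumberField ↥(L i),
            |(NumberField.discr ↥(L i) : ℝ)| ≤ c * (n : ℝ) ^ ((8 : ℝ) + ε)) := by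
  obtain ⟨d, hd, δ, hδk, hδ⟩ := exists_sq_eq_neg_natCast k hquad himag
  obtain ⟨C, hC⟩ := exists_independent_le d hd
  refine ⟨256 * d ^ 2 * (C ^ 2 + d), by positivity, fun n hn => ?_⟩
  obtain ⟨a, haC, ha⟩ := hC n hn
  choose θ hθ using fun i => IsAlgClosed.exists_pow_nat_eq ((a i : ℂ) + δ) two_pos
  set s : Fin n ⊕ Fin n → ℂ := Sum.elim θ (fun i => starRingEnd ℂ (θ i)) with hs
  have hind : ∀ T : Finset (Fin n ⊕ Fin n), T.Nonempty → ∏ i ∈ T, s i ∉ k :=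
    prod_notMem_of_independent hquad hd hδ hδk hθ ha
  have hθk : ∀ i, θ i ^ 2 ∈ k := fun i => by
    rw [hθ]
    exact add_mem (_root_.natCast_mem _ _) hδk
  have hsk : ∀ i, s i ^ 2 ∈ k := by
    rintro (i | i)
    · exact hθk i
    · simp only [hs, Sum.elim_inr, ← map_pow]
      exact conj_mem_of_mem hquad hd hδ hδk (hθk i)
  have hdeg : ∀ i, Module.finrank ℚ ↥(k ⊔ adjoin ℚ {θ i}) = 2 * Module.finrank ℚ k := by
    refine fun i => finrank_sup_adjoin_sqrt k _ (hθk i) ?_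
    simpa [hs] using hind {Sum.inl i} (Finset.singleton_nonempty _)
  have hconjk : conjField k ≤ k := by
    rintro _ ⟨x, hx, rfl⟩
    exact conj_mem_of_mem hquad hd hδ hδk hx
  refine ⟨fun i => k ⊔ adjoin ℚ {θ i}, fun i => le_sup_left, hdeg, fun i hgal => ?_, ?_,
    fun i hnf => ?_⟩
  · have hmem : starRingEnd ℂ (θ i) ∈ k ⊔ adjoin ℚ {θ i} :=
      map_mem_of_normal hgal.to_normal (RingHom.toRatAlgHom (starRingEnd ℂ))
        ((le_sup_right : adjoin ℚ {θ i} ≤ _) (mem_adjoin_simple_self ℚ _))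
    refine notMem_sup_of_prod_notMem k s hsk hind {Sum.inl i} (Sum.inr i) (by simp) ?_
    simpa [hs] using hmem
  · have hfield : ⨆ i, (k ⊔ adjoin ℚ {θ i}) ⊔ conjField (k ⊔ adjoin ℚ {θ i}) =
        k ⊔ adjoin ℚ (s '' (Finset.univ : Finset (Fin n ⊕ Fin n))) := by
      apply le_antisymm
      · have hmem : ∀ j, adjoin ℚ {s j} ≤
            k ⊔ adjoin ℚ (s '' (Finset.univ : Finset (Fin n ⊕ Fin n))) := fun j =>
          (adjoin.mono ℚ _ _ (by simp)).trans le_sup_right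
        refine iSup_le fun i => ?_
        rw [conjField_sup_adjoin]
        exact sup_le (sup_le le_sup_left (hmem (Sum.inl i)))
          (sup_le (hconjk.trans le_sup_left) (hmem (Sum.inr i)))
      · refine sup_le ?_ (adjoin_le_iff.2 ?_)
        · exact (le_sup_left.trans le_sup_left).trans
            (le_iSup (fun i => (k ⊔ adjoin ℚ {θ i}) ⊔ conjField (k ⊔ adjoin ℚ {θ i})) ⟨0, hn⟩)
        · rintro _ ⟨j, _, rfl⟩
          rcases j with i | i
          · exact (le_iSup (fun i => (k ⊔ adjoin ℚ {θ i}) ⊔ conjField (k ⊔ adjoin ℚ {θ i})) i)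
              ((le_sup_left : k ⊔ adjoin ℚ {θ i} ≤ _)
                ((le_sup_right : adjoin ℚ {θ i} ≤ _) (mem_adjoin_simple_self ℚ _)))
          · refine (le_iSup (fun i => (k ⊔ adjoin ℚ {θ i}) ⊔ conjField (k ⊔ adjoin ℚ {θ i})) i)
              ((le_sup_right : conjField (k ⊔ adjoin ℚ {θ i}) ≤ _) ?_)
            exact ⟨θ i, (le_sup_right : adjoin ℚ {θ i} ≤ _) (mem_adjoin_simple_self ℚ _), rfl⟩
    rw [hfield, finrank_sup_adjoin_sqrts k s hsk hind, Finset.card_univ, Fintype.card_sum,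
      Fintype.card_fin, two_mul]
  · have hθL : θ i ∈ k ⊔ adjoin ℚ {θ i} :=
      (le_sup_right : adjoin ℚ {θ i} ≤ _) (mem_adjoin_simple_self ℚ _)
    have hkle : k ≤ adjoin ℚ {θ i} := by
      intro x hx
      obtain ⟨u, v, rfl⟩ := exists_eq_add_mul_of_mem hquad hd hδ hδk hx
      have hδθ : δ = θ i ^ 2 - a i := by rw [hθ]; ring
      rw [hδθ]
      exact add_mem (SubfieldClass.ratCast_mem _ u) (mul_mem (SubfieldClass.ratCast_mem _ v)
        (sub_mem (pow_mem (mem_adjoin_simple_self ℚ _) 2) (_root_.natCast_mem _ _)))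
    have hbound := abs_discr_quartic_le (K := ↥(k ⊔ adjoin ℚ {θ i})) (by rw [hdeg, hquad])
      (a i) d ⟨θ i, hθL⟩ (Subtype.ext (by
        push_cast
        rw [hθ, add_sub_cancel_left, hδ])) (adjoin_simple_eq_top_of_eq hθL (sup_eq_right.2 hkle))
    refine hbound.trans ?_
    have hn1 : (1 : ℝ) ≤ n := by exact_mod_cast hn
    have han : (a i : ℝ) ≤ C * n ^ 4 := by exact_mod_cast haC i
    have hn8 : (1 : ℝ) ≤ (n : ℝ) ^ 8 := one_le_pow₀ hn1
    have hpow : (n : ℝ) ^ 8 ≤ (n : ℝ) ^ ((8 : ℝ) + ε) := by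
      rw [← Real.rpow_natCast]
      exact Real.rpow_le_rpow_of_exponent_le hn1 (by push_cast; linarith)
    calc 256 * (d : ℝ) ^ 2 * ((a i : ℝ) ^ 2 + d)
        ≤ 256 * (d : ℝ) ^ 2 * ((C * (n : ℝ) ^ 4) ^ 2 + d * (n : ℝ) ^ 8) := by
          gcongr
          exact le_mul_of_one_le_right (Nat.cast_nonneg d) hn8
      _ = 256 * (d : ℝ) ^ 2 * (C ^ 2 + d) * (n : ℝ) ^ 8 := by ring
      _ ≤ _ := by gcongr
end
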